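/- arXiv:1310.2339 — 2 statements merged into one kernel-verified Lean document; each statement's English description precedes it below -/
import Mathlib

section
/- Suppose a = 0 and b < 0. Then, almost surely, limsup_{t→∞} X(t)/√(2 t log log t) = σ/√3 and liminf_{t→∞} X(t)/√(2 t log log t) = −σ/√3. -/
open MeasureTheory ProbabilityTheory Filter Real Set

noncomputable section

/-- `B` is a standard one-dimensional Brownian motion adapted to the filtration `F`
under the probability measure `P`: all paths are continuous and start at `0`, the
increment `B t - B s` is Gaussian with mean `0` and variance `t - s`, and increments
after time `s` are independent of `F s`. -/
def IsStdBrownian {Ω : Type*} {mΩ : MeasurableSpace Ω} (P : Measure Ω)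
    (F : MeasureTheory.Filtration ℝ mΩ) (B : ℝ → Ω → ℝ) : Prop :=
  MeasureTheory.Adapted F B ∧
  (∀ ω, B 0 ω = 0) ∧
  (∀ ω, Continuous fun t => B t ω) ∧
  (∀ s t : ℝ, 0 ≤ s → s ≤ t →
    P.map (fun ω => B t ω - B s ω) = gaussianReal 0 (Real.toNNReal (t - s))) ∧
  (∀ s t : ℝ, 0 ≤ s → s ≤ t →
    Indep (MeasurableSpace.comap (fun ω => B t ω - B s ω) Real.measurableSpace) (F s) P)

/-- `X` is the (continuous, adapted) solution of the affine stochastic functional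
differential equation `dX(t) = (a X(t) + b/(1+t) ∫_{-1}^t X(s) ds) dt + σ dB(t)` for
`t ≥ 0`, with initial history `ψ` on `[-1, 0]`; i.e. almost surely, for all `t ≥ 0`,
`X t = ψ 0 + ∫_0^t (a X(s) + b/(1+s) (∫_{-1}^0 ψ(u) du + ∫_0^s X(u) du)) ds + σ B t`. -/
def IsSolutionSFDE {Ω : Type*} {mΩ : MeasurableSpace Ω} (P : Measure Ω)
    (F : MeasureTheory.Filtration ℝ mΩ) (a b σ : ℝ) (ψ : ℝ → ℝ)
    (B X : ℝ → Ω → ℝ) : Prop :=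
  (∀ t : ℝ, 0 ≤ t → StronglyMeasurable[F t] (X t)) ∧
  (∀ ω, ContinuousOn (fun t => X t ω) (Set.Ici (0 : ℝ))) ∧
  (∀ᵐ ω ∂P, ∀ t : ℝ, 0 ≤ t →
    X t ω = ψ 0
      + (∫ s in (0:ℝ)..t,
          (a * X s ω + b / (1 + s) * ((∫ u in (-1:ℝ)..(0:ℝ), ψ u) + ∫ u in (0:ℝ)..s, X u ω)))
      + σ * B t ω)

/-- A real process with continuous paths on `[0, ∞)`, started at `0`, adapted to `F`, whose
increments over `[s, t]` are centred Gaussian with variance `v t - v s` and independent of `F s`. -/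
structure HasGaussianIncrements {Ω : Type*} {mΩ : MeasurableSpace Ω} (P : Measure Ω)
    (F : MeasureTheory.Filtration ℝ mΩ) (Y : ℝ → Ω → ℝ) (v : ℝ → ℝ) : Prop where
  zero : ∀ ω, Y 0 ω = 0
  continuousOn : ∀ ω, ContinuousOn (fun t => Y t ω) (Ici 0)
  measurable : ∀ t, 0 ≤ t → Measurable[F t] (Y t)
  variance_zero : v 0 = 0
  variance_mono : ∀ s t, 0 ≤ s → s ≤ t → v s ≤ v t
  law : ∀ s t, 0 ≤ s → s ≤ t →
    P.map (fun ω => Y t ω - Y s ω) = gaussianReal 0 (Real.toNNReal (v t - v s))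
  indep : ∀ s t, 0 ≤ s → s ≤ t →
    Indep (MeasurableSpace.comap (fun ω => Y t ω - Y s ω) Real.measurableSpace) (F s) P

/-- Equidistant partition points of `[s, t]`. -/
def gridPoint (s t : ℝ) (n i : ℕ) : ℝ := s + i * ((t - s) / (n + 1))

lemma gridPoint_succ_sub (s t : ℝ) (n i : ℕ) :
    gridPoint s t n (i + 1) - gridPoint s t n i = (t - s) / (n + 1) := by
  simp only [gridPoint]; push_cast; ring

lemma gridPoint_mono {s t : ℝ} (hst : s ≤ t) (n : ℕ) : Monotone (gridPoint s t n) := by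
  intro i j hij
  have : (i : ℝ) ≤ j := by exact_mod_cast hij
  have h2 : 0 ≤ (t - s) / ((n : ℝ) + 1) := div_nonneg (by linarith) (by positivity)
  simp only [gridPoint]
  gcongr

@[simp] lemma gridPoint_zero (s t : ℝ) (n : ℕ) : gridPoint s t n 0 = s := by simp [gridPoint]

@[simp] lemma gridPoint_last (s t : ℝ) (n : ℕ) : gridPoint s t n (n + 1) = t := by
  have : (n : ℝ) + 1 ≠ 0 := by positivity
  simp only [gridPoint]; push_cast; field_simp; ring

lemma le_gridPoint {s t : ℝ} (hst : s ≤ t) (n i : ℕ) : s ≤ gridPoint s t n i := by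
  simpa using gridPoint_mono hst n (Nat.zero_le i)

lemma gridPoint_le {s t : ℝ} (hst : s ≤ t) {n i : ℕ} (hi : i ≤ n + 1) : gridPoint s t n i ≤ t := by
  simpa using gridPoint_mono hst n hi

lemma tendsto_mesh (s t : ℝ) : Tendsto (fun n : ℕ => (t - s) / ((n : ℝ) + 1)) atTop (nhds 0) :=
  (tendsto_const_div_atTop_nhds_zero_nat (t - s)).comp (tendsto_add_atTop_nat 1) |>.congr
    fun n => by simp

/-- If the increments of `G` are locally approximated by `g` up to `o(b - a)`, uniformly, then
the corresponding Riemann sums converge to the total increment of `G`. -/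
lemma tendsto_sum_gridPoint {G : ℝ → ℝ} {g : ℝ → ℝ → ℝ} {s t : ℝ} (hst : s ≤ t)
    (h : ∀ ε > 0, ∃ δ > 0, ∀ a b, s ≤ a → a ≤ b → b ≤ t → b - a ≤ δ →
      |G b - G a - g a b| ≤ ε * (b - a)) :
    Tendsto (fun n : ℕ => ∑ i ∈ Finset.range (n + 1),
      g (gridPoint s t n i) (gridPoint s t n (i + 1))) atTop (nhds (G t - G s)) := by
  rw [Metric.tendsto_atTop]
  intro ε hε
  have hpos : 0 < t - s + 1 := by linarith
  obtain ⟨δ, hδ, hG⟩ := h (ε / (t - s + 1)) (by positivity)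
  obtain ⟨N, hN⟩ := eventually_atTop.1 ((tendsto_mesh s t).eventually (gt_mem_nhds hδ))
  refine ⟨N, fun n hn => ?_⟩
  have key : G t - G s = ∑ i ∈ Finset.range (n + 1),
      (G (gridPoint s t n (i + 1)) - G (gridPoint s t n i)) := by
    rw [Finset.sum_range_sub (fun i => G (gridPoint s t n i))]; simp
  rw [dist_comm, Real.dist_eq, key, ← Finset.sum_sub_distrib]
  calc _ ≤ ∑ i ∈ Finset.range (n + 1), ε / (t - s + 1) * ((t - s) / (n + 1)) := by
        refine (Finset.abs_sum_le_sum_abs _ _).trans (Finset.sum_le_sum fun i hi => ?_)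
        have hi' : i + 1 ≤ n + 1 := by have := Finset.mem_range.1 hi; omega
        have := hG _ _ (le_gridPoint hst n i) (gridPoint_mono hst n (Nat.le_succ i))
          (gridPoint_le hst hi') (by rw [gridPoint_succ_sub]; exact (hN n hn).le)
        rwa [gridPoint_succ_sub] at this
    _ = ε * ((t - s) / (t - s + 1)) := by
        have : (n : ℝ) + 1 ≠ 0 := by positivity
        simp only [Finset.sum_const, Finset.card_range, nsmul_eq_mul]; push_cast
        field_simp
    _ < ε * 1 := by
        gcongr
        rw [div_lt_one hpos]; linarith
    _ = ε := mul_one ε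

/-- The Wiener integral `∫₀ᵗ f dB` of a `C¹` integrand, defined pathwise by parts. -/
def wienerIntegral (f f' B : ℝ → ℝ) (t : ℝ) : ℝ := f t * B t - ∫ u in (0:ℝ)..t, f' u * B u

lemma intervalIntegrable_of_continuousOn_Ici {g : ℝ → ℝ} (hg : ContinuousOn g (Ici 0)) {a b : ℝ}
    (ha : 0 ≤ a) (hb : 0 ≤ b) : IntervalIntegrable g volume a b :=
  (hg.mono fun _ hx => (le_min ha hb).trans hx.1).intervalIntegrable

lemma integral_sub_left {g : ℝ → ℝ} (hg : ContinuousOn g (Ici 0)) {a b : ℝ}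
    (ha : 0 ≤ a) (hb : 0 ≤ b) :
    (∫ u in (0:ℝ)..b, g u) - (∫ u in (0:ℝ)..a, g u) = ∫ u in a..b, g u :=
  intervalIntegral.integral_interval_sub_left
    (intervalIntegrable_of_continuousOn_Ici hg le_rfl hb)
    (intervalIntegrable_of_continuousOn_Ici hg le_rfl ha)

lemma continuousOn_integral_Ici {g : ℝ → ℝ} (hg : ContinuousOn g (Ici 0)) :
    ContinuousOn (fun t => ∫ u in (0:ℝ)..t, g u) (Ici 0) := by
  have hg' : Continuous fun x => g (max x 0) :=
    hg.comp_continuous (by fun_prop) fun x => mem_Ici.2 (le_max_right _ _)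
  have := (intervalIntegral.continuous_primitive (μ := volume)
    (fun a b => hg'.intervalIntegrable a b) 0)
  refine this.continuousOn.congr fun t ht => intervalIntegral.integral_congr fun u hu => ?_
  rw [uIcc_of_le ht] at hu
  simp [max_eq_left hu.1]

lemma wienerIntegral_sub_sub {f f' : ℝ → ℝ} (hf : ∀ t, 0 ≤ t → HasDerivAt f (f' t) t)
    (hf' : ContinuousOn f' (Ici 0)) {B : ℝ → ℝ} (hB : Continuous B) {a b : ℝ} (ha : 0 ≤ a) (hab : a ≤ b) :
    wienerIntegral f f' B b - wienerIntegral f f' B a - f a * (B b - B a) =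
      ∫ u in a..b, f' u * (B b - B u) := by
  have hb := ha.trans hab
  have h1 : ∫ u in a..b, f' u = f b - f a :=
    intervalIntegral.integral_eq_sub_of_hasDerivAt
      (fun x hx => hf x (by rw [uIcc_of_le hab] at hx; exact ha.trans hx.1))
      (intervalIntegrable_of_continuousOn_Ici hf' ha hb)
  have hfB : ContinuousOn (fun u => f' u * B u) (Ici 0) := hf'.mul hB.continuousOn
  simp_rw [mul_sub]
  rw [intervalIntegral.integral_sub
    ((intervalIntegrable_of_continuousOn_Ici hf' ha hb).mul_const _)
    (intervalIntegrable_of_continuousOn_Ici hfB ha hb), intervalIntegral.integral_mul_const, h1,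
    ← integral_sub_left hfB ha hb]
  simp only [wienerIntegral]; ring

lemma tendsto_sum_wienerIntegral {f f' : ℝ → ℝ} (hf : ∀ t, 0 ≤ t → HasDerivAt f (f' t) t)
    (hf' : ContinuousOn f' (Ici 0)) 
    {B : ℝ → ℝ} (hB : Continuous B) {s t : ℝ} (hs : 0 ≤ s)
    (hst : s ≤ t) :
    Tendsto (fun n : ℕ => ∑ i ∈ Finset.range (n + 1),
      f (gridPoint s t n i) * (B (gridPoint s t n (i + 1)) - B (gridPoint s t n i))) atTop
      (nhds (wienerIntegral f f' B t - wienerIntegral f f' B s)) := by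
  refine tendsto_sum_gridPoint (g := fun a b => f a * (B b - B a)) hst fun ε hε => ?_
  have hsub : Icc s t ⊆ Ici 0 := fun x hx => hs.trans hx.1
  obtain ⟨K, hK⟩ := isCompact_Icc.exists_bound_of_continuousOn (hf'.mono hsub)
  have hK0 : 0 ≤ K := (norm_nonneg _).trans (hK s ⟨le_rfl, hst⟩)
  obtain ⟨δ, hδ, hu⟩ := Metric.uniformContinuousOn_iff.1
    (isCompact_Icc.uniformContinuousOn_of_continuous (hB.continuousOn (s := Icc s t)))
    (ε / (K + 1)) (by positivity)
  refine ⟨δ / 2, by positivity, fun a b ha hab hb hd => ?_⟩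
  rw [wienerIntegral_sub_sub hf hf' hB (hs.trans ha) hab, ← Real.norm_eq_abs]
  refine (intervalIntegral.norm_integral_le_of_norm_le_const (C := ε) fun u hu' => ?_).trans
    (by rw [abs_of_nonneg (sub_nonneg.2 hab)])
  rw [uIoc_of_le hab] at hu'
  have h1 := hK u ⟨ha.trans hu'.1.le, hu'.2.trans hb⟩
  have h2 := (hu b ⟨ha.trans hab, hb⟩ u ⟨ha.trans hu'.1.le, hu'.2.trans hb⟩ (by
    rw [Real.dist_eq, abs_of_nonneg (sub_nonneg.2 hu'.2)]; linarith [hu'.1])).le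
  rw [norm_mul]
  calc _ ≤ K * (ε / (K + 1)) := mul_le_mul h1 (by simpa [Real.dist_eq] using h2) (norm_nonneg _) hK0
    _ ≤ ε := by
      rw [mul_div_assoc', div_le_iff₀ (by positivity)]; nlinarith

lemma tendsto_sum_sq {f f' : ℝ → ℝ} (hf : ∀ t, 0 ≤ t → HasDerivAt f (f' t) t)
    {s t : ℝ} (hs : 0 ≤ s) (hst : s ≤ t) :
    Tendsto (fun n : ℕ => ∑ i ∈ Finset.range (n + 1), f (gridPoint s t n i) ^ 2 *
      (gridPoint s t n (i + 1) - gridPoint s t n i)) atTop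
      (nhds ((∫ u in (0:ℝ)..t, f u ^ 2) - ∫ u in (0:ℝ)..s, f u ^ 2)) := by
  have hfc : ContinuousOn (fun u => f u ^ 2) (Ici 0) := fun x hx =>
    ((hf x hx).continuousAt.pow 2).continuousWithinAt
  refine tendsto_sum_gridPoint (G := fun t => ∫ u in (0:ℝ)..t, f u ^ 2)
    (g := fun a b => f a ^ 2 * (b - a)) hst fun ε hε => ?_
  have hsub : Icc s t ⊆ Ici 0 := fun x hx => hs.trans hx.1
  obtain ⟨δ, hδ, hu⟩ := Metric.uniformContinuousOn_iff.1
    (isCompact_Icc.uniformContinuousOn_of_continuous (hfc.mono hsub)) ε hε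
  refine ⟨δ / 2, by positivity, fun a b ha hab hb hd => ?_⟩
  have ha0 := hs.trans ha
  have hb0 := ha0.trans hab
  have : (∫ u in (0:ℝ)..b, f u ^ 2) - (∫ u in (0:ℝ)..a, f u ^ 2) - f a ^ 2 * (b - a) =
      ∫ u in a..b, (f u ^ 2 - f a ^ 2) := by
    rw [intervalIntegral.integral_sub (intervalIntegrable_of_continuousOn_Ici hfc ha0 hb0) (by simp),
      integral_sub_left hfc ha0 hb0, intervalIntegral.integral_const, smul_eq_mul, mul_comm (b - a)]
  rw [this, ← Real.norm_eq_abs]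
  refine (intervalIntegral.norm_integral_le_of_norm_le_const (C := ε) fun u hu' => ?_).trans
    (by rw [abs_of_nonneg (sub_nonneg.2 hab)])
  rw [uIoc_of_le hab] at hu'
  exact (hu u ⟨ha.trans hu'.1.le, hu'.2.trans hb⟩ a ⟨ha, hab.trans hb⟩ (by
    rw [Real.dist_eq, abs_of_nonneg (sub_nonneg.2 hu'.1.le)]; linarith [hu'.2])).le

section

variable {Ω : Type*} {mΩ : MeasurableSpace Ω} {P : Measure Ω} {F : MeasureTheory.Filtration ℝ mΩ}

lemma indepFun_of_indep_comap {m : MeasurableSpace Ω} {D : Ω → ℝ}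
    (h : Indep (MeasurableSpace.comap D Real.measurableSpace) m P)
    {E : Type*} [MeasurableSpace E] {Z : Ω → E} (hZ : Measurable[m] Z) : IndepFun Z D P := by
  rw [IndepFun_iff_Indep]
  exact (indep_of_indep_of_le_right h hZ.comap_le).symm

lemma integral_indicator_mul_cexp_sum {B : ℝ → Ω → ℝ} (hB : IsStdBrownian P F B) (c : ℕ → ℝ)
    {p : ℕ → ℝ} (hp : Monotone p) (hp0 : 0 ≤ p 0) {A : Set Ω} (hA : MeasurableSet[F (p 0)] A)
    (θ : ℝ) (n : ℕ) :
    ∫ ω, A.indicator (1 : Ω → ℂ) ω * Complex.exp (θ * ((∑ i ∈ Finset.range n,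
        c i * (B (p (i + 1)) ω - B (p i) ω) : ℝ) : ℂ) * Complex.I) ∂P =
      P.real A * Complex.exp (-((∑ i ∈ Finset.range n, c i ^ 2 * (p (i + 1) - p i) : ℝ) : ℂ) *
        θ ^ 2 / 2) := by
  obtain ⟨hBa, -, -, hBl, hBi⟩ := hB
  induction n with
  | zero =>
    have hA' : MeasurableSet A := F.le _ _ hA
    simp [integral_indicator hA']
  | succ n ih =>
    have hpn : 0 ≤ p n := hp0.trans (hp (Nat.zero_le n))
    have hle : p n ≤ p (n + 1) := hp (Nat.le_succ n)
    have hmeasB : ∀ i, i ≤ n → Measurable[F (p n)] (B (p i)) := fun i hi =>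
      (hBa (p i)).mono (F.mono (hp hi)) le_rfl
    have hsum : Measurable[F (p n)] fun ω => ∑ i ∈ Finset.range n,
        c i * (B (p (i + 1)) ω - B (p i) ω) := by
      refine Finset.measurable_sum _ fun i hi => ?_
      have hi' := Finset.mem_range.1 hi
      exact ((hmeasB (i + 1) hi').sub (hmeasB i hi'.le)).const_mul _
    have hZ : Measurable[F (p n)] fun ω => A.indicator (1 : Ω → ℂ) ω *
        Complex.exp (θ * ((∑ i ∈ Finset.range n,
        c i * (B (p (i + 1)) ω - B (p i) ω) : ℝ) : ℂ) * Complex.I) := by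
      refine Measurable.mul (@Measurable.indicator Ω ℂ A 1 (F (p n)) _ _
        (@measurable_const ℂ Ω _ (F (p n)) 1)
        (F.mono (hp (Nat.zero_le n)) _ hA)) ?_
      have : Measurable fun x : ℝ => Complex.exp (θ * (x : ℂ) * Complex.I) := by fun_prop
      exact this.comp hsum
    have hD : Measurable fun ω => B (p (n + 1)) ω - B (p n) ω :=
      ((hBa _).mono (F.le _) le_rfl).sub ((hBa _).mono (F.le _) le_rfl)
    have hφ : Measurable fun x : ℝ => Complex.exp (((θ * c n : ℝ) : ℂ) * (x : ℂ) * Complex.I) := by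
      fun_prop
    have hind := (indepFun_of_indep_comap (hBi _ _ hpn hle) hZ).comp measurable_id hφ
    have hchar : ∫ ω, Complex.exp (((θ * c n : ℝ) : ℂ) *
        ((B (p (n + 1)) ω - B (p n) ω : ℝ) : ℂ) * Complex.I) ∂P =
        Complex.exp (-((p (n + 1) - p n : ℝ) : ℂ) * ((θ * c n : ℝ) : ℂ) ^ 2 / 2) := by
      have := charFun_gaussianReal (μ := 0) (v := Real.toNNReal (p (n + 1) - p n)) (θ * c n)
      rw [← hBl _ _ hpn hle, charFun_apply_real, integral_map hD.aemeasurable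
        hφ.aestronglyMeasurable] at this
      rw [this]
      congr 1
      have h2 : (((Real.toNNReal (p (n + 1) - p n)) : ℝ) : ℂ) = ((p (n + 1) - p n : ℝ) : ℂ) := by
        rw [Real.coe_toNNReal _ (sub_nonneg.2 hle)]
      rw [h2]; push_cast; ring
    have := hind.integral_fun_mul_eq_mul_integral
      (hZ.mono (F.le _) le_rfl).aestronglyMeasurable (hφ.comp hD).aestronglyMeasurable
    simp only [Function.comp_apply, id] at this
    calc _ = _ := by
          refine integral_congr_ae (Eventually.of_forall fun ω => ?_)
          simp only [Finset.sum_range_succ]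
          rw [show ∀ x y : ℝ, (θ : ℂ) * ((x + c n * y : ℝ) : ℂ) * Complex.I =
            θ * (x : ℂ) * Complex.I + ((θ * c n : ℝ) : ℂ) * (y : ℂ) * Complex.I from
            fun x y => by push_cast; ring, Complex.exp_add, ← mul_assoc]
      _ = _ := this
      _ = _ := by
          rw [ih, hchar, mul_assoc, ← Complex.exp_add, Finset.sum_range_succ]
          congr 2
          push_cast; ring

lemma continuousOn_wienerIntegral {f f' B : ℝ → ℝ} (hf : ∀ t, 0 ≤ t → HasDerivAt f (f' t) t)
    (hf' : ContinuousOn f' (Ici 0)) (hB : Continuous B) :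
    ContinuousOn (wienerIntegral f f' B) (Ici 0) :=
  ContinuousOn.sub
    (ContinuousOn.mul (fun x hx => (hf x hx).continuousAt.continuousWithinAt) hB.continuousOn)
    (continuousOn_integral_Ici (hf'.mul hB.continuousOn))

lemma measurable_wienerIntegral {f f' : ℝ → ℝ} (hf : ∀ t, 0 ≤ t → HasDerivAt f (f' t) t)
    (hf' : ContinuousOn f' (Ici 0)) {B : ℝ → Ω → ℝ} (hB : IsStdBrownian P F B)
    {t : ℝ} (ht : 0 ≤ t) :
    Measurable[F t] fun ω => wienerIntegral f f' (fun u => B u ω) t := by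
  obtain ⟨hBa, hB0, hBc, -, -⟩ := hB
  refine @measurable_of_tendsto_metrizable Ω ℝ (F t) _ _ _ _ (fun (n : ℕ) ω => ∑ i ∈ Finset.range (n + 1),
      f (gridPoint 0 t n i) * (B (gridPoint 0 t n (i + 1)) ω - B (gridPoint 0 t n i) ω)) _ ?_ ?_
  · refine fun n => Finset.measurable_sum _ fun i hi => ?_
    have hi' := Finset.mem_range.1 hi
    have h1 := (hBa _).mono (F.mono (gridPoint_le ht (n := n) (i := i + 1) (by omega))) le_rfl
    have h2 := (hBa _).mono (F.mono (gridPoint_le ht (n := n) (i := i) (by omega))) le_rfl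
    exact (h1.sub h2).const_mul _
  · rw [tendsto_pi_nhds]
    intro ω
    have := tendsto_sum_wienerIntegral hf hf' (hBc ω) le_rfl ht
    rwa [show wienerIntegral f f' (fun u => B u ω) 0 = 0 by simp [wienerIntegral, hB0], sub_zero]
      at this

variable [IsProbabilityMeasure P]

lemma integral_indicator_mul_cexp_wienerIntegral {f f' : ℝ → ℝ}
    (hf : ∀ t, 0 ≤ t → HasDerivAt f (f' t) t) (hf' : ContinuousOn f' (Ici 0))
    {B : ℝ → Ω → ℝ} (hB : IsStdBrownian P F B)
    {s t : ℝ} (hs : 0 ≤ s) (hst : s ≤ t) {A : Set Ω} (hA : MeasurableSet[F s] A) (θ : ℝ) :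
    ∫ ω, A.indicator (1 : Ω → ℂ) ω * Complex.exp (θ * ((wienerIntegral f f' (fun u => B u ω) t -
        wienerIntegral f f' (fun u => B u ω) s : ℝ) : ℂ) * Complex.I) ∂P =
      P.real A * Complex.exp (-(((∫ u in (0:ℝ)..t, f u ^ 2) - ∫ u in (0:ℝ)..s, f u ^ 2 : ℝ) : ℂ) *
        θ ^ 2 / 2) := by
  have hA' : MeasurableSet A := F.le _ _ hA
  have hgrid := fun n : ℕ => integral_indicator_mul_cexp_sum hB
    (fun i => f (gridPoint s t n i)) (gridPoint_mono hst n) (by simpa using hs)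
    (A := A) (by rwa [gridPoint_zero]) θ (n + 1)
  refine tendsto_nhds_unique (l := atTop) ?_ (((?_ : Tendsto _ atTop _)).congr fun n => (hgrid n).symm)
  · refine tendsto_integral_of_dominated_convergence (fun _ => 1) (fun n => ?_)
      (integrable_const _) (fun n => Eventually.of_forall fun ω => ?_)
      (Eventually.of_forall fun ω => ?_)
    · refine (((measurable_one.indicator hA').mul ?_)).aestronglyMeasurable
      have h1 : Measurable fun x : ℝ => Complex.exp (θ * (x : ℂ) * Complex.I) := by fun_prop
      refine h1.comp (Finset.measurable_sum _ fun i hi => Measurable.const_mul ?_ _)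
      exact ((hB.1 _).mono (F.le _) le_rfl).sub ((hB.1 _).mono (F.le _) le_rfl)
    · rw [norm_mul, ← Complex.ofReal_mul, Complex.norm_exp_ofReal_mul_I, mul_one]
      by_cases h : ω ∈ A <;> simp [h]
    · refine Tendsto.const_mul _ ?_
      have h1 : Continuous fun x : ℝ => Complex.exp (θ * (x : ℂ) * Complex.I) := by fun_prop
      exact (h1.tendsto _).comp (tendsto_sum_wienerIntegral hf hf' (hB.2.2.1 ω) hs hst)
  · refine Tendsto.const_mul _ ?_
    have h1 : Continuous fun x : ℝ => Complex.exp (-(x : ℂ) * θ ^ 2 / 2) := by fun_prop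
    exact (h1.tendsto _).comp (tendsto_sum_sq hf hs hst)

/-- Wiener integrals of `C¹` functions have independent Gaussian increments. -/
theorem hasGaussianIncrements_wienerIntegral {f f' : ℝ → ℝ}
    (hf : ∀ t, 0 ≤ t → HasDerivAt f (f' t) t) (hf' : ContinuousOn f' (Ici 0))
    {B : ℝ → Ω → ℝ} (hB : IsStdBrownian P F B) :
    HasGaussianIncrements P F (fun t ω => wienerIntegral f f' (fun u => B u ω) t)
      (fun t => ∫ u in (0:ℝ)..t, f u ^ 2) := by
  have hvar : ∀ s t : ℝ, 0 ≤ s → s ≤ t →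
      ∫ u in (0:ℝ)..s, f u ^ 2 ≤ ∫ u in (0:ℝ)..t, f u ^ 2 := fun s t hs hst => by
    have hfc : ContinuousOn (fun u => f u ^ 2) (Ici 0) := fun x hx =>
      ((hf x hx).continuousAt.pow 2).continuousWithinAt
    rw [← sub_nonneg, integral_sub_left hfc hs (hs.trans hst)]
    exact intervalIntegral.integral_nonneg hst fun u _ => sq_nonneg _
  have hmeas : ∀ s t : ℝ, 0 ≤ s → s ≤ t → Measurable fun ω =>
      wienerIntegral f f' (fun u => B u ω) t - wienerIntegral f f' (fun u => B u ω) s :=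
    fun s t hs hst => ((measurable_wienerIntegral hf hf' hB (hs.trans hst)).mono (F.le _) le_rfl).sub
      ((measurable_wienerIntegral hf hf' hB hs).mono (F.le _) le_rfl)
  have hlaw : ∀ s t : ℝ, 0 ≤ s → s ≤ t → ∀ A, MeasurableSet[F s] A →
      (P.restrict A).map (fun ω => wienerIntegral f f' (fun u => B u ω) t -
        wienerIntegral f f' (fun u => B u ω) s) = P A • gaussianReal 0
        (Real.toNNReal ((∫ u in (0:ℝ)..t, f u ^ 2) - ∫ u in (0:ℝ)..s, f u ^ 2)) := by
    intro s t hs hst A hA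
    have : IsFiniteMeasure (P A • gaussianReal 0
        (Real.toNNReal ((∫ u in (0:ℝ)..t, f u ^ 2) - ∫ u in (0:ℝ)..s, f u ^ 2))) :=
      Measure.smul_finite _ (measure_ne_top _ _)
    refine Measure.ext_of_charFun (funext fun θ => ?_)
    have h1 : Measurable fun x : ℝ => Complex.exp (θ * (x : ℂ) * Complex.I) := by fun_prop
    rw [charFun_apply_real (μ := _ • _), integral_smul_measure, ← charFun_apply_real,
      charFun_gaussianReal, charFun_apply_real, integral_map (hmeas s t hs hst).aemeasurable h1.aestronglyMeasurable,
      ← integral_indicator (F.le _ _ hA)]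
    have := integral_indicator_mul_cexp_wienerIntegral hf hf' hB hs hst hA θ
    rw [Real.coe_toNNReal _ (sub_nonneg.2 (hvar s t hs hst))]
    convert this using 1
    · refine integral_congr_ae (Eventually.of_forall fun ω => ?_)
      by_cases h : ω ∈ A <;> simp [h]
    · simp only [Measure.real]
      simp
      exact Or.inl (by ring_nf)
  have hlaw' : ∀ s t : ℝ, 0 ≤ s → s ≤ t →
      P.map (fun ω => wienerIntegral f f' (fun u => B u ω) t -
        wienerIntegral f f' (fun u => B u ω) s) = gaussianReal 0
        (Real.toNNReal ((∫ u in (0:ℝ)..t, f u ^ 2) - ∫ u in (0:ℝ)..s, f u ^ 2)) := by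
    intro s t hs hst
    simpa using hlaw s t hs hst univ MeasurableSet.univ
  refine ⟨fun ω => by simp [wienerIntegral, hB.2.1], fun ω =>
    continuousOn_wienerIntegral hf hf' (hB.2.2.1 ω), fun t ht =>
    measurable_wienerIntegral hf hf' hB ht, by simp, hvar, hlaw', fun s t hs hst => ?_⟩
  rw [Indep_iff]
  rintro _ A ⟨E, hE, rfl⟩ hA
  have hm := hmeas s t hs hst
  have h1 := congrArg (fun μ : Measure ℝ => μ E) (hlaw s t hs hst A hA)
  have h2 := congrArg (fun μ : Measure ℝ => μ E) (hlaw' s t hs hst)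
  simp only [Measure.smul_apply, smul_eq_mul] at h1 h2
  rw [Measure.map_apply hm hE] at h1 h2
  rw [Measure.restrict_apply (hm hE)] at h1
  rw [h1, h2, mul_comm]

end

/-- The discrete filtration obtained by sampling `F` along a monotone sequence of times. -/
def sampledFiltration {Ω : Type*} {mΩ : MeasurableSpace Ω} (F : MeasureTheory.Filtration ℝ mΩ)
    (p : ℕ → ℝ) (hp : Monotone p) : MeasureTheory.Filtration ℕ mΩ where
  seq i := F (p i)
  mono' _ _ hij := F.mono (hp hij)
  le' _ := F.le _

namespace HasGaussianIncrements

variable {Ω : Type*} {mΩ : MeasurableSpace Ω} {P : Measure Ω}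
  {F : MeasureTheory.Filtration ℝ mΩ} {Y : ℝ → Ω → ℝ} {v : ℝ → ℝ}

lemma measurable_sub (h : HasGaussianIncrements P F Y v) {s t : ℝ} (hs : 0 ≤ s) (hst : s ≤ t) :
    Measurable fun ω => Y t ω - Y s ω :=
  ((h.measurable t (hs.trans hst)).mono (F.le _) le_rfl).sub
    ((h.measurable s hs).mono (F.le _) le_rfl)

lemma mgf_sub (h : HasGaussianIncrements P F Y v) {s t : ℝ} (hs : 0 ≤ s) (hst : s ≤ t) (θ : ℝ) :
    ∫ ω, exp (θ * (Y t ω - Y s ω)) ∂P = exp ((v t - v s) * θ ^ 2 / 2) := by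
  have := mgf_gaussianReal (h.law s t hs hst) θ
  rw [mgf, Real.coe_toNNReal _ (sub_nonneg.2 (h.variance_mono s t hs hst))] at this
  simpa using this

lemma neg (h : HasGaussianIncrements P F Y v) :
    HasGaussianIncrements P F (fun t ω => -Y t ω) v := by
  refine ⟨fun ω => by simp [h.zero], fun ω => (h.continuousOn ω).neg,
    fun t ht => (h.measurable t ht).neg, h.variance_zero, h.variance_mono, fun s t hs hst => ?_,
    fun s t hs hst => ?_⟩
  · have : (fun ω => -Y t ω - -Y s ω) = (fun x => -x) ∘ fun ω => Y t ω - Y s ω := by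
      ext ω; simp; ring
    rw [this, ← Measure.map_map measurable_neg (h.measurable_sub hs hst), h.law s t hs hst,
      gaussianReal_map_neg, neg_zero]
  · have : (fun ω => -Y t ω - -Y s ω) = (fun x => -x) ∘ fun ω => Y t ω - Y s ω := by
      ext ω; simp; ring
    rw [this]
    refine indep_of_indep_of_le_left (h.indep s t hs hst) ?_
    rw [← MeasurableSpace.comap_comp]
    exact MeasurableSpace.comap_mono (measurable_neg.comap_le)

lemma integrable_exp (h : HasGaussianIncrements P F Y v) {t : ℝ} (ht : 0 ≤ t) (θ : ℝ) :
    Integrable (fun ω => exp (θ * Y t ω)) P := by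
  have h1 := integrable_exp_mul_gaussianReal (μ := 0) (v := Real.toNNReal (v t - v 0)) θ
  rw [← h.law 0 t le_rfl ht] at h1
  simpa [Function.comp_def, h.zero] using h1.comp_measurable (h.measurable_sub le_rfl ht)

variable [IsProbabilityMeasure P]

lemma submartingale_exp (h : HasGaussianIncrements P F Y v) {p : ℕ → ℝ} (hp : Monotone p)
    (hp0 : 0 ≤ p 0) (θ : ℝ) :
    Submartingale (fun n ω => exp (θ * Y (p n) ω)) (sampledFiltration F p hp) P := by
  have hpos : ∀ n, 0 ≤ p n := fun n => hp0.trans (hp (Nat.zero_le n))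
  have hm : ∀ n, Measurable[F (p n)] fun ω => exp (θ * Y (p n) ω) := fun n =>
    (measurable_exp.comp (measurable_const_mul θ)).comp (h.measurable _ (hpos n))
  refine submartingale_of_setIntegral_le_succ (fun n => (hm n).stronglyMeasurable)
    (fun n => h.integrable_exp (hpos n) θ) fun n A hA => ?_
  have hle : p n ≤ p (n + 1) := hp (Nat.le_succ n)
  have hA' : MeasurableSet A := F.le _ _ hA
  have hZ : Measurable[F (p n)] (A.indicator fun ω => exp (θ * Y (p n) ω)) :=
    @Measurable.indicator Ω ℝ A _ (F (p n)) _ _ (hm n) hA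
  have hφ : Measurable fun x : ℝ => exp (θ * x) := by fun_prop
  have hind := (indepFun_of_indep_comap (h.indep _ _ (hpos n) hle) hZ).comp measurable_id hφ
  have hmul := hind.integral_fun_mul_eq_mul_integral
    (hZ.mono (F.le _) le_rfl).aestronglyMeasurable
    (hφ.comp (h.measurable_sub (hpos n) hle)).aestronglyMeasurable
  simp only [Function.comp_apply, id] at hmul
  rw [h.mgf_sub (hpos n) hle, integral_indicator hA'] at hmul
  have heq : ∫ ω in A, exp (θ * Y (p (n + 1)) ω) ∂P = ∫ ω, A.indicator
      (fun ω => exp (θ * Y (p n) ω)) ω * exp (θ * (Y (p (n + 1)) ω - Y (p n) ω)) ∂P := by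
    rw [← integral_indicator hA']
    refine integral_congr_ae (Eventually.of_forall fun ω => ?_)
    by_cases hω : ω ∈ A
    · simp only [hω, indicator_of_mem, ← exp_add]; ring_nf
    · simp [hω]
  rw [heq, hmul]
  refine le_mul_of_one_le_right (integral_nonneg fun ω => (exp_pos _).le) (one_le_exp ?_)
  have := sub_nonneg.2 (h.variance_mono _ _ (hpos n) hle)
  positivity

lemma measure_exists_grid_le (h : HasGaussianIncrements P F Y v) {T x : ℝ} (hT : 0 ≤ T)
    (hv : 0 < v T) (hx : 0 < x) (n : ℕ) :
    P {ω | ∃ i ≤ n + 1, x ≤ Y (gridPoint 0 T n i) ω} ≤ ENNReal.ofReal (exp (-(x ^ 2 / (2 * v T)))) := by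
  set θ := x / v T with hθ
  have hθ0 : 0 < θ := by positivity
  have hsub := h.submartingale_exp (gridPoint_mono hT n) (by simp) θ
  have hmax := maximal_ineq hsub (fun i ω => (exp_pos _).le)
    (ε := Real.toNNReal (exp (θ * x))) (n + 1)
  rw [Real.coe_toNNReal _ (exp_pos _).le] at hmax
  have hset : {ω | ∃ i ≤ n + 1, x ≤ Y (gridPoint 0 T n i) ω} ⊆ {ω | exp (θ * x) ≤
      (Finset.range (n + 1 + 1)).sup' Finset.nonempty_range_add_one
        fun k => exp (θ * Y (gridPoint 0 T n k) ω)} := by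
    rintro ω ⟨i, hi, hxi⟩
    refine (exp_le_exp.2 (mul_le_mul_of_nonneg_left hxi hθ0.le)).trans
      (Finset.le_sup' (fun k => exp (θ * Y (gridPoint 0 T n k) ω))
        (Finset.mem_range.2 (Nat.lt_succ_of_le hi)))
  have hint : ∫ ω, exp (θ * Y T ω) ∂P = exp (v T * θ ^ 2 / 2) := by
    simpa [h.zero, h.variance_zero] using h.mgf_sub le_rfl hT θ
  have hbound := hmax.trans (ENNReal.ofReal_le_ofReal
    (setIntegral_le_integral (h.integrable_exp (by simpa using hT) θ)
      (Eventually.of_forall fun ω => (exp_pos _).le)))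
  rw [gridPoint_last, hint] at hbound
  have h2 := (mul_le_mul_right (measure_mono hset) _).trans hbound
  have h3 : ENNReal.ofReal (exp (v T * θ ^ 2 / 2)) =
      ENNReal.ofReal (exp (θ * x)) * ENNReal.ofReal (exp (-(x ^ 2 / (2 * v T)))) := by
    rw [← ENNReal.ofReal_mul (exp_pos _).le, ← exp_add, hθ]
    congr 2; field_simp; ring
  rw [h3] at h2
  refine (ENNReal.mul_le_mul_iff_right ?_ ?_).1 h2
  · simpa using exp_pos _
  · simp

/-- Exponential maximal inequality for processes with independent Gaussian increments. -/
lemma measure_exists_lt_le (h : HasGaussianIncrements P F Y v) {T x : ℝ} (hT : 0 ≤ T)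
    (hv : 0 < v T) (hx : 0 < x) :
    P {ω | ∃ t, 0 ≤ t ∧ t ≤ T ∧ x < Y t ω} ≤ ENNReal.ofReal (exp (-(x ^ 2 / (2 * v T)))) := by
  have hT' : 0 < T := by
    rcases hT.eq_or_lt with rfl | h'
    · simp [h.variance_zero] at hv
    · exact h'
  set G : ℕ → Set Ω := fun N => ⋂ n ≥ N, {ω | ∃ i ≤ n + 1, x ≤ Y (gridPoint 0 T n i) ω}
  have hG : Monotone G := fun N M hNM => by
    refine subset_iInter₂ fun n hn => ?_
    exact iInter₂_subset_of_subset n (hNM.trans hn) Subset.rfl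
  have hsub : {ω | ∃ t, 0 ≤ t ∧ t ≤ T ∧ x < Y t ω} ⊆ ⋃ N, G N := by
    rintro ω ⟨t, ht0, htT, hxt⟩
    have hev : ∀ᶠ u in nhdsWithin t (Ici 0), x < Y u ω :=
      ((h.continuousOn ω) t ht0).eventually (lt_mem_nhds hxt)
    obtain ⟨δ, hδ, hball⟩ := Metric.mem_nhdsWithin_iff.1 hev
    obtain ⟨N, hN⟩ := eventually_atTop.1 ((tendsto_mesh 0 T).eventually (gt_mem_nhds hδ))
    refine mem_iUnion.2 ⟨N, mem_iInter₂.2 fun n hn => ?_⟩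
    have hmesh := hN n hn
    rw [sub_zero] at hmesh
    have hm0 : 0 < T / ((n : ℝ) + 1) := by positivity
    refine ⟨⌊t / (T / (n + 1))⌋₊, ?_, (le_of_lt (hball ⟨?_, ?_⟩ :))⟩
    · refine Nat.floor_le_of_le ?_
      rw [div_le_iff₀ hm0]; push_cast; field_simp; exact htT
    · have h1 := Nat.floor_le (div_nonneg ht0 hm0.le)
      have h2 := Nat.lt_floor_add_one (t / (T / ((n : ℝ) + 1)))
      rw [le_div_iff₀ hm0] at h1
      rw [div_lt_iff₀ hm0, add_mul, one_mul] at h2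
      rw [Metric.mem_ball, Real.dist_eq, abs_sub_lt_iff]
      simp only [gridPoint, sub_zero, zero_add]
      constructor <;> linarith
    · exact le_gridPoint hT _ _
  refine (measure_mono hsub).trans ?_
  rw [hG.measure_iUnion]
  exact iSup_le fun N => (measure_mono (iInter₂_subset N le_rfl)).trans
    (h.measure_exists_grid_le hT hv hx N)

end HasGaussianIncrements

/-- A lower bound for the Gaussian tail. -/
lemma le_gaussianReal_Ici {w : ℝ} (hw : 0 < w) {x : ℝ} (hx : 0 ≤ x) :
    ENNReal.ofReal ((√(2 * π))⁻¹ * exp (-((x / √w + 1) ^ 2 / 2))) ≤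
      gaussianReal 0 (Real.toNNReal w) (Ici x) := by
  have hw' : Real.toNNReal w ≠ 0 := by simpa using hw
  have hsw : 0 < √w := sqrt_pos.2 hw
  rw [gaussianReal_apply_eq_integral _ hw']
  refine ENNReal.ofReal_le_ofReal ?_
  calc _ = ∫ y in Icc x (x + √w), (√(2 * π * w))⁻¹ * exp (-(x + √w) ^ 2 / (2 * w)) := by
        rw [setIntegral_const, measureReal_def, Real.volume_Icc, ENNReal.toReal_ofReal (by linarith),
          smul_eq_mul, sqrt_mul (by positivity : 0 ≤ 2 * π) w]
        have : (x + √w) ^ 2 / (2 * w) = (x / √w + 1) ^ 2 / 2 := by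
          nth_rewrite 2 [← sq_sqrt hw.le]
          field_simp
        rw [neg_div, this]
        field_simp
        ring
    _ ≤ ∫ y in Icc x (x + √w), gaussianPDFReal 0 (Real.toNNReal w) y := by
        refine setIntegral_mono_on (integrableOn_const (by simp))
          (integrable_gaussianPDFReal _ _).integrableOn measurableSet_Icc fun y hy => ?_
        simp only [gaussianPDFReal, Real.coe_toNNReal _ hw.le, sub_zero]
        have : y ^ 2 ≤ (x + √w) ^ 2 := pow_le_pow_left₀ (hx.trans hy.1) hy.2 2
        gcongr
    _ ≤ _ := setIntegral_mono_set (integrable_gaussianPDFReal _ _).integrableOn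
        (Eventually.of_forall fun y => gaussianPDFReal_nonneg _ _ _)
        (Icc_subset_Ici_self.eventuallyLE)

/-- The iterated-logarithm scale `√(2 t^{3/2} log log t)`. -/
def lilScale (t : ℝ) : ℝ := √(2 * (t * √t) * log (log t))

lemma lilScale_nonneg (t : ℝ) : 0 ≤ lilScale t := sqrt_nonneg _

lemma log_log_nonneg {t : ℝ} (ht : exp 1 ≤ t) : 0 ≤ log (log t) :=
  log_nonneg ((le_log_iff_exp_le ((exp_pos 1).trans_le ht)).2 ht)

lemma log_log_mono {s t : ℝ} (hs : exp 1 ≤ s) (hst : s ≤ t) : log (log s) ≤ log (log t) := by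
  have hs0 : 0 < s := (exp_pos 1).trans_le hs
  have h1 : 1 ≤ log s := (le_log_iff_exp_le hs0).2 hs
  exact log_le_log (by linarith) (log_le_log hs0 hst)

lemma lilScale_le_mul {s t r : ℝ} (hs : exp 1 ≤ s) (hst : s ≤ t) (hr : s ≤ r * t) (hr0 : 0 ≤ r) :
    lilScale s ≤ √(r * √r) * lilScale t := by
  have hs0 : 0 < s := (exp_pos 1).trans_le hs
  rw [lilScale, lilScale, ← sqrt_mul (by positivity)]
  refine sqrt_le_sqrt ?_
  have h1 : √s ≤ √r * √t := by rw [← sqrt_mul hr0]; exact sqrt_le_sqrt hr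
  have h2 := log_log_nonneg hs
  have h3 := log_log_mono hs hst
  have ht0 : 0 < t := hs0.trans_le hst
  calc _ ≤ 2 * ((r * t) * (√r * √t)) * log (log t) := by gcongr
    _ = _ := by ring

lemma lilScale_mono {s t : ℝ} (hs : exp 1 ≤ s) (hst : s ≤ t) : lilScale s ≤ lilScale t := by
  simpa using lilScale_le_mul (r := 1) hs hst (by simpa using hst) zero_le_one

lemma tendsto_log_log_atTop : Tendsto (fun t : ℝ => log (log t)) atTop atTop :=
  tendsto_log_atTop.comp tendsto_log_atTop

lemma summable_ofReal_exp_log_log {l p : ℝ} (hl : 1 < l) (hp : 1 < p) :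
    ∑' k : ℕ, ENNReal.ofReal (exp (-(p * log (log (l ^ (k + 1)))))) ≠ ⊤ := by
  have hlog : 0 < log l := log_pos hl
  have h : Summable fun k : ℕ => (log l) ^ (-p) * ((k + 1 : ℕ) : ℝ) ^ (-p) :=
    ((summable_nat_add_iff 1).2 (Real.summable_nat_rpow.2 (by linarith))).mul_left _
  have heq : ∀ k : ℕ, exp (-(p * log (log (l ^ (k + 1))))) =
      (log l) ^ (-p) * ((k + 1 : ℕ) : ℝ) ^ (-p) := fun k => by
    rw [← mul_rpow hlog.le (by positivity), log_pow, rpow_def_of_pos (by positivity)]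
    congr 1
    rw [mul_comm (log l)]; ring
  simp_rw [heq]
  exact h.tsum_ofReal_ne_top

namespace HasGaussianIncrements

variable {Ω : Type*} {mΩ : MeasurableSpace Ω} {P : Measure Ω} [IsProbabilityMeasure P]
  {F : MeasureTheory.Filtration ℝ mΩ} {Y : ℝ → Ω → ℝ} {v : ℝ → ℝ} {d : ℝ}

lemma ae_eventually_le (h : HasGaussianIncrements P F Y v) (hd : 0 < d)
    (hv : Tendsto (fun t => v t / (t * √t)) atTop (nhds d)) {c : ℝ} (hc : 0 < c) (hcd : d < c ^ 2) :
    ∀ᵐ ω ∂P, ∀ᶠ t in atTop, Y t ω ≤ c * lilScale t := by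
  obtain ⟨l, hl1, hl⟩ : ∃ l : ℝ, 1 < l ∧ d * (l * √l) < c ^ 2 := by
    have hcont : ContinuousAt (fun l : ℝ => d * (l * √l)) 1 := by fun_prop
    have : ∀ᶠ l : ℝ in nhdsWithin 1 (Ioi 1), d * (l * √l) < c ^ 2 :=
      (hcont.eventually (gt_mem_nhds (by simpa using hcd))).filter_mono nhdsWithin_le_nhds
    obtain ⟨l, hl, hl'⟩ := (this.and self_mem_nhdsWithin).exists
    exact ⟨l, hl', hl⟩
  have hl0 : 0 < l := by linarith
  have hll : 0 < l * √l := by positivity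
  obtain ⟨p, hp1, hp⟩ : ∃ p : ℝ, 1 < p ∧ p < c ^ 2 / (d * (l * √l)) :=
    exists_between (by rw [lt_div_iff₀ (by positivity)]; linarith)
  have hpow : Tendsto (fun k : ℕ => l ^ k) atTop atTop := tendsto_pow_atTop_atTop_of_one_lt hl1
  have hdp : d < c ^ 2 / (p * (l * √l)) := by
    rw [lt_div_iff₀ (by positivity)] at hp ⊢; linarith
  have hev : ∀ᶠ k : ℕ in atTop, exp 1 ≤ l ^ k ∧
      0 < v (l ^ (k + 1)) / (l ^ (k + 1) * √(l ^ (k + 1))) ∧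
      v (l ^ (k + 1)) / (l ^ (k + 1) * √(l ^ (k + 1))) < c ^ 2 / (p * (l * √l)) := by
    have h1 := hv.comp (hpow.comp (tendsto_add_atTop_nat 1))
    filter_upwards [hpow.eventually_ge_atTop (exp 1), h1.eventually (lt_mem_nhds hd),
      h1.eventually (gt_mem_nhds hdp)] with k a1 a2 a3
    exact ⟨a1, a2, a3⟩
  obtain ⟨K, hK⟩ := eventually_atTop.1 hev
  set E : ℕ → Set Ω := fun k => {ω | ∃ t, 0 ≤ t ∧ t ≤ l ^ (k + 1) ∧ c * lilScale (l ^ k) < Y t ω}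
  have hE : ∀ k ≥ K, log (log (l ^ k)) ≠ 0 →
      P (E k) ≤ ENNReal.ofReal (exp (-(p * log (log (l ^ k))))) := by
    intro k hk hne
    obtain ⟨a1, a2, a3⟩ := hK k hk
    have hlk : 0 < l ^ k := by positivity
    have hden : 0 < l ^ (k + 1) * √(l ^ (k + 1)) := by positivity
    have hll0 : 0 < log (log (l ^ k)) := lt_of_le_of_ne (log_log_nonneg a1) hne.symm
    have hv0 : 0 < v (l ^ (k + 1)) := (div_pos_iff_of_pos_right hden).1 a2
    have hx : 0 < c * lilScale (l ^ k) := by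
      refine mul_pos hc (sqrt_pos.2 ?_)
      positivity
    refine (h.measure_exists_lt_le (by positivity) hv0 hx).trans
      (ENNReal.ofReal_le_ofReal (exp_le_exp.2 (neg_le_neg ?_)))
    rw [div_lt_div_iff₀ hden (by positivity), pow_succ, sqrt_mul hlk.le] at a3
    rw [le_div_iff₀ (by positivity), mul_pow, lilScale, sq_sqrt (by positivity), pow_succ]
    have h4 : v (l ^ k * l) * p ≤ c ^ 2 * (l ^ k * √(l ^ k)) := by
      refine le_of_mul_le_mul_right ?_ hll
      nlinarith
    nlinarith
  have hEv : ∀ᵐ ω ∂P, ∀ᶠ k in atTop, ω ∉ E (k + 1) := by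
    have hne : ∀ᶠ k : ℕ in atTop, log (log (l ^ k)) ≠ 0 :=
      ((tendsto_log_log_atTop.comp hpow).eventually_gt_atTop 0).mono fun k hk => ne_of_gt hk
    obtain ⟨K', hK'⟩ := eventually_atTop.1 hne
    have hsum : ∑' k, P (E (k + (K + K') + 1)) ≠ ⊤ := by
      refine ne_top_of_le_ne_top ?_ (ENNReal.tsum_le_tsum fun k =>
        hE (k + (K + K') + 1) (by omega) (hK' _ (by omega)))
      exact ne_top_of_le_ne_top (summable_ofReal_exp_log_log hl1 hp1)
        (ENNReal.tsum_comp_le_tsum_of_injective (f := fun k => k + (K + K')) (add_left_injective _)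
          fun k : ℕ => ENNReal.ofReal (exp (-(p * log (log (l ^ (k + 1)))))))
    filter_upwards [ae_eventually_notMem hsum] with ω hω
    obtain ⟨N, hN⟩ := eventually_atTop.1 hω
    refine eventually_atTop.2 ⟨N + (K + K'), fun k hk => ?_⟩
    simpa only [Nat.sub_add_cancel (show K + K' ≤ k by omega)] using hN (k - (K + K')) (by omega)
  filter_upwards [hEv] with ω hω
  obtain ⟨K', hK'⟩ := eventually_atTop.1 hω
  filter_upwards [eventually_ge_atTop (l ^ (K + K' + 1))] with t ht
  have hone : ∀ n : ℕ, 1 ≤ l ^ n := fun n => one_le_pow₀ hl1.le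
  obtain ⟨k, hk1, hk2⟩ := exists_nat_pow_near ((hone _).trans ht) hl1
  have hkK : K + K' + 1 < k + 1 := (pow_lt_pow_iff_right₀ hl1).1 (ht.trans_lt hk2)
  have hk' := hK' (k - 1) (by omega)
  rw [Nat.sub_add_cancel (by omega)] at hk'
  have h0 : 0 ≤ t := by linarith [hone (K + K' + 1)]
  have : Y t ω ≤ c * lilScale (l ^ k) := by
    by_contra hcon
    exact hk' ⟨t, h0, hk2.le, not_le.1 hcon⟩
  refine this.trans (mul_le_mul_of_nonneg_left ?_ hc.le)
  exact lilScale_mono (hK k (by omega)).1 hk1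

/-- Second Borel-Cantelli lemma for the increments along a sequence of times. -/
lemma ae_frequently_le_sub (h : HasGaussianIncrements P F Y v) {p : ℕ → ℝ} (hp : Monotone p)
    (hp0 : 0 ≤ p 0) (x : ℕ → ℝ)
    (hx : ¬ Summable fun k => P.real {ω | x k ≤ Y (p (k + 1)) ω - Y (p k) ω}) :
    ∀ᵐ ω ∂P, ∃ᶠ k in atTop, x k ≤ Y (p (k + 1)) ω - Y (p k) ω := by
  have hpos : ∀ n, 0 ≤ p n := fun n => hp0.trans (hp (Nat.zero_le n))
  set s : ℕ → Set Ω := fun k => Nat.casesOn k ∅ fun k => {ω | x k ≤ Y (p (k + 1)) ω - Y (p k) ω}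
    with hs
  have hmD : ∀ k, Measurable[F (p (k + 1))] fun ω => Y (p (k + 1)) ω - Y (p k) ω := fun k =>
    (h.measurable _ (hpos _)).sub ((h.measurable _ (hpos _)).mono (F.mono (hp k.le_succ)) le_rfl)
  have hsm : ∀ n, MeasurableSet[sampledFiltration F p hp n] (s n) := by
    intro n
    cases n with
    | zero => exact @MeasurableSet.empty _ (_)
    | succ k => exact hmD k measurableSet_Ici
  have hcond : ∀ k, P[(s (k + 1)).indicator (1 : Ω → ℝ) | sampledFiltration F p hp k] =ᵐ[P]
      fun _ => P.real (s (k + 1)) := by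
    intro k
    have hms : MeasurableSet (s (k + 1)) := F.le _ _ (hmD k measurableSet_Ici)
    have hm : Measurable fun ω => Y (p (k + 1)) ω - Y (p k) ω :=
      h.measurable_sub (hpos _) (hp k.le_succ)
    have := condExp_indep_eq (μ := P) (f := (s (k + 1)).indicator (1 : Ω → ℝ)) hm.comap_le
      ((sampledFiltration F p hp).le k) ?_ (h.indep _ _ (hpos _) (hp k.le_succ))
    · rw [integral_indicator_one hms] at this
      exact this
    · refine Measurable.stronglyMeasurable ?_
      refine @Measurable.indicator Ω ℝ _ _ (MeasurableSpace.comap _ Real.measurableSpace) _ _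
        (@measurable_const ℝ Ω _ (_) 1) ⟨Ici (x k), measurableSet_Ici, rfl⟩
  filter_upwards [ae_mem_limsup_atTop_iff P hsm, ae_all_iff.2 hcond] with ω hω hc
  have : ω ∈ limsup s atTop := by
    rw [hω]
    simp_rw [hc]
    exact (not_summable_iff_tendsto_nat_atTop_of_nonneg fun _ => measureReal_nonneg).1 hx
  rw [mem_limsup_iff_frequently_mem] at this
  rw [frequently_atTop] at this ⊢
  intro a
  obtain ⟨b, hb, hb'⟩ := this (a + 1)
  obtain ⟨b, rfl⟩ : ∃ k, b = k + 1 := ⟨b - 1, by omega⟩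
  exact ⟨b, by omega, hb'⟩

lemma tendsto_div_succ_of_tendsto_div_pow {p : ℕ → ℝ} {M α : ℝ} (hM : 1 < M) (hα : 0 < α)
    (hpM : Tendsto (fun k => p k / M ^ k) atTop (nhds α)) :
    Tendsto (fun k => p k / p (k + 1)) atTop (nhds (1 / M)) := by
  have hM0 : 0 < M := by linarith
  have h1 := hpM.div ((hpM.comp (tendsto_add_atTop_nat 1))) hα.ne'
  have h2 := h1.mul_const (1 / M)
  rw [div_self hα.ne', one_mul] at h2
  refine h2.congr fun k => ?_
  simp only [Pi.div_apply, Function.comp_apply, pow_succ]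
  by_cases hk : p (k + 1) = 0
  · simp [hk]
  · field_simp

lemma tendsto_atTop_of_tendsto_div_pow {p : ℕ → ℝ} {M α : ℝ} (hM : 1 < M) (hα : 0 < α)
    (hpM : Tendsto (fun k => p k / M ^ k) atTop (nhds α)) : Tendsto p atTop atTop := by
  have hM0 : 0 < M := by linarith
  refine (hpM.pos_mul_atTop hα (tendsto_pow_atTop_atTop_of_one_lt hM)).congr fun k => ?_
  field_simp

lemma ae_frequently_lilScale_le_sub (h : HasGaussianIncrements P F Y v)
    (hv : Tendsto (fun t => v t / (t * √t)) atTop (nhds d)) {M α : ℝ} (hM : 1 < M) (hα : 0 < α)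
    {p : ℕ → ℝ} (hp : Monotone p) (hp0 : 0 ≤ p 0)
    (hpM : Tendsto (fun k => p k / M ^ k) atTop (nhds α)) {c : ℝ} (hc : 0 < c)
    (hcd : c ^ 2 < d * (1 - 1 / M * √(1 / M))) :
    ∀ᵐ ω ∂P, ∃ᶠ k in atTop, c * lilScale (p (k + 1)) ≤ Y (p (k + 1)) ω - Y (p k) ω := by
  have hpos : ∀ n, 0 ≤ p n := fun n => hp0.trans (hp (Nat.zero_le n))
  have hM0 : 0 < M := by linarith
  refine h.ae_frequently_le_sub hp hp0 _ fun hsum => ?_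
  have hpT := tendsto_atTop_of_tendsto_div_pow hM hα hpM
  have hpT1 := hpT.comp (tendsto_add_atTop_nat 1)
  have hratio := tendsto_div_succ_of_tendsto_div_pow hM hα hpM
  have hw : Tendsto (fun k => (v (p (k + 1)) - v (p k)) / (p (k + 1) * √(p (k + 1)))) atTop
      (nhds (d * (1 - 1 / M * √(1 / M)))) := by
    have h1 := (hv.comp hpT1).sub ((hv.comp hpT).mul (hratio.mul hratio.sqrt))
    rw [show d - d * (1 / M * √(1 / M)) = d * (1 - 1 / M * √(1 / M)) by ring] at h1
    refine h1.congr' ?_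
    filter_upwards [hpT.eventually_gt_atTop 0, hpT1.eventually_gt_atTop 0] with k hk hk1
    simp only [Function.comp_apply] at hk1 ⊢
    have h2 : 0 < √(p k) := sqrt_pos.2 hk
    have h3 : 0 < √(p (k + 1)) := sqrt_pos.2 hk1
    rw [sqrt_div hk.le]
    field_simp
  set D := d * (1 - 1 / M * √(1 / M)) with hD
  have hD0 : 0 < D := lt_of_le_of_lt (sq_nonneg c) hcd
  obtain ⟨ρ, hρ1, hρ2⟩ : ∃ ρ, c ^ 2 / D < ρ ∧ ρ < 1 := exists_between ((div_lt_one hD0).2 hcd)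
  have hρ0 : 0 < ρ := lt_trans (by positivity) hρ1
  have hcρ : c ^ 2 / ρ < D := by
    rw [div_lt_iff₀ hD0] at hρ1
    rw [div_lt_iff₀ hρ0]; linarith
  have hsρ : √ρ < 1 := by rw [sqrt_lt' one_pos]; simpa using hρ2
  obtain ⟨C, hC0, hC⟩ : ∃ C : ℝ, 0 < C ∧ ∀ᶠ k : ℕ in atTop, log (p (k + 1)) ≤ C * (k + 1) := by
    have hl1 : 0 < log (α + 1) := log_pos (by linarith)
    have hl2 : 0 < log M := log_pos hM
    refine ⟨log (α + 1) + log M, by positivity, ?_⟩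
    filter_upwards [(hpM.comp (tendsto_add_atTop_nat 1)).eventually
      (gt_mem_nhds (lt_add_one α)), hpT1.eventually_gt_atTop 0] with k hk hk1
    simp only [Function.comp_apply] at hk hk1
    rw [div_lt_iff₀ (by positivity)] at hk
    have := log_le_log hk1 hk.le
    rw [log_mul (by positivity) (by positivity), log_pow] at this
    push_cast at this
    nlinarith [(Nat.cast_nonneg k : (0:ℝ) ≤ k)]
  have hbig : ∀ᶠ k : ℕ in atTop, (√(2 * π))⁻¹ * C⁻¹ * (1 / ((k : ℝ) + 1)) ≤
      P.real {ω | c * lilScale (p (k + 1)) ≤ Y (p (k + 1)) ω - Y (p k) ω} := by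
    filter_upwards [hC, hw.eventually (lt_mem_nhds hcρ), hpT1.eventually_gt_atTop (exp 1),
      (tendsto_log_log_atTop.comp hpT1).eventually_ge_atTop (1 / (2 * (1 - √ρ) ^ 2))]
      with k h1 h2 h3 h4
    simp only [Function.comp_apply] at h3 h4
    set t := p (k + 1) with ht
    set w := v t - v (p k) with hw
    set ℓ := log (log t) with hℓ
    have ht0 : 0 < t := (exp_pos 1).trans h3
    have htt : 0 < t * √t := by positivity
    have hℓ0 : 0 < ℓ := lt_of_lt_of_le (by have : 0 < 1 - √ρ := by linarith
                                           positivity) h4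
    have hlog : 0 < log t := by
      have := (le_log_iff_exp_le ht0).2 h3.le; linarith
    rw [lt_div_iff₀ htt] at h2
    have hw0 : 0 < w := lt_trans (by positivity) h2
    have hz : c * lilScale t / √w ≤ √(2 * ℓ * ρ) := by
      rw [lilScale, div_le_iff₀ (sqrt_pos.2 hw0), ← sqrt_mul (by positivity)]
      refine le_sqrt_of_sq_le ?_
      rw [mul_pow, sq_sqrt (by positivity)]
      rw [div_mul_eq_mul_div, div_lt_iff₀ hρ0] at h2
      nlinarith
    have hz2 : (c * lilScale t / √w + 1) ^ 2 / 2 ≤ ℓ := by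
      have h5 : 1 ≤ √(2 * ℓ) * (1 - √ρ) := by
        have h1ρ : 0 < 1 - √ρ := by linarith
        rw [← div_le_iff₀ h1ρ]
        refine le_sqrt_of_sq_le ?_
        rw [div_le_iff₀ (by positivity)] at h4
        rw [div_pow, div_le_iff₀ (by positivity)]; linarith
      have h6 : c * lilScale t / √w + 1 ≤ √(2 * ℓ) := by
        rw [sqrt_mul (by positivity)] at hz
        linarith
      have h7 : 0 ≤ c * lilScale t / √w + 1 := by
        have := lilScale_nonneg t
        positivity
      have := pow_le_pow_left₀ h7 h6 2
      rw [sq_sqrt (by positivity)] at this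
      linarith
    have htail := le_gaussianReal_Ici hw0 (x := c * lilScale t)
      (mul_nonneg hc.le (lilScale_nonneg t))
    rw [← h.law _ _ (hpos k) (hp k.le_succ), Measure.map_apply
      (h.measurable_sub (hpos k) (hp k.le_succ)) measurableSet_Ici] at htail
    have htail' := (ENNReal.ofReal_le_iff_le_toReal (measure_ne_top _ _)).1 htail
    refine le_trans ?_ htail'
    rw [mul_assoc]
    refine mul_le_mul_of_nonneg_left ?_ (by positivity)
    calc C⁻¹ * (1 / ((k : ℝ) + 1)) = (C * (k + 1))⁻¹ := by rw [mul_inv, one_div]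
      _ ≤ (log t)⁻¹ := inv_anti₀ hlog h1
      _ = exp (-ℓ) := by rw [exp_neg, hℓ, exp_log hlog]
      _ ≤ _ := exp_le_exp.2 (neg_le_neg hz2)
  have hs2 : Summable fun k : ℕ => (√(2 * π))⁻¹ * C⁻¹ * (1 / ((k : ℝ) + 1)) :=
    Summable.of_norm_bounded_eventually_nat hsum (hbig.mono fun k hk => by
      rwa [Real.norm_of_nonneg (by positivity)])
  have hs3 := (summable_mul_left_iff (by positivity)).1 hs2
  refine Real.not_summable_one_div_natCast ((summable_nat_add_iff 1).1 ?_)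
  simpa using hs3

lemma exists_forall_ae_frequently_lilScale_le (h : HasGaussianIncrements P F Y v) (hd : 0 < d)
    (hv : Tendsto (fun t => v t / (t * √t)) atTop (nhds d)) {c : ℝ} (hc : 0 < c)
    (hcd : c ^ 2 < d) :
    ∀ᶠ M in atTop, ∀ α, 0 < α → ∀ p : ℕ → ℝ, Monotone p → 0 ≤ p 0 →
      Tendsto (fun k => p k / M ^ k) atTop (nhds α) →
      ∀ᵐ ω ∂P, ∃ᶠ k in atTop, c * lilScale (p k) ≤ Y (p k) ω := by
  obtain ⟨c₁, hc1, hc1d⟩ : ∃ c₁, c < c₁ ∧ c₁ < √d := exists_between (lt_sqrt_of_sq_lt hcd)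
  have hc1d' : c₁ ^ 2 < d := (lt_sqrt (by linarith)).1 hc1d
  have hK : d < (√d + 1) ^ 2 := by nlinarith [sq_sqrt hd.le, sqrt_nonneg d]
  have hlim1 : Tendsto (fun M : ℝ => d * (1 - 1 / M * √(1 / M))) atTop (nhds d) := by
    have h1 : Tendsto (fun M : ℝ => 1 / M) atTop (nhds 0) := by
      simpa using tendsto_inv_atTop_zero (𝕜 := ℝ)
    have h2 := ((h1.mul h1.sqrt).const_sub 1).const_mul d
    simpa using h2
  have hlim2 : Tendsto (fun M : ℝ => (√d + 1) * √(2 / M * √(2 / M))) atTop (nhds 0) := by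
    have h1 : Tendsto (fun M : ℝ => 2 / M) atTop (nhds 0) :=
      tendsto_const_nhds.div_atTop tendsto_id
    simpa using ((h1.mul h1.sqrt).sqrt).const_mul (√d + 1)
  filter_upwards [hlim1.eventually (lt_mem_nhds hc1d'),
    hlim2.eventually (gt_mem_nhds (sub_pos.2 hc1)), eventually_gt_atTop 1]
    with M hM1 hM2 hM3 α hα p hp hp0 hpM
  have hM0 : 0 < M := by linarith
  have hpT := tendsto_atTop_of_tendsto_div_pow hM3 hα hpM
  have hratio := tendsto_div_succ_of_tendsto_div_pow hM3 hα hpM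
  filter_upwards [h.ae_frequently_lilScale_le_sub hv hM3 hα hp hp0 hpM (hc.trans hc1) hM1,
    h.neg.ae_eventually_le hd hv (c := √d + 1) (by positivity) hK] with ω hω1 hω2
  have hev : ∀ᶠ k in atTop, c₁ * lilScale (p (k + 1)) ≤ Y (p (k + 1)) ω - Y (p k) ω →
      c * lilScale (p (k + 1)) ≤ Y (p (k + 1)) ω := by
    have h12 : 1 / M < 2 / M := by gcongr; norm_num
    filter_upwards [hpT.eventually hω2, hpT.eventually_ge_atTop (exp 1),
      hratio.eventually (gt_mem_nhds h12)] with k a1 a2 a3 a4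
    have hle := hp k.le_succ
    have hpos : 0 < p (k + 1) := (exp_pos 1).trans_le (a2.trans hle)
    rw [div_lt_iff₀ hpos] at a3
    have h5 := lilScale_le_mul a2 hle a3.le (by positivity)
    have h6 := mul_le_mul_of_nonneg_right hM2.le (lilScale_nonneg (p (k + 1)))
    have h7 := mul_le_mul_of_nonneg_left h5 (by positivity : 0 ≤ √d + 1)
    nlinarith
  have := (hω1.and_eventually hev).mono fun k hk => hk.2 hk.1
  rw [frequently_atTop] at this ⊢
  intro a
  obtain ⟨b, hb, hb'⟩ := this a
  exact ⟨b + 1, by omega, hb'⟩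

end HasGaussianIncrements

/-- The function `t ↦ (1 + t) ^ (1 / 4)`. -/
def fourthRoot (t : ℝ) : ℝ := √√(1 + t)

lemma fourthRoot_pos {t : ℝ} (ht : 0 ≤ t) : 0 < fourthRoot t :=
  sqrt_pos.2 (sqrt_pos.2 (by linarith))

lemma fourthRoot_sq (t : ℝ) : fourthRoot t ^ 2 = √(1 + t) := sq_sqrt (sqrt_nonneg _)

lemma fourthRoot_pow_four {t : ℝ} (ht : 0 ≤ t) : fourthRoot t ^ 4 = 1 + t := by
  rw [show 4 = 2 * 2 from rfl, pow_mul, fourthRoot_sq, sq_sqrt (by linarith)]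

lemma hasDerivAt_fourthRoot {t : ℝ} (ht : 0 ≤ t) :
    HasDerivAt fourthRoot (1 / (4 * fourthRoot t ^ 3)) t := by
  have h1 : HasDerivAt (fun t : ℝ => 1 + t) 1 t := (hasDerivAt_id t).const_add 1
  have h2 := (h1.sqrt (by positivity : 1 + t ≠ 0)).sqrt (sqrt_pos.2 (by positivity)).ne'
  refine h2.congr_deriv ?_
  have := (fourthRoot_pos ht).ne'
  rw [← fourthRoot_sq, sqrt_sq (fourthRoot_pos ht).le]
  field_simp; norm_num

lemma continuous_fourthRoot : Continuous fourthRoot := by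
  unfold fourthRoot; fun_prop

/-- The Wiener integrand `(1 + t) ^ (1 / 4) cos (2 s √(1 + t) - φ)`. -/
def oscKernel (s φ t : ℝ) : ℝ := fourthRoot t * cos (2 * s * fourthRoot t ^ 2 - φ)

/-- The derivative of `oscKernel`. -/
def oscKernelDeriv (s φ t : ℝ) : ℝ :=
  cos (2 * s * fourthRoot t ^ 2 - φ) / (4 * fourthRoot t ^ 3) -
    s / fourthRoot t * sin (2 * s * fourthRoot t ^ 2 - φ)

lemma hasDerivAt_phase (s φ : ℝ) {t : ℝ} (ht : 0 ≤ t) :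
    HasDerivAt (fun t => 2 * s * fourthRoot t ^ 2 - φ) (s / fourthRoot t ^ 2) t := by
  refine ((((hasDerivAt_fourthRoot ht).pow 2).const_mul (2 * s)).sub_const φ).congr_deriv ?_
  have := (fourthRoot_pos ht).ne'
  field_simp; push_cast; ring

lemma hasDerivAt_oscKernel (s φ t : ℝ) (ht : 0 ≤ t) :
    HasDerivAt (oscKernel s φ) (oscKernelDeriv s φ t) t := by
  refine ((hasDerivAt_fourthRoot ht).mul (hasDerivAt_phase s φ ht).cos).congr_deriv ?_
  have := (fourthRoot_pos ht).ne'
  rw [oscKernelDeriv]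
  field_simp; ring

lemma continuousOn_oscKernelDeriv (s φ : ℝ) : ContinuousOn (oscKernelDeriv s φ) (Ici 0) := by
  have h := continuous_fourthRoot
  have h1 : ∀ t ∈ Ici (0:ℝ), fourthRoot t ≠ 0 := fun t ht => (fourthRoot_pos ht).ne'
  unfold oscKernelDeriv
  refine ContinuousOn.sub (ContinuousOn.div (by fun_prop) (by fun_prop) fun t ht => ?_)
    (ContinuousOn.mul (ContinuousOn.div (by fun_prop) (by fun_prop) h1) (by fun_prop))
  exact mul_ne_zero four_ne_zero (pow_ne_zero _ (h1 t ht))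

lemma oscKernel_eq_add (s φ t : ℝ) :
    oscKernel s φ t = cos φ * oscKernel s 0 t + sin φ * oscKernel s (π / 2) t := by
  simp only [oscKernel, cos_sub_pi_div_two, cos_sub _ φ, sub_zero]; ring

lemma oscKernelDeriv_eq_add (s φ t : ℝ) : oscKernelDeriv s φ t =
    cos φ * oscKernelDeriv s 0 t + sin φ * oscKernelDeriv s (π / 2) t := by
  simp only [oscKernelDeriv, cos_sub_pi_div_two, sin_sub_pi_div_two, cos_sub _ φ, sin_sub _ φ,
    sub_zero]
  ring

lemma wienerIntegral_oscKernel_eq_add {B : ℝ → ℝ} (hB : ContinuousOn B (Ici 0)) (s φ : ℝ) {t : ℝ}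
    (ht : 0 ≤ t) : wienerIntegral (oscKernel s φ) (oscKernelDeriv s φ) B t =
      cos φ * wienerIntegral (oscKernel s 0) (oscKernelDeriv s 0) B t +
      sin φ * wienerIntegral (oscKernel s (π / 2)) (oscKernelDeriv s (π / 2)) B t := by
  have hi : ∀ φ c : ℝ, IntervalIntegrable (fun u => c * (oscKernelDeriv s φ u * B u)) volume 0 t :=
    fun φ c => (intervalIntegrable_of_continuousOn_Ici
      ((continuousOn_oscKernelDeriv s φ).mul hB) le_rfl ht).const_mul c
  have h : ∫ u in (0:ℝ)..t, oscKernelDeriv s φ u * B u =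
      cos φ * (∫ u in (0:ℝ)..t, oscKernelDeriv s 0 u * B u) +
      sin φ * ∫ u in (0:ℝ)..t, oscKernelDeriv s (π / 2) u * B u := by
    rw [← intervalIntegral.integral_const_mul, ← intervalIntegral.integral_const_mul,
      ← intervalIntegral.integral_add (hi 0 _) (hi _ _)]
    congr 1; ext u; rw [oscKernelDeriv_eq_add]; ring
  rw [wienerIntegral, h, oscKernel_eq_add]
  simp only [wienerIntegral]
  ring

/-- Variation of constants for `I'' = -s² I / (1 + t) + noise`, in amplitude-phase form. -/
lemma oscillation_identity {x B I : ℝ → ℝ} {s σ x₀ c : ℝ}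
    (hx : ContinuousOn x (Ici 0)) (hB : ContinuousOn B (Ici 0))
    (hI : ∀ t, 0 ≤ t → I t = c + ∫ u in (0:ℝ)..t, x u)
    (heq : ∀ t, 0 ≤ t → x t = x₀ + (∫ u in (0:ℝ)..t, -s ^ 2 / (1 + u) * I u) + σ * B t) (φ : ℝ) :
    ∃ A : ℝ, ∀ t, 0 ≤ t →
      cos (2 * s * fourthRoot t ^ 2 - φ) * (fourthRoot t * x t - I t / (4 * fourthRoot t ^ 3)) +
        sin (2 * s * fourthRoot t ^ 2 - φ) * (s * I t / fourthRoot t) =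
      A + (∫ u in (0:ℝ)..t, 3 * I u / (16 * fourthRoot u ^ 7) * cos (2 * s * fourthRoot u ^ 2 - φ)) +
        σ * wienerIntegral (oscKernel s φ) (oscKernelDeriv s φ) B t := by
  have hr := continuous_fourthRoot
  have hr0 : ∀ t ∈ Ici (0:ℝ), fourthRoot t ≠ 0 := fun t ht => (fourthRoot_pos ht).ne'
  have hIc : ContinuousOn I (Ici 0) :=
    (continuousOn_const.add (continuousOn_integral_Ici hx)).congr hI
  have hgc : ContinuousOn (fun u => -s ^ 2 / (1 + u) * I u) (Ici 0) :=
    (ContinuousOn.div (by fun_prop) (by fun_prop) fun t (ht : 0 ≤ t) => by positivity).mul hIc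
  have hderiv : ∀ g : ℝ → ℝ, ContinuousOn g (Ici 0) → ∀ t, 0 < t →
      HasDerivAt (fun t => ∫ u in (0:ℝ)..t, g u) (g t) t := fun g hg t ht =>
    intervalIntegral.integral_hasDerivAt_right
      (intervalIntegrable_of_continuousOn_Ici hg le_rfl ht.le)
      (hg.mono Ioi_subset_Ici_self |>.stronglyMeasurableAtFilter isOpen_Ioi t ht)
      ((hg t ht.le).continuousAt (Ici_mem_nhds ht))
  have hId : ∀ t, 0 < t → HasDerivAt I (x t) t := fun t ht =>
    ((hderiv x hx t ht).const_add c).congr_of_eventuallyEq <| by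
      filter_upwards [Ioi_mem_nhds ht] with u hu using hI u (le_of_lt hu)
  set V : ℝ → ℝ := fun t => x₀ + ∫ u in (0:ℝ)..t, -s ^ 2 / (1 + u) * I u with hV
  have hVc : ContinuousOn V (Ici 0) := continuousOn_const.add (continuousOn_integral_Ici hgc)
  have hVd : ∀ t, 0 < t → HasDerivAt V (-s ^ 2 / (1 + t) * I t) t := fun t ht =>
    (hderiv _ hgc t ht).const_add x₀
  set T : ℝ → ℝ := fun t =>
    cos (2 * s * fourthRoot t ^ 2 - φ) * (fourthRoot t * V t - I t / (4 * fourthRoot t ^ 3)) +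
      sin (2 * s * fourthRoot t ^ 2 - φ) * (s * I t / fourthRoot t) with hT
  have hTc : ContinuousOn T (Ici 0) := by
    refine ((by fun_prop : ContinuousOn _ _).mul ((hr.continuousOn.mul hVc).sub
      (hIc.div (by fun_prop) fun t ht => ?_))).add ((by fun_prop : ContinuousOn _ _).mul
      ((continuousOn_const.mul hIc).div hr.continuousOn hr0))
    exact mul_ne_zero four_ne_zero (pow_ne_zero _ (hr0 t ht))
  set k : ℝ → ℝ := fun u =>
    3 * I u / (16 * fourthRoot u ^ 7) * cos (2 * s * fourthRoot u ^ 2 - φ) with hk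
  have hkc : ContinuousOn k (Ici 0) := by
    refine ((continuousOn_const.mul hIc).div (by fun_prop) fun t ht => ?_).mul (by fun_prop)
    exact mul_ne_zero (by norm_num) (pow_ne_zero _ (hr0 t ht))
  have hbc : ContinuousOn (fun u => oscKernelDeriv s φ u * B u) (Ici 0) :=
    (continuousOn_oscKernelDeriv s φ).mul hB
  have hTd : ∀ t, 0 < t → HasDerivAt T (k t - σ * (oscKernelDeriv s φ t * B t)) t := by
    intro t ht
    have h0 := hasDerivAt_phase s φ ht.le
    have hρ := hasDerivAt_fourthRoot ht.le
    have hne := hr0 t ht.le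
    have h := (h0.cos.mul ((hρ.mul (hVd t ht)).sub
      ((hId t ht).div ((hρ.pow 3).const_mul 4) (mul_ne_zero four_ne_zero (pow_ne_zero 3 hne))))).add
      (h0.sin.mul (((hId t ht).const_mul s).div hρ hne))
    refine h.congr_deriv ?_
    have hxV : x t = V t + σ * B t := heq t ht.le
    rw [← fourthRoot_pow_four ht.le, hk, oscKernelDeriv, hxV]
    simp only [Pi.pow_apply, Pi.mul_apply, Pi.sub_apply, Pi.div_apply]
    field_simp
    ring
  refine ⟨T 0, fun t ht => ?_⟩
  have hmono : Icc 0 t ⊆ Ici 0 := Icc_subset_Ici_self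
  have hint := intervalIntegral.integral_eq_sub_of_hasDerivAt_of_le ht (hTc.mono hmono)
    (fun u hu => hTd u hu.1) (intervalIntegrable_of_continuousOn_Ici
      (hkc.sub (continuousOn_const.mul hbc)) le_rfl ht)
  rw [intervalIntegral.integral_sub (intervalIntegrable_of_continuousOn_Ici hkc le_rfl ht)
    ((intervalIntegrable_of_continuousOn_Ici hbc le_rfl ht).const_mul σ),
    intervalIntegral.integral_const_mul] at hint
  have hxV : x t = V t + σ * B t := heq t ht
  rw [wienerIntegral, oscKernel, hxV]
  linear_combination -hint

lemma tendsto_fourthRoot_atTop : Tendsto fourthRoot atTop atTop :=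
  tendsto_sqrt_atTop.comp (tendsto_sqrt_atTop.comp (tendsto_atTop_add_const_left _ 1 tendsto_id))

lemma tendsto_lilScale_atTop : Tendsto lilScale atTop atTop := by
  refine tendsto_sqrt_atTop.comp (Tendsto.atTop_mul_atTop₀ ?_ tendsto_log_log_atTop)
  exact (tendsto_id.atTop_mul_atTop₀ tendsto_sqrt_atTop).const_mul_atTop two_pos

lemma tendsto_oscKernel_variance {s : ℝ} (hs : 0 < s) (φ : ℝ) :
    Tendsto (fun t => (∫ u in (0:ℝ)..t, oscKernel s φ u ^ 2) / (t * √t)) atTop (nhds (1 / 3)) := by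
  set H : ℝ → ℝ := fun t => fourthRoot t ^ 6 / 3 +
    fourthRoot t ^ 4 / (4 * s) * sin (2 * (2 * s * fourthRoot t ^ 2 - φ)) with hH
  have hr := continuous_fourthRoot
  have hHd : ∀ t, 0 ≤ t → HasDerivAt H (oscKernel s φ t ^ 2 +
      sin (2 * (2 * s * fourthRoot t ^ 2 - φ)) / (4 * s)) t := by
    intro t ht
    have h0 := hasDerivAt_phase s φ ht
    have hρ := hasDerivAt_fourthRoot ht
    have hne := (fourthRoot_pos ht).ne'
    refine (((hρ.pow 6).div_const 3).add (((hρ.pow 4).div_const (4 * s)).mul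
      (h0.const_mul 2).sin)).congr_deriv ?_
    simp only [Pi.pow_apply]
    rw [oscKernel, mul_pow, cos_sq]
    field_simp; push_cast; ring
  have hkc : Continuous fun u => oscKernel s φ u ^ 2 := by unfold oscKernel; fun_prop
  have hsc : Continuous fun u => sin (2 * (2 * s * fourthRoot u ^ 2 - φ)) / (4 * s) := by fun_prop
  have hint : ∀ t, 0 ≤ t → |(∫ u in (0:ℝ)..t, oscKernel s φ u ^ 2) - fourthRoot t ^ 6 / 3| ≤
      (|H 0| + 1 / (4 * s)) + 1 / (2 * s) * t := by
    intro t ht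
    have h1 := intervalIntegral.integral_eq_sub_of_hasDerivAt
      (fun u hu => hHd u (by rw [uIcc_of_le ht] at hu; exact hu.1))
      ((hkc.add hsc).intervalIntegrable 0 t)
    rw [intervalIntegral.integral_add (hkc.intervalIntegrable _ _)
      (hsc.intervalIntegrable _ _)] at h1
    have h2 : |∫ u in (0:ℝ)..t, sin (2 * (2 * s * fourthRoot u ^ 2 - φ)) / (4 * s)| ≤
        1 / (4 * s) * t := by
      have := intervalIntegral.norm_integral_le_of_norm_le_const (a := 0) (b := t)
        (f := fun u => sin (2 * (2 * s * fourthRoot u ^ 2 - φ)) / (4 * s)) (C := 1 / (4 * s))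
        fun u _ => by
          rw [norm_eq_abs, abs_div, abs_of_pos (by positivity : 0 < 4 * s)]
          gcongr; exact abs_sin_le_one _
      rwa [norm_eq_abs, sub_zero, abs_of_nonneg ht] at this
    have h3 : |fourthRoot t ^ 4 / (4 * s) * sin (2 * (2 * s * fourthRoot t ^ 2 - φ))| ≤
        1 / (4 * s) * (1 + t) := by
      rw [fourthRoot_pow_four ht, abs_mul, abs_of_nonneg (by positivity)]
      calc (1 + t) / (4 * s) * _ ≤ (1 + t) / (4 * s) * 1 := by gcongr; exact abs_sin_le_one _
        _ = _ := by ring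
    have h4 : (∫ u in (0:ℝ)..t, oscKernel s φ u ^ 2) - fourthRoot t ^ 6 / 3 =
        fourthRoot t ^ 4 / (4 * s) * sin (2 * (2 * s * fourthRoot t ^ 2 - φ)) - H 0 -
        ∫ u in (0:ℝ)..t, sin (2 * (2 * s * fourthRoot u ^ 2 - φ)) / (4 * s) := by
      linear_combination h1
    rw [h4]
    refine (abs_sub _ _).trans (le_trans (add_le_add ((abs_sub _ _).trans
      (add_le_add_left h3 _)) h2) (le_of_eq ?_))
    field_simp; ring
  have hlim : Tendsto (fun t : ℝ => fourthRoot t ^ 6 / 3 / (t * √t)) atTop (nhds (1 / 3)) := by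
    have h1 : Tendsto (fun t : ℝ => t⁻¹ + 1) atTop (nhds 1) := by
      simpa using (tendsto_inv_atTop_zero (𝕜 := ℝ)).add_const 1
    have h2 : Tendsto (fun t : ℝ => (t⁻¹ + 1) * √(t⁻¹ + 1) / 3) atTop (nhds (1 / 3)) := by
      simpa using (h1.mul h1.sqrt).div_const 3
    refine h2.congr' ?_
    filter_upwards [eventually_gt_atTop 0] with t ht
    rw [show fourthRoot t ^ 6 = fourthRoot t ^ 4 * fourthRoot t ^ 2 by ring,
      fourthRoot_pow_four ht.le, fourthRoot_sq,
      show t⁻¹ + 1 = (1 + t) / t by field_simp, sqrt_div (by positivity)]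
    field_simp
  have herr : Tendsto (fun t : ℝ => ((|H 0| + 1 / (4 * s)) + 1 / (2 * s) * t) / (t * √t)) atTop
      (nhds 0) := by
    have h1 : Tendsto (fun t : ℝ => (√t)⁻¹) atTop (nhds 0) :=
      tendsto_inv_atTop_zero.comp tendsto_sqrt_atTop
    have h2 := ((tendsto_inv_atTop_zero.const_mul (|H 0| + 1 / (4 * s))).mul h1).add
      (h1.const_mul (1 / (2 * s)))
    simp only [mul_zero, add_zero] at h2
    refine h2.congr' ?_
    filter_upwards [eventually_gt_atTop 0] with t ht
    have : 0 < √t := sqrt_pos.2 ht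
    field_simp
  have hdiff : Tendsto (fun t : ℝ => ((∫ u in (0:ℝ)..t, oscKernel s φ u ^ 2) -
      fourthRoot t ^ 6 / 3) / (t * √t)) atTop (nhds 0) := by
    refine squeeze_zero_norm' ?_ herr
    filter_upwards [eventually_ge_atTop 0] with t ht
    rw [norm_div, norm_eq_abs, norm_eq_abs, abs_of_nonneg (by positivity : 0 ≤ t * √t)]
    gcongr
    exact hint t ht
  simpa using (hdiff.add hlim).congr fun t => by ring

lemma integral_inv_fourthRoot_pow_le {a b : ℝ} (ha : 0 ≤ a) (hab : a ≤ b) :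
    ∫ u in a..b, (fourthRoot u ^ 6)⁻¹ ≤ 2 / fourthRoot a ^ 2 := by
  have hd : ∀ u ∈ uIcc a b, HasDerivAt (fun u => -2 * (fourthRoot u ^ 2)⁻¹)
      ((fourthRoot u ^ 6)⁻¹) u := by
    intro u hu
    rw [uIcc_of_le hab] at hu
    have hu0 := ha.trans hu.1
    have hne := (fourthRoot_pos hu0).ne'
    refine ((((hasDerivAt_fourthRoot hu0).pow 2).inv (pow_ne_zero 2 hne)).const_mul
      (-2)).congr_deriv ?_
    simp only [Pi.pow_apply]
    field_simp; norm_num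
  have hc : ContinuousOn (fun u => (fourthRoot u ^ 6)⁻¹) (Ici 0) :=
    (continuous_fourthRoot.pow 6).continuousOn.inv₀ fun u hu =>
      pow_ne_zero 6 (fourthRoot_pos hu).ne'
  rw [intervalIntegral.integral_eq_sub_of_hasDerivAt hd
    (intervalIntegrable_of_continuousOn_Ici hc ha (ha.trans hab))]
  have := fourthRoot_pos (ha.trans hab)
  rw [div_eq_mul_inv]
  have : 0 ≤ (fourthRoot b ^ 2)⁻¹ := by positivity
  linarith

/-- A Grönwall estimate with the integrable weight `(1 + t) ^ (-3 / 2)`. -/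
lemma eventually_integral_div_le {q : ℝ → ℝ} (hq : ContinuousOn q (Ici 0))
    (hq0 : ∀ t, 0 ≤ t → 0 ≤ q t) {A K D : ℝ} (hA : 0 ≤ A) (hK : 0 ≤ K) (hD : 0 ≤ D)
    (h : ∀ᶠ t in atTop, q t ≤ A + K * (∫ u in (0:ℝ)..t, q u / fourthRoot u ^ 6) +
      D * lilScale t) {ε : ℝ} (hε : 0 < ε) :
    ∀ᶠ t in atTop, ∫ u in (0:ℝ)..t, q u / fourthRoot u ^ 6 ≤ ε * lilScale t := by
  have hr2 : Tendsto (fun t => fourthRoot t ^ 2) atTop atTop :=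
    (tendsto_pow_atTop two_ne_zero).comp tendsto_fourthRoot_atTop
  have hwc : ContinuousOn (fun u => (fourthRoot u ^ 6)⁻¹) (Ici 0) :=
    (continuous_fourthRoot.pow 6).continuousOn.inv₀ fun u hu =>
      pow_ne_zero 6 (fourthRoot_pos hu).ne'
  have hgc : ContinuousOn (fun u => q u / fourthRoot u ^ 6) (Ici 0) := hq.mul hwc
  have hsplit : ∀ a b m : ℝ, 0 ≤ a → a ≤ b → 0 ≤ m → (∀ u ∈ Icc a b, q u ≤ m) →
      ∫ u in (0:ℝ)..b, q u / fourthRoot u ^ 6 ≤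
        (∫ u in (0:ℝ)..a, q u / fourthRoot u ^ 6) + m * (2 / fourthRoot a ^ 2) := by
    intro a b m ha hab hm hqm
    have h1 := integral_sub_left hgc ha (ha.trans hab)
    have h2 : ∫ u in a..b, q u / fourthRoot u ^ 6 ≤ ∫ u in a..b, m * (fourthRoot u ^ 6)⁻¹ := by
      refine intervalIntegral.integral_mono_on hab
        (intervalIntegrable_of_continuousOn_Ici hgc ha (ha.trans hab))
        ((intervalIntegrable_of_continuousOn_Ici hwc ha (ha.trans hab)).const_mul m)
        fun u hu => ?_
      rw [div_eq_mul_inv]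
      have := fourthRoot_pos (ha.trans hu.1)
      gcongr
      exact hqm u hu
    rw [intervalIntegral.integral_const_mul] at h2
    have h3 := mul_le_mul_of_nonneg_left (integral_inv_fourthRoot_pow_le ha hab) hm
    linarith
  obtain ⟨T, hT, hTe, hTK⟩ := ((eventually_forall_ge_atTop.2 h).and ((eventually_ge_atTop (exp 1)).and
    (hr2.eventually_ge_atTop (4 * K + 1)))).exists
  have hT0 : 0 ≤ T := (exp_pos 1).le.trans hTe
  set A' : ℝ := A + K * ∫ u in (0:ℝ)..T, q u / fourthRoot u ^ 6 with hA'
  have hA'0 : 0 ≤ A' := add_nonneg hA <| mul_nonneg hK <|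
    intervalIntegral.integral_nonneg hT0 fun u hu => by
      have := hq0 u hu.1
      have := fourthRoot_pos hu.1
      positivity
  have hqb : ∀ t, T ≤ t → q t ≤ 2 * A' + 2 * D * lilScale t := by
    intro t ht
    obtain ⟨τ, hτ, hmax⟩ := isCompact_Icc.exists_isMaxOn (nonempty_Icc.2 ht)
      (hq.mono (Icc_subset_Ici_self.trans (Ici_subset_Ici.2 hT0)))
    have hτ0 : 0 ≤ τ := hT0.trans hτ.1
    have h1 := hT τ hτ.1
    have h2 := hsplit T τ (q τ) hT0 hτ.1 (hq0 τ hτ0) fun u hu => hmax ⟨hu.1, hu.2.trans hτ.2⟩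
    have h3 : q t ≤ q τ := hmax ⟨ht, le_rfl⟩
    have h4 : lilScale τ ≤ lilScale t := lilScale_mono (hTe.trans hτ.1) hτ.2
    have h5 : K * (q τ * (2 / fourthRoot T ^ 2)) ≤ q τ / 2 := by
      have hp : 0 < fourthRoot T ^ 2 := pow_pos (fourthRoot_pos hT0) 2
      have : K * (2 / fourthRoot T ^ 2) ≤ 1 / 2 := by
        rw [← mul_div_assoc, div_le_iff₀ hp]; linarith
      have := mul_le_mul_of_nonneg_left this (hq0 τ hτ0)
      linarith
    have h6 := mul_le_mul_of_nonneg_left h2 hK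
    have h7 := mul_le_mul_of_nonneg_left h4 hD
    linarith
  obtain ⟨S, hST, hS⟩ := ((eventually_ge_atTop T).and
    (hr2.eventually_ge_atTop ((2 * (2 * D + 1)) / (ε / 2)))).exists
  have hS0 : 0 ≤ S := hT0.trans hST
  filter_upwards [eventually_ge_atTop S, tendsto_lilScale_atTop.eventually_ge_atTop (2 * A'),
    tendsto_lilScale_atTop.eventually_ge_atTop
      ((∫ u in (0:ℝ)..S, q u / fourthRoot u ^ 6) / (ε / 2))] with t ht h1 h2
  have hL := lilScale_nonneg t
  have h3 := hsplit S t ((2 * D + 1) * lilScale t) hS0 ht (by positivity) fun u hu => by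
    have h4 := hqb u (hST.trans hu.1)
    have h5 := mul_le_mul_of_nonneg_left (lilScale_mono (hTe.trans (hST.trans hu.1)) hu.2) hD
    linarith
  have h6 : (2 * D + 1) * (2 / fourthRoot S ^ 2) ≤ ε / 2 := by
    have hp : 0 < fourthRoot S ^ 2 := pow_pos (fourthRoot_pos hS0) 2
    rw [div_le_iff₀ (by positivity)] at hS
    rw [← mul_div_assoc, div_le_iff₀ hp]; linarith
  rw [div_le_iff₀ (by positivity)] at h2
  have h7 := mul_le_mul_of_nonneg_right h6 hL
  linarith

/-- The radially rescaled solution follows the rotating Wiener integral up to `o(lilScale)`. -/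
lemma eventually_abs_sub_le {x B I : ℝ → ℝ} {s σ x₀ c : ℝ} (hs : 0 < s) (hσ : 0 < σ)
    (hx : ContinuousOn x (Ici 0)) (hB : ContinuousOn B (Ici 0))
    (hI : ∀ t, 0 ≤ t → I t = c + ∫ u in (0:ℝ)..t, x u)
    (heq : ∀ t, 0 ≤ t → x t = x₀ + (∫ u in (0:ℝ)..t, -s ^ 2 / (1 + u) * I u) + σ * B t)
    (hW : ∀ φ, φ = 0 ∨ φ = π / 2 → ∀ᶠ t in atTop,
      |wienerIntegral (oscKernel s φ) (oscKernelDeriv s φ) B t| ≤ lilScale t)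
    {ε : ℝ} (hε : 0 < ε) :
    ∀ᶠ t in atTop, |fourthRoot t * x t - σ * wienerIntegral (oscKernel s (2 * s * fourthRoot t ^ 2))
      (oscKernelDeriv s (2 * s * fourthRoot t ^ 2)) B t| ≤ ε * lilScale t := by
  obtain ⟨A₀, h₀⟩ := oscillation_identity hx hB hI heq 0
  obtain ⟨A₁, h₁⟩ := oscillation_identity hx hB hI heq (π / 2)
  simp only [sub_zero] at h₀
  simp only [cos_sub_pi_div_two, sin_sub_pi_div_two] at h₁
  have hIc : ContinuousOn I (Ici 0) :=
    (continuousOn_const.add (continuousOn_integral_Ici hx)).congr hI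
  set q : ℝ → ℝ := fun t => |s * I t / fourthRoot t| with hq
  have hqc : ContinuousOn q (Ici 0) :=
    ((continuousOn_const.mul hIc).div continuous_fourthRoot.continuousOn
      fun t ht => (fourthRoot_pos ht).ne').abs
  have hqd : ContinuousOn (fun u => 3 / (16 * s) * (q u / fourthRoot u ^ 6)) (Ici 0) :=
    continuousOn_const.mul (hqc.div (continuous_fourthRoot.pow 6).continuousOn
      fun t ht => pow_ne_zero 6 (fourthRoot_pos ht).ne')
  have hJ : ∀ t, 0 ≤ t → ∀ g : ℝ → ℝ, (∀ u, |g u| ≤ 1) →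
      |∫ u in (0:ℝ)..t, 3 * I u / (16 * fourthRoot u ^ 7) * g u| ≤
        3 / (16 * s) * ∫ u in (0:ℝ)..t, q u / fourthRoot u ^ 6 := by
    intro t ht g hg
    rw [← intervalIntegral.integral_const_mul, ← norm_eq_abs]
    refine intervalIntegral.norm_integral_le_of_norm_le ht (ae_of_all _ fun u hu => ?_)
      (intervalIntegrable_of_continuousOn_Ici hqd le_rfl ht)
    have hr := fourthRoot_pos hu.1.le
    rw [norm_eq_abs, abs_mul]
    refine (mul_le_of_le_one_right (abs_nonneg _) (hg u)).trans (le_of_eq ?_)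
    simp only [hq, abs_div, abs_mul, abs_of_pos hs, abs_of_pos hr, abs_of_pos (pow_pos hr 7)]
    norm_num
    field_simp
  have hcomb : ∀ t, ∀ a b : ℝ, |cos (2 * s * fourthRoot t ^ 2) * a| ≤ |a| ∧
      |sin (2 * s * fourthRoot t ^ 2) * b| ≤ |b| := fun t a b =>
    ⟨by rw [abs_mul]; exact mul_le_of_le_one_left (abs_nonneg _) (abs_cos_le_one _),
     by rw [abs_mul]; exact mul_le_of_le_one_left (abs_nonneg _) (abs_sin_le_one _)⟩
  have hW₀ := hW 0 (Or.inl rfl)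
  have hW₁ := hW (π / 2) (Or.inr rfl)
  set w₀ := wienerIntegral (oscKernel s 0) (oscKernelDeriv s 0) B
  set w₁ := wienerIntegral (oscKernel s (π / 2)) (oscKernelDeriv s (π / 2)) B
  have hqle : ∀ᶠ t in atTop, q t ≤ (|A₀| + |A₁|) +
      (3 / (8 * s)) * (∫ u in (0:ℝ)..t, q u / fourthRoot u ^ 6) + (2 * σ) * lilScale t := by
    filter_upwards [hW₀, hW₁, eventually_ge_atTop 0] with t hw₀ hw₁ ht
    have e₀ := h₀ t ht
    have e₁ := h₁ t ht
    have j₀ := hJ t ht (fun u => cos (2 * s * fourthRoot u ^ 2)) fun u => abs_cos_le_one _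
    have j₁ := hJ t ht (fun u => sin (2 * s * fourthRoot u ^ 2)) fun u => abs_sin_le_one _
    set J₀ := ∫ u in (0:ℝ)..t, 3 * I u / (16 * fourthRoot u ^ 7) * cos (2 * s * fourthRoot u ^ 2)
    set J₁ := ∫ u in (0:ℝ)..t, 3 * I u / (16 * fourthRoot u ^ 7) * sin (2 * s * fourthRoot u ^ 2)
    have key : s * I t / fourthRoot t =
        sin (2 * s * fourthRoot t ^ 2) * (A₀ + J₀ + σ * w₀ t) -
        cos (2 * s * fourthRoot t ^ 2) * (A₁ + J₁ + σ * w₁ t) := by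
      rw [← e₀, ← e₁]
      linear_combination -(s * I t / fourthRoot t) * sin_sq_add_cos_sq (2 * s * fourthRoot t ^ 2)
    have b₀ : |A₀ + J₀ + σ * w₀ t| ≤ |A₀| + |J₀| + σ * |w₀ t| := by
      simpa [abs_mul, abs_of_pos hσ] using abs_add_three A₀ J₀ (σ * w₀ t)
    have b₁ : |A₁ + J₁ + σ * w₁ t| ≤ |A₁| + |J₁| + σ * |w₁ t| := by
      simpa [abs_mul, abs_of_pos hσ] using abs_add_three A₁ J₁ (σ * w₁ t)
    have m₀ := mul_le_mul_of_nonneg_left hw₀ hσ.le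
    have m₁ := mul_le_mul_of_nonneg_left hw₁ hσ.le
    have e : 3 / (8 * s) * (∫ u in (0:ℝ)..t, q u / fourthRoot u ^ 6) =
      2 * (3 / (16 * s) * (∫ u in (0:ℝ)..t, q u / fourthRoot u ^ 6)) := by ring
    have hqt : q t = |s * I t / fourthRoot t| := rfl
    rw [e, hqt, key]
    have := abs_sub (sin (2 * s * fourthRoot t ^ 2) * (A₀ + J₀ + σ * w₀ t))
      (cos (2 * s * fourthRoot t ^ 2) * (A₁ + J₁ + σ * w₁ t))
    have c₁ := (hcomb t (A₁ + J₁ + σ * w₁ t) (A₀ + J₀ + σ * w₀ t))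
    linarith [c₁.1, c₁.2]
  have hint : ∀ δ : ℝ, 0 < δ → ∀ᶠ t in atTop,
      3 / (16 * s) * (∫ u in (0:ℝ)..t, q u / fourthRoot u ^ 6) ≤ δ * lilScale t := by
    intro δ hδ
    filter_upwards [eventually_integral_div_le hqc (fun t _ => abs_nonneg _) (by positivity)
      (by positivity) (by positivity) hqle (ε := δ * (16 * s / 3)) (by positivity)] with t ht
    calc _ ≤ 3 / (16 * s) * (δ * (16 * s / 3) * lilScale t) := by gcongr
      _ = _ := by field_simp
  have hr2 : Tendsto (fun t => fourthRoot t ^ 2) atTop atTop :=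
    (tendsto_pow_atTop two_ne_zero).comp tendsto_fourthRoot_atTop
  filter_upwards [hqle, hint 1 one_pos, hint (ε / 8) (by positivity), eventually_ge_atTop 0,
    tendsto_lilScale_atTop.eventually_ge_atTop (4 * (|A₀| + |A₁|) / ε + (|A₀| + |A₁|)),
    hr2.eventually_ge_atTop ((3 + 2 * σ) / (ε * s))] with t hq₁ hi₁ hi₂ ht hL hr
  have e₀ := h₀ t ht
  have e₁ := h₁ t ht
  have j₀ := hJ t ht (fun u => cos (2 * s * fourthRoot u ^ 2)) fun u => abs_cos_le_one _
  have j₁ := hJ t ht (fun u => sin (2 * s * fourthRoot u ^ 2)) fun u => abs_sin_le_one _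
  set J₀ := ∫ u in (0:ℝ)..t, 3 * I u / (16 * fourthRoot u ^ 7) * cos (2 * s * fourthRoot u ^ 2)
  set J₁ := ∫ u in (0:ℝ)..t, 3 * I u / (16 * fourthRoot u ^ 7) * sin (2 * s * fourthRoot u ^ 2)
  have hrp := fourthRoot_pos ht
  have hrp2 : 0 < fourthRoot t ^ 2 := pow_pos hrp 2
  have key : fourthRoot t * x t - σ * wienerIntegral (oscKernel s (2 * s * fourthRoot t ^ 2))
      (oscKernelDeriv s (2 * s * fourthRoot t ^ 2)) B t =
      (s * I t / fourthRoot t) / (4 * s * fourthRoot t ^ 2) +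
      cos (2 * s * fourthRoot t ^ 2) * (A₀ + J₀) + sin (2 * s * fourthRoot t ^ 2) * (A₁ + J₁) := by
    rw [wienerIntegral_oscKernel_eq_add hB s _ ht]
    have e₂ : (s * I t / fourthRoot t) / (4 * s * fourthRoot t ^ 2) =
      I t / (4 * fourthRoot t ^ 3) := by field_simp
    rw [e₂]
    change _ - σ * (_ * w₀ t + _ * w₁ t) = _
    linear_combination cos (2 * s * fourthRoot t ^ 2) * e₀ + sin (2 * s * fourthRoot t ^ 2) * e₁ -
      (fourthRoot t * x t - I t / (4 * fourthRoot t ^ 3)) *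
        sin_sq_add_cos_sq (2 * s * fourthRoot t ^ 2)
  have hA : |A₀| + |A₁| ≤ ε / 4 * lilScale t := by
    have : 0 ≤ |A₀| + |A₁| := by positivity
    have : 4 * (|A₀| + |A₁|) / ε ≤ lilScale t := by linarith
    rw [div_le_iff₀ hε] at this
    linarith
  have hqL : q t ≤ (3 + 2 * σ) * lilScale t := by
    have : 0 ≤ 4 * (|A₀| + |A₁|) / ε := by positivity
    have e : 3 / (8 * s) * (∫ u in (0:ℝ)..t, q u / fourthRoot u ^ 6) =
      2 * (3 / (16 * s) * (∫ u in (0:ℝ)..t, q u / fourthRoot u ^ 6)) := by ring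
    rw [e] at hq₁
    linarith
  have hqe : |(s * I t / fourthRoot t) / (4 * s * fourthRoot t ^ 2)| ≤ ε / 4 * lilScale t := by
    rw [abs_div, abs_of_pos (by positivity : 0 < 4 * s * fourthRoot t ^ 2),
      div_le_iff₀ (by positivity)]
    rw [div_le_iff₀ (by positivity)] at hr
    refine hqL.trans ?_
    calc (3 + 2 * σ) * lilScale t ≤ (fourthRoot t ^ 2 * (ε * s)) * lilScale t := by
          gcongr; exact lilScale_nonneg t
      _ = _ := by ring
  rw [key]
  have b₁ := abs_add_three ((s * I t / fourthRoot t) / (4 * s * fourthRoot t ^ 2))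
    (cos (2 * s * fourthRoot t ^ 2) * (A₀ + J₀)) (sin (2 * s * fourthRoot t ^ 2) * (A₁ + J₁))
  have b₂ := hcomb t (A₀ + J₀) (A₁ + J₁)
  have b₃ := abs_add_le A₀ J₀
  have b₄ := abs_add_le A₁ J₁
  have b₅ := mul_nonneg hε.le (lilScale_nonneg t)
  linarith [b₂.1, b₂.2]

lemma exists_phase_close {n : ℕ} (hn : 0 < n) (θ : ℝ) : ∃ j ∈ Finset.range n,
    |cos θ - cos (2 * π * (j / n))| ≤ 2 * π / n ∧ |sin θ - sin (2 * π * (j / n))| ≤ 2 * π / n := by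
  have hn' : (0:ℝ) < n := by exact_mod_cast hn
  set f := Int.fract (θ / (2 * π)) with hf
  have hf0 : 0 ≤ f := Int.fract_nonneg _
  have hf1 : f < 1 := Int.fract_lt_one _
  have hθ : θ = 2 * π * f + ⌊θ / (2 * π)⌋ * (2 * π) := by
    have h := Int.fract_add_floor (θ / (2 * π))
    have hp := pi_pos
    rw [← hf, eq_div_iff (by positivity)] at h
    linarith
  have hj := Nat.floor_le (mul_nonneg hf0 hn'.le)
  have hj' := Nat.lt_floor_add_one (f * n)
  have hd : |2 * π * f - 2 * π * (⌊f * n⌋₊ / n)| ≤ 2 * π / n := by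
    have h1 : 2 * π * f - 2 * π * (⌊f * n⌋₊ / n) = 2 * π / n * (f * n - ⌊f * n⌋₊) := by
      field_simp
    have hp := pi_pos
    rw [h1, abs_mul, abs_of_pos (by positivity), abs_of_nonneg (by linarith)]
    exact mul_le_of_le_one_right (by positivity) (by linarith)
  refine ⟨⌊f * n⌋₊, Finset.mem_range.2 ((Nat.floor_lt (by positivity)).2
    (mul_lt_of_lt_one_left hn' hf1)), ?_, ?_⟩
  · rw [hθ, cos_add_int_mul_two_pi]
    exact (abs_cos_sub_cos_le _ _).trans hd
  · rw [hθ, sin_add_int_mul_two_pi]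
    exact (abs_sin_sub_sin_le _ _).trans hd

lemma lilScale_eq (t : ℝ) : lilScale t = √√t * √(2 * t * log (log t)) := by
  rw [lilScale, ← sqrt_mul (sqrt_nonneg t)]; ring_nf

section Solution

variable {Ω : Type*} {mΩ : MeasurableSpace Ω} {P : Measure Ω}
  {F : MeasureTheory.Filtration ℝ mΩ} {B X : ℝ → Ω → ℝ} {b σ : ℝ} {ψ : ℝ → ℝ}

lemma IsStdBrownian.neg (hB : IsStdBrownian P F B) :
    IsStdBrownian P F (fun t ω => -B t ω) := by
  obtain ⟨hm, h0, hc, hl, hi⟩ := hB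
  have e : ∀ s t, (fun ω => -B t ω - -B s ω) = (fun x => -x) ∘ fun ω => B t ω - B s ω := by
    intro s t; ext ω; simp; ring
  have hd : ∀ s t, Measurable fun ω => B t ω - B s ω := fun s t =>
    ((hm t).mono (F.le _) le_rfl).sub ((hm s).mono (F.le _) le_rfl)
  refine ⟨fun t => (hm t).neg, fun ω => by simp [h0], fun ω => (hc ω).neg, fun s t hs hst => ?_,
    fun s t hs hst => ?_⟩
  · rw [e, ← Measure.map_map measurable_neg (hd s t), hl s t hs hst, gaussianReal_map_neg,
      neg_zero]
  · rw [e]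
    refine indep_of_indep_of_le_left (hi s t hs hst) ?_
    rw [← MeasurableSpace.comap_comp]
    exact MeasurableSpace.comap_mono measurable_neg.comap_le

lemma IsSolutionSFDE.neg {a : ℝ} (hX : IsSolutionSFDE P F a b σ ψ B X) :
    IsSolutionSFDE P F a b σ (fun u => -ψ u) (fun t ω => -B t ω) (fun t ω => -X t ω) := by
  refine ⟨fun t ht => (hX.1 t ht).neg, fun ω => (hX.2.1 ω).neg, ?_⟩
  filter_upwards [hX.2.2] with ω h t ht
  rw [h t ht]
  simp only [intervalIntegral.integral_neg, neg_add, ← mul_neg]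
  congr 2
  rw [← intervalIntegral.integral_neg]
  congr 1; ext u; ring

variable [IsProbabilityMeasure P]

lemma ae_eventually_wienerIntegral_le (hB : IsStdBrownian P F B) {s : ℝ} (hs : 0 < s) (φ : ℝ)
    {c : ℝ} (hc : 0 < c) (hc3 : 1 / 3 < c ^ 2) :
    ∀ᵐ ω ∂P, ∀ᶠ t in atTop,
      |wienerIntegral (oscKernel s φ) (oscKernelDeriv s φ) (fun u => B u ω) t| ≤
        c * lilScale t := by
  have h := hasGaussianIncrements_wienerIntegral (hasDerivAt_oscKernel s φ)
    (continuousOn_oscKernelDeriv s φ) hB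
  have hv := tendsto_oscKernel_variance hs φ
  filter_upwards [h.ae_eventually_le (by norm_num) hv hc hc3,
    h.neg.ae_eventually_le (by norm_num) hv hc hc3] with ω h₁ h₂
  filter_upwards [h₁, h₂] with t ht₁ ht₂
  exact abs_le.2 ⟨by linarith, ht₁⟩

lemma IsSolutionSFDE.ae_eventually_abs_sub_le (hX : IsSolutionSFDE P F 0 b σ ψ B X)
    (hB : IsStdBrownian P F B) (hσ : 0 < σ) (hb : b < 0) :
    ∀ᵐ ω ∂P, ∀ ε > 0, ∀ᶠ t in atTop, |fourthRoot t * X t ω - σ *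
      wienerIntegral (oscKernel √(-b) (2 * √(-b) * fourthRoot t ^ 2))
        (oscKernelDeriv √(-b) (2 * √(-b) * fourthRoot t ^ 2)) (fun u => B u ω) t| ≤
      ε * lilScale t := by
  have hs : 0 < √(-b) := sqrt_pos.2 (by linarith)
  filter_upwards [hX.2.2, ae_eventually_wienerIntegral_le hB hs 0 one_pos (by norm_num),
    ae_eventually_wienerIntegral_le hB hs (π / 2) one_pos (by norm_num)] with ω heq h₀ h₁ ε hε
  simp only [one_mul] at h₀ h₁
  refine eventually_abs_sub_le (x := fun t => X t ω) (x₀ := ψ 0) (c := ∫ u in (-1:ℝ)..0, ψ u) hs hσ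
    (hX.2.1 ω) (hB.2.2.1 ω).continuousOn (fun t _ => rfl) (fun t ht => ?_) ?_ hε
  · rw [heq t ht, sq_sqrt (by linarith), neg_neg]
    simp only [zero_mul, zero_add]
  · rintro φ (rfl | rfl)
    exacts [h₀, h₁]

lemma IsSolutionSFDE.ae_eventually_le (hX : IsSolutionSFDE P F 0 b σ ψ B X)
    (hB : IsStdBrownian P F B) (hσ : 0 < σ) (hb : b < 0) {c : ℝ} (hc : σ / √3 < c) :
    ∀ᵐ ω ∂P, ∀ᶠ t in atTop, X t ω ≤ c * √(2 * t * log (log t)) := by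
  have hs : 0 < √(-b) := sqrt_pos.2 (by linarith)
  have h3 : 0 < √3 := sqrt_pos.2 (by norm_num)
  have hc0 : 0 < c := (div_pos hσ h3).trans hc
  obtain ⟨c', hc', hc'c⟩ := exists_between (show 1 / √3 < c / σ by
    rw [div_lt_div_iff₀ h3 hσ]; rw [div_lt_iff₀ h3] at hc; linarith)
  have hc'0 : 0 < c' := (by positivity : 0 < 1 / √3).trans hc'
  have hc'3 : 1 / 3 < c' ^ 2 := by
    calc (1 : ℝ) / 3 = (1 / √3) ^ 2 := by rw [div_pow, one_pow, sq_sqrt (by norm_num)]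
      _ < c' ^ 2 := by gcongr
  rw [lt_div_iff₀ hσ] at hc'c
  obtain ⟨n, hn0, hn⟩ : ∃ n : ℕ, 0 < n ∧ σ * (2 * (2 * π / n)) ≤ (c - c' * σ) / 2 := by
    have h1 : Tendsto (fun n : ℕ => σ * (2 * (2 * π / n))) atTop (nhds 0) := by
      simpa using ((tendsto_const_div_atTop_nhds_zero_nat (2 * π)).const_mul 2).const_mul σ
    exact ((eventually_gt_atTop 0).and
      (h1.eventually_le_const (show 0 < (c - c' * σ) / 2 by linarith))).exists
  have hall : ∀ᵐ ω ∂P, ∀ j : ℕ, ∀ᶠ t in atTop,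
      |wienerIntegral (oscKernel √(-b) (2 * π * (j / n))) (oscKernelDeriv √(-b) (2 * π * (j / n)))
        (fun u => B u ω) t| ≤ c' * lilScale t :=
    ae_all_iff.2 fun j => ae_eventually_wienerIntegral_le hB hs _ hc'0 hc'3
  filter_upwards [hX.ae_eventually_abs_sub_le hB hσ hb, hall,
    ae_eventually_wienerIntegral_le hB hs 0 one_pos (by norm_num),
    ae_eventually_wienerIntegral_le hB hs (π / 2) one_pos (by norm_num)] with ω herr hω h₀ h₁
  filter_upwards [herr ((c - c' * σ) / 2) (by linarith),
    (Finset.range n).eventually_all.2 fun j _ => hω j, h₀, h₁, eventually_gt_atTop 0]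
    with t ht hj hw₀ hw₁ ht0
  obtain ⟨j, hjn, hcos, hsin⟩ := exists_phase_close hn0 (2 * √(-b) * fourthRoot t ^ 2)
  have hBc := (hB.2.2.1 ω).continuousOn (s := Ici 0)
  have hWj := (le_abs_self _).trans (hj j hjn)
  rw [wienerIntegral_oscKernel_eq_add hBc _ _ ht0.le] at hWj ht
  set w₀ := wienerIntegral (oscKernel √(-b) 0) (oscKernelDeriv √(-b) 0) (fun u => B u ω) t
  set w₁ := wienerIntegral (oscKernel √(-b) (π / 2)) (oscKernelDeriv √(-b) (π / 2))
    (fun u => B u ω) t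
  set C := cos (2 * √(-b) * fourthRoot t ^ 2)
  set S := sin (2 * √(-b) * fourthRoot t ^ 2)
  set Cj := cos (2 * π * (j / n))
  set Sj := sin (2 * π * (j / n))
  rw [one_mul] at hw₀ hw₁
  have hδ : 0 ≤ 2 * π / n := (abs_nonneg _).trans hcos
  have d₀ : (C - Cj) * w₀ ≤ 2 * π / n * lilScale t := by
    refine (le_abs_self _).trans ?_
    rw [abs_mul]; gcongr
  have d₁ : (S - Sj) * w₁ ≤ 2 * π / n * lilScale t := by
    refine (le_abs_self _).trans ?_
    rw [abs_mul]; gcongr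
  have hsum : C * w₀ + S * w₁ ≤ (c' + 2 * (2 * π / n)) * lilScale t := by linarith
  have hσs := mul_le_mul_of_nonneg_left hsum hσ.le
  have hnL := mul_le_mul_of_nonneg_right hn (lilScale_nonneg t)
  have hrX : fourthRoot t * X t ω ≤ c * lilScale t := by
    have := (abs_le.1 ht).2
    linarith
  have hr := fourthRoot_pos ht0.le
  have hrt : √√t ≤ fourthRoot t := sqrt_le_sqrt (sqrt_le_sqrt (by linarith))
  rw [lilScale_eq] at hrX
  refine le_of_mul_le_mul_left (hrX.trans ?_) hr
  calc c * (√√t * √(2 * t * log (log t))) ≤ c * (fourthRoot t * √(2 * t * log (log t))) := by gcongr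
    _ = _ := by ring

lemma IsSolutionSFDE.ae_frequently_le (hX : IsSolutionSFDE P F 0 b σ ψ B X)
    (hB : IsStdBrownian P F B) (hσ : 0 < σ) (hb : b < 0) {c : ℝ} (hc0 : 0 < c) (hc : c < σ / √3) :
    ∀ᵐ ω ∂P, ∃ᶠ t in atTop, c * √(2 * t * log (log t)) ≤ X t ω := by
  have hs : 0 < √(-b) := sqrt_pos.2 (by linarith)
  have h3 : 0 < √3 := sqrt_pos.2 (by norm_num)
  obtain ⟨c', hcc', hc'⟩ := exists_between (show c / σ < 1 / √3 by
    rw [div_lt_div_iff₀ hσ h3]; rw [lt_div_iff₀ h3] at hc; linarith)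
  have hc'0 : 0 < c' := (div_pos hc0 hσ).trans hcc'
  have hc'3 : c' ^ 2 < 1 / 3 := by
    calc c' ^ 2 < (1 / √3) ^ 2 := by gcongr
      _ = 1 / 3 := by rw [div_pow, one_pow, sq_sqrt (by norm_num)]
  rw [div_lt_iff₀ hσ] at hcc'
  have h := hasGaussianIncrements_wienerIntegral (hasDerivAt_oscKernel √(-b) 0)
    (continuousOn_oscKernelDeriv √(-b) 0) hB
  have hlow := h.exists_forall_ae_frequently_lilScale_le (by norm_num)
    (tendsto_oscKernel_variance hs 0) hc'0 hc'3
  obtain ⟨N, hN, hN1⟩ := ((((tendsto_pow_atTop two_ne_zero).comp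
    (tendsto_natCast_atTop_atTop (R := ℝ))).eventually hlow).and (eventually_gt_atTop 1)).exists
  obtain ⟨m, hm⟩ := exists_nat_ge (√(-b))
  have hN1' : (1:ℝ) < N := by exact_mod_cast hN1
  have hm0 : (0:ℝ) < m := hs.trans_le hm
  set α : ℝ := (π * m / √(-b)) ^ 2 with hα
  have hα1 : 1 ≤ α := by
    have : 1 ≤ π * m / √(-b) := by
      rw [one_le_div hs]
      nlinarith [pi_gt_three]
    exact one_le_pow₀ this
  set p : ℕ → ℝ := fun k => α * ((N:ℝ) ^ 2) ^ k - 1 with hp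
  have hM1 : 1 < (N:ℝ) ^ 2 := one_lt_pow₀ hN1' two_ne_zero
  have hpmono : Monotone p := fun i j hij => by
    simp only [hp]
    gcongr
    exact hM1.le
  have hp0 : 0 ≤ p 0 := by simp [hp, hα1]
  have hplim : Tendsto (fun k => p k / ((N:ℝ) ^ 2) ^ k) atTop (nhds α) := by
    have h1 : Tendsto (fun k : ℕ => α - (((N:ℝ) ^ 2) ^ k)⁻¹) atTop (nhds α) := by
      simpa using ((tendsto_inv_atTop_zero.comp
        (tendsto_pow_atTop_atTop_of_one_lt hM1)).const_sub α)
    refine h1.congr fun k => ?_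
    have : ((N:ℝ) ^ 2) ^ k ≠ 0 := by positivity
    simp only [hp]
    field_simp
  have hptop := HasGaussianIncrements.tendsto_atTop_of_tendsto_div_pow hM1
    (zero_lt_one.trans_le hα1) hplim
  have hphase : ∀ k, 2 * √(-b) * fourthRoot (p k) ^ 2 = ((m * N ^ k : ℕ) : ℝ) * (2 * π) := by
    intro k
    have : 1 + p k = (π * m / √(-b) * N ^ k) ^ 2 := by simp only [hp, hα]; ring
    rw [fourthRoot_sq, this, sqrt_sq (by positivity)]
    push_cast
    field_simp
  have hratio : ∀ᶠ t : ℝ in atTop, c * fourthRoot t ≤ (c + (c' * σ - c) / 2) * √√t := by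
    have h1 : Tendsto (fun t : ℝ => c * √√(t⁻¹ + 1)) atTop (nhds c) := by
      simpa using (((tendsto_inv_atTop_zero (𝕜 := ℝ)).add_const 1).sqrt.sqrt).const_mul c
    filter_upwards [h1.eventually_le_const (show c < c + (c' * σ - c) / 2 by linarith),
      eventually_gt_atTop 0] with t ht ht0
    have e : fourthRoot t = √√(t⁻¹ + 1) * √√t := by
      rw [fourthRoot, ← sqrt_mul (sqrt_nonneg _), ← sqrt_mul (by positivity)]
      congr 2; field_simp
    rw [e, ← mul_assoc]
    gcongr
  filter_upwards [hX.ae_eventually_abs_sub_le hB hσ hb,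
    hN α (zero_lt_one.trans_le hα1) p hpmono hp0 hplim] with ω herr hfreq
  refine hptop.frequently ((hfreq.and_eventually (hptop.eventually
    ((herr ((c' * σ - c) / 2) (by linarith)).and
      (hratio.and (eventually_gt_atTop 0))))).mono ?_)
  rintro k ⟨hk, hek, hrk, hk0⟩
  rw [wienerIntegral_oscKernel_eq_add (hB.2.2.1 ω).continuousOn _ _ hk0.le, hphase,
    cos_nat_mul_two_pi, sin_periodic.nat_mul_eq, sin_zero, one_mul, zero_mul, add_zero] at hek
  have h1 := (abs_le.1 hek).1
  have h2 := mul_le_mul_of_nonneg_left hk hσ.le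
  have h3 : (c + (c' * σ - c) / 2) * lilScale (p k) ≤ fourthRoot (p k) * X (p k) ω := by linarith
  rw [lilScale_eq] at h3
  have h4 := mul_le_mul_of_nonneg_right hrk (sqrt_nonneg (2 * p k * log (log (p k))))
  refine le_of_mul_le_mul_left ?_ (fourthRoot_pos hk0.le)
  linarith

end Solution

lemma limsup_eq_of_eventually_le_of_frequently_le {f : ℝ → ℝ} {L : ℝ} (hL : 0 < L)
    (hle : ∀ q : ℚ, L < q → ∀ᶠ t in atTop, f t ≤ q)
    (hge : ∀ q : ℚ, 0 < (q : ℝ) → (q : ℝ) < L → ∃ᶠ t in atTop, (q : ℝ) ≤ f t) :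
    limsup f atTop = L := by
  obtain ⟨q₀, hq₀⟩ := exists_rat_gt L
  have hbdd : IsBoundedUnder (· ≤ ·) atTop f := ⟨q₀, eventually_map.2 (hle q₀ hq₀)⟩
  obtain ⟨q₁, hq₁, hq₁'⟩ := exists_rat_btwn hL
  have hcob : IsCoboundedUnder (· ≤ ·) atTop f :=
    IsCoboundedUnder.of_frequently_ge (hge q₁ hq₁ hq₁')
  refine le_antisymm (le_of_forall_gt_imp_ge_of_dense fun c hc => ?_)
    (le_of_forall_lt_imp_le_of_dense fun c hc => ?_)
  · obtain ⟨q, hq, hqc⟩ := exists_rat_btwn hc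
    exact (limsup_le_of_le hcob (hle q hq)).trans hqc.le
  · obtain ⟨q, hq, hqL⟩ := exists_rat_btwn (max_lt hc hL)
    exact ((le_max_left _ _).trans hq.le).trans
      (le_limsup_of_frequently_le (hge q ((le_max_right _ _).trans_lt hq) hqL) hbdd)

lemma liminf_eq_neg_limsup_neg (f : ℝ → ℝ) :
    liminf f atTop = -limsup (fun t => -f t) atTop := by
  rw [limsup_eq, liminf_eq, ← Real.sSup_neg]
  congr 1
  ext a
  simp

lemma IsSolutionSFDE.ae_limsup_eq {Ω : Type*} {mΩ : MeasurableSpace Ω} {P : Measure Ω}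
    [IsProbabilityMeasure P] {F : MeasureTheory.Filtration ℝ mΩ} {B X : ℝ → Ω → ℝ} {b σ : ℝ}
    {ψ : ℝ → ℝ} (hX : IsSolutionSFDE P F 0 b σ ψ B X)
    (hB : IsStdBrownian P F B) (hσ : 0 < σ) (hb : b < 0) :
    ∀ᵐ ω ∂P, limsup (fun t : ℝ => X t ω / √(2 * t * log (log t))) atTop = σ / √3 := by
  have hpos : ∀ᶠ t : ℝ in atTop, 0 < √(2 * t * log (log t)) := by
    filter_upwards [eventually_gt_atTop 0, tendsto_log_log_atTop.eventually_gt_atTop 0]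
      with t h₁ h₂
    positivity
  have h₁ : ∀ᵐ ω ∂P, ∀ q : ℚ, σ / √3 < q → ∀ᶠ t in atTop, X t ω ≤ q * √(2 * t * log (log t)) :=
    ae_all_iff.2 fun q => eventually_imp_distrib_left.2 fun hq => hX.ae_eventually_le hB hσ hb hq
  have h₂ : ∀ᵐ ω ∂P, ∀ q : ℚ, 0 < (q : ℝ) → (q : ℝ) < σ / √3 →
      ∃ᶠ t in atTop, q * √(2 * t * log (log t)) ≤ X t ω :=
    ae_all_iff.2 fun q => eventually_imp_distrib_left.2 fun hq₀ =>
      eventually_imp_distrib_left.2 fun hq => hX.ae_frequently_le hB hσ hb hq₀ hq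
  filter_upwards [h₁, h₂] with ω hω₁ hω₂
  refine limsup_eq_of_eventually_le_of_frequently_le (by positivity) (fun q hq => ?_)
    fun q hq₀ hq => ?_
  · filter_upwards [hω₁ q hq, hpos] with t ht ht0
    rwa [div_le_iff₀ ht0]
  · refine ((hω₂ q hq₀ hq).and_eventually hpos).mono fun t ht => ?_
    rw [le_div_iff₀ ht.2]
    exact ht.1

theorem sfde_lil_bessel {Ω : Type*} {mΩ : MeasurableSpace Ω} (P : Measure Ω) [IsProbabilityMeasure P]
    (F : MeasureTheory.Filtration ℝ mΩ) (a b σ : ℝ) (ψ : ℝ → ℝ) (B X : ℝ → Ω → ℝ)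
    (hσ : 0 < σ) (hψ : ContinuousOn ψ (Set.Icc (-1 : ℝ) 0))
    (hB : IsStdBrownian P F B) (hX : IsSolutionSFDE P F a b σ ψ B X)
    (ha : a = 0) (hb : b < 0) :
    ∀ᵐ ω ∂P,
      Filter.limsup (fun t : ℝ => X t ω / Real.sqrt (2 * t * Real.log (Real.log t)))
        Filter.atTop = σ / Real.sqrt 3 ∧
      Filter.liminf (fun t : ℝ => X t ω / Real.sqrt (2 * t * Real.log (Real.log t)))
        Filter.atTop = -(σ / Real.sqrt 3) := by
  subst ha
  filter_upwards [hX.ae_limsup_eq hB hσ hb, hX.neg.ae_limsup_eq hB.neg hσ hb] with ω h₁ h₂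
  refine ⟨h₁, ?_⟩
  rw [liminf_eq_neg_limsup_neg, ← h₂]
  simp only [neg_div]
end
end

section
/- Suppose a < 0 and a + b > 0. Then there exists a random variable C whose distribution is Gaussian with strictly positive variance such that, almost surely, lim_{t→∞} t^{1 + b/a} X(t) = C; moreover lim_{t→∞} t^{1 + b/a} E[X(t)] = E[C] and lim_{t→∞} t^{2 + 2b/a} Var[X(t)] = Var[C]. -/
open MeasureTheory ProbabilityTheory Filter Real Set

noncomputable section

lemma tendsto_zero_of_hasDerivAt_relaxation {w ρ δ : ℝ → ℝ} {α : ℝ} (hα : 0 < α)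
    (hw : ∀ᶠ t in atTop, HasDerivAt w (-ρ t * w t + δ t) t)
    (hρ : Tendsto ρ atTop (nhds α)) (hδ : Tendsto δ atTop (nhds 0)) :
    Tendsto w atTop (nhds 0) := by
  have key : ∀ η : ℝ, 0 < η → ∀ᶠ t in atTop, w t ^ 2 < 2 * η := by
    intro η hη
    have h1 : ∀ᶠ t in atTop, 3 * α / 4 < ρ t := hρ.eventually_const_lt (by linarith)
    have h2 : ∀ᶠ t in atTop, δ t ^ 2 < α ^ 2 / 2 * η := by
      have : Tendsto (fun t => δ t ^ 2) atTop (nhds 0) := by simpa using hδ.pow 2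
      exact this.eventually_lt_const (by positivity)
    obtain ⟨T, hT⟩ := eventually_atTop.1 ((hw.and h1).and h2)
    have hder : ∀ t, T ≤ t → HasDerivAt (fun t => (w t ^ 2 - η) * exp (α * t))
        (2 * w t * (-ρ t * w t + δ t) * exp (α * t) + (w t ^ 2 - η) * (exp (α * t) * α)) t := by
      intro t ht
      have hd := (hT t ht).1.1
      have := ((hd.pow 2).sub_const η).mul (((hasDerivAt_id t).const_mul α).exp)
      convert! this using 1
      simp
    have hanti : AntitoneOn (fun t => (w t ^ 2 - η) * exp (α * t)) (Ici T) := by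
      apply antitoneOn_of_deriv_nonpos (convex_Ici T)
      · exact fun t ht => (hder t ht).continuousAt.continuousWithinAt
      · intro t ht
        rw [interior_Ici] at ht
        exact (hder t (le_of_lt ht)).differentiableAt.differentiableWithinAt
      · intro t ht
        rw [interior_Ici] at ht
        have ht' : T ≤ t := le_of_lt ht
        rw [(hder t ht').deriv]
        obtain ⟨⟨-, hr⟩, hd⟩ := hT t ht'
        have : 2 * w t * (-ρ t * w t + δ t) + (w t ^ 2 - η) * α ≤ 0 := by
          have e1 : 3 * α / 4 * w t ^ 2 ≤ ρ t * w t ^ 2 :=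
            mul_le_mul_of_nonneg_right hr.le (sq_nonneg _)
          have e2 : α * (2 * w t * δ t) ≤ α ^ 2 / 2 * w t ^ 2 + 2 * δ t ^ 2 := by
            nlinarith [sq_nonneg (α * w t - 2 * δ t)]
          have e3 : α * (2 * w t * (-ρ t * w t + δ t) + (w t ^ 2 - η) * α) ≤ 0 := by
            nlinarith
          by_contra hcon
          push Not at hcon
          nlinarith [mul_pos hα hcon]
        have hE := exp_pos (α * t)
        nlinarith
    have hlim : Tendsto (fun t => (w T ^ 2 - η) * exp (α * T) * exp (-(α * t))) atTop
        (nhds 0) := by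
      have : Tendsto (fun t : ℝ => exp (-(α * t))) atTop (nhds 0) :=
        tendsto_exp_neg_atTop_nhds_zero.comp (tendsto_id.const_mul_atTop hα)
      simpa using this.const_mul ((w T ^ 2 - η) * exp (α * T))
    filter_upwards [eventually_ge_atTop T, hlim.eventually_lt_const hη] with t ht hlt
    have h := hanti (mem_Ici.2 le_rfl) (mem_Ici.2 ht) ht
    have h3 : w t ^ 2 - η ≤ (w T ^ 2 - η) * exp (α * T) * exp (-(α * t)) := by
      have := mul_le_mul_of_nonneg_right h (exp_pos (-(α * t))).le
      simp only [] at this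
      rwa [mul_assoc (w t ^ 2 - η), ← exp_add, add_neg_cancel, exp_zero, mul_one] at this
    linarith
  rw [Metric.tendsto_nhds]
  intro ε hε
  filter_upwards [key (ε ^ 2 / 2) (by positivity)] with t ht
  rw [Real.dist_eq, sub_zero]
  exact abs_lt_of_sq_lt_sq (by linarith) hε.le

/-- Solutions of `w' = -ρ w + γ` converge to `ℓ / α` when `ρ → α > 0` and `γ → ℓ`. -/
lemma tendsto_of_hasDerivAt_relaxation {w ρ γ : ℝ → ℝ} {α ℓ : ℝ} (hα : 0 < α)
    (hw : ∀ᶠ t in atTop, HasDerivAt w (-ρ t * w t + γ t) t)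
    (hρ : Tendsto ρ atTop (nhds α)) (hγ : Tendsto γ atTop (nhds ℓ)) :
    Tendsto w atTop (nhds (ℓ / α)) := by
  have h := tendsto_zero_of_hasDerivAt_relaxation (w := fun t => w t - ℓ / α) (ρ := ρ)
    (δ := fun t => γ t - ρ t * (ℓ / α)) hα ?_ hρ ?_
  · simpa using h.add_const (ℓ / α)
  · filter_upwards [hw] with t ht
    convert! ht.sub_const (ℓ / α) using 1
    ring
  · have := hγ.sub (hρ.mul_const (ℓ / α))
    rwa [mul_div_cancel₀ _ hα.ne', sub_self] at this

/-- Riemann–Stieltjes sums of a continuous function against a `C¹` integrator converge. -/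
lemma tendsto_riemann_stieltjes_sum {f g g' : ℝ → ℝ} {T : ℝ} (hT : 0 ≤ T)
    (hf : ContinuousOn f (Icc 0 T)) (hg : ∀ t ∈ Icc 0 T, HasDerivAt g (g' t) t)
    (hg' : ContinuousOn g' (Icc 0 T)) {τ : ℕ → ℕ → ℝ}
    (hτ : ∀ n k : ℕ, k < n → τ n k ∈ Icc (k * (T / n)) ((k + 1 : ℕ) * (T / n))) :
    Tendsto (fun n : ℕ => ∑ k ∈ Finset.range n,
      f (τ n k) * (g ((k + 1 : ℕ) * (T / n)) - g (k * (T / n)))) atTop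
      (nhds (∫ t in (0 : ℝ)..T, f t * g' t)) := by
  obtain ⟨M, hM⟩ := isCompact_Icc.exists_bound_of_continuousOn hg'
  have hM0 : 0 ≤ M := (norm_nonneg _).trans (hM 0 ⟨le_rfl, hT⟩)
  have huc := isCompact_Icc.uniformContinuousOn_of_continuous hf
  rw [Metric.uniformContinuousOn_iff] at huc
  rw [Metric.tendsto_atTop]
  intro ε hε
  have hε' : 0 < ε / (M * T + 1) := by positivity
  obtain ⟨d, hd, hfd⟩ := huc _ hε'
  obtain ⟨N, hN⟩ := exists_nat_gt (T / d)
  refine ⟨N + 1, fun n hn => ?_⟩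
  have hn0 : (0 : ℝ) < n := by
    have : 0 < n := by omega
    exact_mod_cast this
  have hstep : T / n < d := by
    rw [div_lt_iff₀ hn0]
    rw [div_lt_iff₀ hd] at hN
    have : (N : ℝ) ≤ n := by exact_mod_cast (by omega : N ≤ n)
    nlinarith
  have hstep0 : 0 ≤ T / n := by positivity
  set x : ℕ → ℝ := fun k => k * (T / n) with hx
  have hxmono : ∀ k, x k ≤ x (k + 1) := fun k => by
    simp only [hx]; push_cast; nlinarith
  have hxn : x n = T := by simp only [hx]; field_simp
  have hx0 : x 0 = 0 := by simp [hx]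
  have hsub : ∀ k, k < n → Icc (x k) (x (k + 1)) ⊆ Icc 0 T := by
    intro k hk
    apply Icc_subset_Icc
    · simp only [hx]; positivity
    · rw [← hxn]
      have : ((k + 1 : ℕ) : ℝ) ≤ n := by exact_mod_cast hk
      exact mul_le_mul_of_nonneg_right this hstep0
  have hint : ∀ k, k < n → ∀ φ : ℝ → ℝ, ContinuousOn φ (Icc 0 T) →
      IntervalIntegrable φ volume (x k) (x (k + 1)) := fun k hk φ hφ =>
    (hφ.mono (by rw [uIcc_of_le (hxmono k)]; exact hsub k hk)).intervalIntegrable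
  have hsum : ∫ t in (0 : ℝ)..T, f t * g' t
      = ∑ k ∈ Finset.range n, ∫ t in (x k)..(x (k + 1)), f t * g' t := by
    rw [intervalIntegral.sum_integral_adjacent_intervals, hx0, hxn]
    exact fun k hk => hint k hk _ (hf.mul hg')
  rw [hsum, dist_eq_norm, ← Finset.sum_sub_distrib]
  have hterm : ∀ k ∈ Finset.range n, ‖f (τ n k) * (g ((k + 1 : ℕ) * (T / n)) - g (k * (T / n)))
      - ∫ t in (x k)..(x (k + 1)), f t * g' t‖ ≤ ε / (M * T + 1) * M * (T / n) := by
    intro k hk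
    rw [Finset.mem_range] at hk
    have h1 : g ((k + 1 : ℕ) * (T / n)) - g (k * (T / n)) = ∫ t in (x k)..(x (k + 1)), g' t := by
      rw [intervalIntegral.integral_eq_sub_of_hasDerivAt _ (hint k hk _ hg')]
      intro t ht
      rw [uIcc_of_le (hxmono k)] at ht
      exact hg t (hsub k hk ht)
    have h0 := intervalIntegral.integral_sub ((hint k hk _ hg').const_mul (f (τ n k)))
      (hint k hk (fun t => f t * g' t) (hf.mul hg'))
    rw [h1, ← intervalIntegral.integral_const_mul, ← h0]
    have h2 : |x (k + 1) - x k| = T / n := by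
      have : x (k + 1) - x k = T / n := by simp only [hx]; push_cast; ring
      rw [this, abs_of_nonneg hstep0]
    rw [← h2]
    apply intervalIntegral.norm_integral_le_of_norm_le_const
    intro t ht
    rw [uIoc_of_le (hxmono k)] at ht
    have ht' : t ∈ Icc (x k) (x (k + 1)) := Ioc_subset_Icc_self ht
    have hτk := hτ n k hk
    rw [← sub_mul, norm_mul]
    refine mul_le_mul ?_ (hM t (hsub k hk ht')) (norm_nonneg _) hε'.le
    rw [← dist_eq_norm]
    refine (hfd _ (hsub k hk hτk) _ (hsub k hk ht') ?_).le
    rw [Real.dist_eq, abs_lt]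
    have h3 : x (k + 1) - x k = T / n := by simp only [hx]; push_cast; ring
    have h4 : x k ≤ τ n k := hτk.1
    have h5 : τ n k ≤ x (k + 1) := hτk.2
    constructor <;> linarith [ht'.1, ht'.2]
  refine (norm_sum_le_of_le _ hterm).trans_lt ?_
  rw [Finset.sum_const, Finset.card_range, nsmul_eq_mul]
  have : (n : ℝ) * (ε / (M * T + 1) * M * (T / n)) = ε * (M * T / (M * T + 1)) := by
    field_simp
  rw [this]
  have h6 : M * T / (M * T + 1) < 1 := by
    rw [div_lt_one (by positivity)]; linarith
  nlinarith

/-- The Laplace transform `∫₀^∞ e^{-s x} x^c (x + α)^{-d} dx`, a confluent hypergeometric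
function of the second kind up to normalization. -/
def kummerLaplace (α c d s : ℝ) : ℝ :=
  ∫ x in Ioi (0 : ℝ), exp (-s * x) * x ^ c * (x + α) ^ (-d)

lemma continuousOn_kummerLaplace_integrand {α : ℝ} (hα : 0 < α) (c d s : ℝ) :
    ContinuousOn (fun x : ℝ => exp (-s * x) * x ^ c * (x + α) ^ (-d)) (Ioi 0) := by
  refine ContinuousOn.mul (ContinuousOn.mul (by fun_prop) ?_) ?_
  · exact continuousOn_id.rpow_const fun x hx => Or.inl (ne_of_gt hx)
  · exact ContinuousOn.rpow_const (by fun_prop) fun x hx => by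
      left; have : (0 : ℝ) < x := hx; positivity

lemma add_rpow_neg_le {α d x : ℝ} (hα : 0 < α) (hd : 0 ≤ d) (hx : 0 ≤ x) :
    (x + α) ^ (-d) ≤ α ^ (-d) :=
  rpow_le_rpow_of_nonpos hα (by linarith) (by linarith)

lemma integrableOn_exp_neg_mul_rpow {c s : ℝ} (hc : -1 < c) (hs : 0 < s) :
    IntegrableOn (fun x : ℝ => exp (-s * x) * x ^ c) (Ioi 0) := by
  have := integrableOn_rpow_mul_exp_neg_mul_rpow (p := 1) hc one_pos hs
  simpa [rpow_one, mul_comm] using this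

lemma integral_exp_neg_mul_rpow' {c s : ℝ} (hc : -1 < c) (hs : 0 < s) :
    ∫ x in Ioi (0 : ℝ), exp (-s * x) * x ^ c = Gamma (c + 1) * s ^ (-(c + 1)) := by
  have := integral_rpow_mul_exp_neg_mul_rpow (p := 1) one_pos hc hs
  simp only [rpow_one, div_one, mul_one] at this
  rw [mul_comm (Gamma _), ← this]
  simp only [mul_comm]

lemma integrableOn_kummerLaplace_integrand {α c d s : ℝ} (hα : 0 < α) (hc : -1 < c)
    (hd : 0 ≤ d) (hs : 0 < s) :
    IntegrableOn (fun x : ℝ => exp (-s * x) * x ^ c * (x + α) ^ (-d)) (Ioi 0) := by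
  refine Integrable.mono' ((integrableOn_exp_neg_mul_rpow hc hs).mul_const (α ^ (-d)))
    ((continuousOn_kummerLaplace_integrand hα c d s).aestronglyMeasurable measurableSet_Ioi) ?_
  refine (ae_restrict_iff' measurableSet_Ioi).2 (Eventually.of_forall fun x hx => ?_)
  have hx' : (0 : ℝ) < x := hx
  rw [norm_of_nonneg (by positivity)]
  exact mul_le_mul_of_nonneg_left (add_rpow_neg_le hα hd hx'.le) (by positivity)

lemma kummerLaplace_pos {α c d s : ℝ} (hα : 0 < α) (hc : -1 < c) (hd : 0 ≤ d) (hs : 0 < s) :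
    0 < kummerLaplace α c d s := by
  have hpos : ∀ x ∈ Ioi (0 : ℝ), 0 < exp (-s * x) * x ^ c * (x + α) ^ (-d) := fun x hx => by
    have hx' : (0 : ℝ) < x := hx
    positivity
  rw [kummerLaplace, setIntegral_pos_iff_support_of_nonneg_ae
    ((ae_restrict_iff' measurableSet_Ioi).2 (Eventually.of_forall fun x hx => (hpos x hx).le))
    (integrableOn_kummerLaplace_integrand hα hc hd hs)]
  have : Function.support (fun x : ℝ => exp (-s * x) * x ^ c * (x + α) ^ (-d)) ∩ Ioi 0
      = Ioi 0 := inter_eq_right.2 fun x hx => (hpos x hx).ne'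
  rw [this, volume_Ioi]
  exact ENNReal.zero_lt_top

lemma kummerLaplace_le {α c d s : ℝ} (hα : 0 < α) (hc : -1 < c) (hd : 0 ≤ d) (hs : 0 < s) :
    kummerLaplace α c d s ≤ α ^ (-d) * Gamma (c + 1) * s ^ (-(c + 1)) := by
  rw [mul_assoc, ← integral_exp_neg_mul_rpow' hc hs, mul_comm (α ^ (-d)), ← integral_mul_const]
  refine setIntegral_mono_on (integrableOn_kummerLaplace_integrand hα hc hd hs)
    ((integrableOn_exp_neg_mul_rpow hc hs).mul_const _) measurableSet_Ioi fun x hx => ?_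
  have hx' : (0 : ℝ) < x := hx
  exact mul_le_mul_of_nonneg_left (add_rpow_neg_le hα hd hx'.le) (by positivity)

lemma hasDerivAt_kummerLaplace {α c d s : ℝ} (hα : 0 < α) (hc : -1 < c) (hd : 0 ≤ d)
    (hs : 0 < s) :
    HasDerivAt (kummerLaplace α c d) (-kummerLaplace α (c + 1) d s) s := by
  have hs2 : 0 < s / 2 := by positivity
  have key := hasDerivAt_integral_of_dominated_loc_of_deriv_le (μ := volume.restrict (Ioi (0 : ℝ)))
    (F := fun s x => exp (-s * x) * x ^ c * (x + α) ^ (-d))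
    (F' := fun s x => -(exp (-s * x) * x ^ (c + 1) * (x + α) ^ (-d)))
    (x₀ := s) (s := Ioi (s / 2)) (bound := fun x => exp (-(s / 2) * x) * x ^ (c + 1) * α ^ (-d))
    (Ioi_mem_nhds (by linarith)) ?_ (integrableOn_kummerLaplace_integrand hα hc hd hs) ?_ ?_ ?_ ?_
  · convert! key.2 using 1
    rw [integral_neg, kummerLaplace]
  · exact Eventually.of_forall fun u => (continuousOn_kummerLaplace_integrand
      hα c d u).aestronglyMeasurable measurableSet_Ioi
  · exact ((continuousOn_kummerLaplace_integrand
      hα (c + 1) d s).aestronglyMeasurable measurableSet_Ioi).neg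
  · refine (ae_restrict_iff' measurableSet_Ioi).2 (Eventually.of_forall fun x hx u hu => ?_)
    have hx' : (0 : ℝ) < x := hx
    have hu' : s / 2 < u := hu
    rw [norm_neg, norm_of_nonneg (by positivity)]
    refine mul_le_mul ?_ (add_rpow_neg_le hα hd hx'.le) (by positivity) (by positivity)
    refine mul_le_mul_of_nonneg_right (exp_le_exp.2 ?_) (by positivity)
    nlinarith
  · exact (integrableOn_exp_neg_mul_rpow (by linarith) hs2).mul_const _
  · refine (ae_restrict_iff' measurableSet_Ioi).2 (Eventually.of_forall fun x hx u _ => ?_)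
    have hx' : (0 : ℝ) < x := hx
    have h := (((hasDerivAt_id u).neg.mul_const x).exp.mul_const (x ^ c)).mul_const
      ((x + α) ^ (-d))
    convert! h using 1
    rw [rpow_add_one hx'.ne']
    simp only [id, Pi.neg_apply]
    ring

lemma kummerLaplace_eq_add {α c d s : ℝ} (hα : 0 < α) (hc : -1 < c) (hd : 0 ≤ d) (hs : 0 < s) :
    kummerLaplace α c d s
      = α * kummerLaplace α c (d + 1) s + kummerLaplace α (c + 1) (d + 1) s := by
  unfold kummerLaplace
  rw [← integral_const_mul, ← integral_add
    ((integrableOn_kummerLaplace_integrand hα hc (by linarith) hs).const_mul _)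
    (integrableOn_kummerLaplace_integrand hα (by linarith) (by linarith) hs)]
  refine setIntegral_congr_fun measurableSet_Ioi fun x hx => ?_
  have hx' : (0 : ℝ) < x := hx
  have h1 : (x + α) ^ (-d) = (x + α) ^ (-(d + 1)) * (x + α) := by
    rw [← rpow_add_one (by positivity)]; ring_nf
  rw [h1, rpow_add_one hx'.ne']
  ring

lemma mul_kummerLaplace_self {α κ s : ℝ} (hα : 0 < α) (hκ : 0 < κ) (hs : 0 < s) :
    s * kummerLaplace α κ κ s = α * κ * kummerLaplace α (κ - 1) (κ + 1) s := by
  have hi1 := integrableOn_kummerLaplace_integrand (c := κ) (d := κ) hα (by linarith) hκ.le hs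
  have hi2 := integrableOn_kummerLaplace_integrand (c := κ - 1) (d := κ + 1) hα (by linarith)
    (by linarith) hs
  have key := integral_Ioi_of_hasDerivAt_of_tendsto (a := (0 : ℝ)) (m := 0)
    (f := fun x : ℝ => exp (-s * x) * x ^ κ * (x + α) ^ (-κ))
    (f' := fun x => α * κ * (exp (-s * x) * x ^ (κ - 1) * (x + α) ^ (-(κ + 1)))
      - s * (exp (-s * x) * x ^ κ * (x + α) ^ (-κ))) ?_ ?_ ?_ ?_
  · rw [integral_sub (hi2.const_mul _) (hi1.const_mul _), integral_const_mul,
      integral_const_mul] at key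
    simp only [zero_rpow hκ.ne', mul_zero, zero_mul, sub_zero] at key
    unfold kummerLaplace
    linarith
  · refine ContinuousWithinAt.mul (ContinuousWithinAt.mul (by fun_prop) ?_) ?_
    · exact (continuousAt_rpow_const _ _ (Or.inr hκ.le)).continuousWithinAt
    · exact ContinuousWithinAt.rpow_const (by fun_prop) (Or.inl (by simpa using hα.ne'))
  · intro x hx
    have hx' : (0 : ℝ) < x := hx
    have h := (((hasDerivAt_id x).const_mul (-s)).exp.mul
      (hasDerivAt_rpow_const (x := x) (p := κ) (Or.inl hx'.ne'))).mul
      (((hasDerivAt_id x).add_const α).rpow_const (p := -κ) (Or.inl (by simp; positivity)))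
    convert! h using 1
    have h1 : x ^ κ = x ^ (κ - 1) * x := by
      rw [← rpow_add_one hx'.ne']; ring_nf
    have h2 : (x + α) ^ (-κ) = (x + α) ^ (-(κ + 1)) * (x + α) := by
      rw [← rpow_add_one (by positivity)]; ring_nf
    have h3 : -κ - 1 = -(κ + 1) := by ring
    simp only [id, h3, h1, h2, Pi.mul_apply]
    ring
  · exact (hi2.const_mul _).sub (hi1.const_mul _)
  · have hz : Tendsto (fun x : ℝ => exp (-s * x) * 1) atTop (nhds 0) := by
      have := tendsto_exp_neg_atTop_nhds_zero.comp (tendsto_id.const_mul_atTop hs)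
      simpa [Function.comp_def] using this
    refine tendsto_of_tendsto_of_tendsto_of_le_of_le' tendsto_const_nhds hz ?_ ?_
    · filter_upwards [eventually_gt_atTop 0] with x hx
      positivity
    · filter_upwards [eventually_gt_atTop 0] with x hx
      rw [mul_assoc]
      refine mul_le_mul_of_nonneg_left ?_ (exp_pos _).le
      rw [rpow_neg (by positivity), ← div_eq_mul_inv, div_le_one (by positivity)]
      exact rpow_le_rpow hx.le (by linarith) hκ.le

lemma tendsto_rpow_mul_kummerLaplace {α c d : ℝ} (hα : 0 < α) (hc : -1 < c) (hd : 0 ≤ d) :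
    Tendsto (fun s => s ^ (c + 1) * kummerLaplace α c d s) atTop
      (nhds (α ^ (-d) * Gamma (c + 1))) := by
  have hlim : Tendsto (fun s : ℝ => ∫ y in Ioi (0 : ℝ), exp (-1 * y) * y ^ c * (y / s + α) ^ (-d))
      atTop (nhds (∫ y in Ioi (0 : ℝ), exp (-1 * y) * y ^ c * α ^ (-d))) := by
    refine tendsto_integral_filter_of_dominated_convergence
      (fun y => exp (-1 * y) * y ^ c * α ^ (-d)) ?_ ?_
      ((integrableOn_exp_neg_mul_rpow hc one_pos).mul_const _) ?_
    · filter_upwards [eventually_gt_atTop 0] with s hs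
      refine ContinuousOn.aestronglyMeasurable ?_ measurableSet_Ioi
      refine ContinuousOn.mul (ContinuousOn.mul (by fun_prop) ?_) ?_
      · exact continuousOn_id.rpow_const fun x hx => Or.inl (ne_of_gt hx)
      · exact ContinuousOn.rpow_const (by fun_prop) fun x hx => by
          left; have : (0 : ℝ) < x := hx; positivity
    · filter_upwards [eventually_gt_atTop 0] with s hs
      refine (ae_restrict_iff' measurableSet_Ioi).2 (Eventually.of_forall fun x hx => ?_)
      have hx' : (0 : ℝ) < x := hx
      rw [norm_of_nonneg (by positivity)]
      exact mul_le_mul_of_nonneg_left (add_rpow_neg_le hα hd (by positivity)) (by positivity)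
    · refine (ae_restrict_iff' measurableSet_Ioi).2 (Eventually.of_forall fun x hx => ?_)
      refine Tendsto.const_mul _ ?_
      have h1 : Tendsto (fun s : ℝ => x / s + α) atTop (nhds α) := by
        simpa using (tendsto_const_nhds.div_atTop tendsto_id : Tendsto (fun s : ℝ => x / s)
          atTop (nhds 0)).add_const α
      exact h1.rpow_const (Or.inl hα.ne')
  rw [integral_mul_const, integral_exp_neg_mul_rpow' hc one_pos, one_rpow, mul_one,
    mul_comm (Gamma _)] at hlim
  refine hlim.congr' ?_
  filter_upwards [eventually_gt_atTop 0] with s hs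
  have h := integral_comp_mul_left_Ioi
    (fun y : ℝ => exp (-1 * y) * y ^ c * (y / s + α) ^ (-d)) 0 hs
  rw [mul_zero, smul_eq_mul] at h
  have h' : ∫ y in Ioi (0 : ℝ), exp (-1 * y) * y ^ c * (y / s + α) ^ (-d)
      = s * ∫ x in Ioi (0 : ℝ), exp (-1 * (s * x)) * (s * x) ^ c * (s * x / s + α) ^ (-d) := by
    rw [h, mul_inv_cancel_left₀ hs.ne']
  have h2 : s ^ c * kummerLaplace α c d s
      = ∫ x in Ioi (0 : ℝ), s ^ c * (exp (-s * x) * x ^ c * (x + α) ^ (-d)) := by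
    rw [integral_const_mul, kummerLaplace]
  rw [h', rpow_add_one hs.ne', mul_comm (s ^ c) s, mul_assoc s, h2]
  congr 1
  refine setIntegral_congr_fun measurableSet_Ioi fun x hx => ?_
  have hx' : (0 : ℝ) < x := hx
  rw [mul_rpow hs.le hx'.le, mul_div_cancel_left₀ _ hs.ne']
  ring_nf

section GaussianLimits

variable {Ω : Type*} {mΩ : MeasurableSpace Ω} {P : Measure Ω}

lemma tendsto_charFun_map_of_ae_tendsto [IsProbabilityMeasure P] {ι : Type*} {l : Filter ι}
    [l.IsCountablyGenerated] {Z : ι → Ω → ℝ} {W : Ω → ℝ}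
    (hZ : ∀ᶠ i in l, AEMeasurable (Z i) P) (hW : AEMeasurable W P)
    (h : ∀ᵐ ω ∂P, Tendsto (fun i => Z i ω) l (nhds (W ω))) (u : ℝ) :
    Tendsto (fun i => charFun (P.map (Z i)) u) l (nhds (charFun (P.map W) u)) := by
  have hmap : ∀ V : Ω → ℝ, AEMeasurable V P →
      charFun (P.map V) u = ∫ ω, Complex.exp (u * V ω * Complex.I) ∂P := fun V hV => by
    rw [charFun_apply_real, integral_map hV (by fun_prop)]
  rw [hmap W hW]
  refine Tendsto.congr' (hZ.mono fun i hi => (hmap _ hi).symm) ?_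
  refine tendsto_integral_filter_of_dominated_convergence (fun _ => 1) ?_ ?_
    (integrable_const _) ?_
  · filter_upwards [hZ] with i hi
    exact (by fun_prop : AEMeasurable (fun ω => Complex.exp (u * Z i ω * Complex.I))
      P).aestronglyMeasurable
  · refine Eventually.of_forall fun i => Eventually.of_forall fun ω => ?_
    rw [← Complex.ofReal_mul, Complex.norm_exp_ofReal_mul_I]
  · filter_upwards [h] with ω hω
    have : Continuous fun x : ℝ => Complex.exp (u * x * Complex.I) := by fun_prop
    exact (this.tendsto _).comp hω

/-- An almost sure limit of Gaussian variables with convergent parameters is Gaussian. -/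
lemma hasLaw_gaussianReal_of_ae_tendsto [IsProbabilityMeasure P] {Z : ℕ → Ω → ℝ} {W : Ω → ℝ}
    {m : ℕ → ℝ} {v : ℕ → NNReal} {m₀ : ℝ} {v₀ : NNReal}
    (hZ : ∀ n, HasLaw (Z n) (gaussianReal (m n) (v n)) P)
    (hm : Tendsto m atTop (nhds m₀)) (hv : Tendsto v atTop (nhds v₀))
    (h : ∀ᵐ ω ∂P, Tendsto (fun n => Z n ω) atTop (nhds (W ω))) :
    HasLaw W (gaussianReal m₀ v₀) P := by
  have hW : AEMeasurable W P :=
    aemeasurable_of_tendsto_metrizable_ae atTop (fun n => (hZ n).aemeasurable) h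
  refine ⟨hW, ?_⟩
  have : IsProbabilityMeasure (P.map W) := Measure.isProbabilityMeasure_map hW
  refine Measure.ext_of_charFun (funext fun u => ?_)
  have h1 := tendsto_charFun_map_of_ae_tendsto
    (Eventually.of_forall fun n => (hZ n).aemeasurable) hW h u
  refine tendsto_nhds_unique h1 ?_
  simp_rw [(hZ _).map_eq, charFun_gaussianReal]
  have hm' : Tendsto (fun n => (m n : ℂ)) atTop (nhds (m₀ : ℂ)) :=
    (Complex.continuous_ofReal.tendsto _).comp hm
  have hv' : Tendsto (fun n => ((v n : ℝ) : ℂ)) atTop (nhds ((v₀ : ℝ) : ℂ)) :=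
    ((Complex.continuous_ofReal.comp NNReal.continuous_coe).tendsto _).comp hv
  refine (Complex.continuous_exp.tendsto _).comp ?_
  exact (((hm'.const_mul _).mul_const _)).sub ((hv'.mul_const _).div_const _)

/-- The mean and variance of Gaussian variables converge along almost sure convergence. -/
lemma tendsto_gaussianReal_params_of_ae_tendsto [IsProbabilityMeasure P] {ι : Type*}
    {l : Filter ι} [l.IsCountablyGenerated] {Z : ι → Ω → ℝ} {W : Ω → ℝ}
    {m : ι → ℝ} {v : ι → NNReal} {m₀ : ℝ} {v₀ : NNReal}
    (hZ : ∀ᶠ i in l, HasLaw (Z i) (gaussianReal (m i) (v i)) P)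
    (hW : HasLaw W (gaussianReal m₀ v₀) P)
    (h : ∀ᵐ ω ∂P, Tendsto (fun i => Z i ω) l (nhds (W ω))) :
    Tendsto m l (nhds m₀) ∧ Tendsto (fun i => (v i : ℝ)) l (nhds (v₀ : ℝ)) := by
  have hchar : ∀ u : ℝ, Tendsto (fun i => Complex.exp (u * m i * Complex.I - v i * u ^ 2 / 2)) l
      (nhds (Complex.exp (u * m₀ * Complex.I - v₀ * u ^ 2 / 2))) := by
    intro u
    have h1 := tendsto_charFun_map_of_ae_tendsto (hZ.mono fun i hi => hi.aemeasurable)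
      hW.aemeasurable h u
    rw [hW.map_eq, charFun_gaussianReal] at h1
    refine h1.congr' (hZ.mono fun i hi => ?_)
    rw [hi.map_eq, charFun_gaussianReal]
  have hv : Tendsto (fun i => (v i : ℝ)) l (nhds (v₀ : ℝ)) := by
    have h1 := (hchar 1).norm
    simp only [Complex.norm_exp] at h1
    have h2 := (h1.log (exp_ne_zero _)).const_mul (-2)
    simp only [Real.log_exp] at h2
    convert! h2 using 1
    · ext i; simp; ring
    · simp; ring_nf
  refine ⟨?_, hv⟩
  have hone : ∀ u : ℝ, Tendsto (fun i => Complex.exp ((m i - m₀ : ℝ) * u * Complex.I)) l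
      (nhds 1) := by
    intro u
    have hvc : Tendsto (fun i => ((v i : ℝ) : ℂ)) l (nhds ((v₀ : ℝ) : ℂ)) :=
      (Complex.continuous_ofReal.tendsto _).comp hv
    have h2 : Tendsto (fun i => Complex.exp ((v i : ℝ) * u ^ 2 / 2 - u * m₀ * Complex.I)) l
        (nhds (Complex.exp ((v₀ : ℝ) * u ^ 2 / 2 - u * m₀ * Complex.I))) :=
      (Complex.continuous_exp.tendsto _).comp
        (((hvc.mul_const _).div_const _).sub_const _)
    have h3 := (hchar u).mul h2
    simp only [← Complex.exp_add] at h3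
    convert! h3 using 2
    · congr 1; push_cast; ring
    · rw [eq_comm, ← Complex.exp_zero]; congr 1; ring
  have hint : Tendsto (fun i => ∫ u, Complex.exp ((m i - m₀ : ℝ) * u * Complex.I)
      ∂(gaussianReal 0 1)) l (nhds (∫ _, (1 : ℂ) ∂(gaussianReal 0 1))) := by
    refine tendsto_integral_filter_of_dominated_convergence (fun _ => 1) ?_ ?_
      (integrable_const _) (Eventually.of_forall hone)
    · exact Eventually.of_forall fun i => (by fun_prop : Measurable fun u : ℝ =>
        Complex.exp ((m i - m₀ : ℝ) * u * Complex.I)).aestronglyMeasurable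
    · refine Eventually.of_forall fun i => Eventually.of_forall fun ω => ?_
      rw [← Complex.ofReal_mul, Complex.norm_exp_ofReal_mul_I]
  simp_rw [← charFun_apply_real, charFun_gaussianReal] at hint
  have h4 := hint.norm
  simp only [Complex.norm_exp] at h4
  have h5 := (h4.log (by simp)).const_mul (-2)
  simp only [Real.log_exp] at h5
  have h6 : Tendsto (fun i => (m i - m₀) ^ 2) l (nhds 0) := by
    convert! h5 using 1
    · ext i
      simp [← Complex.ofReal_pow, -Complex.ofReal_sub]
      ring
    · simp
  have h7 : Tendsto (fun i => m i - m₀) l (nhds 0) := by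
    refine (tendsto_zero_iff_abs_tendsto_zero _).2 ?_
    have := h6.sqrt
    simpa [Real.sqrt_sq_eq_abs, Function.comp_def] using this
  simpa using h7.add_const m₀

end GaussianLimits

namespace IsStdBrownian

variable {Ω : Type*} {mΩ : MeasurableSpace Ω} {P : Measure Ω}
  {F : MeasureTheory.Filtration ℝ mΩ} {B : ℝ → Ω → ℝ}

lemma measurable (hB : IsStdBrownian P F B) (t : ℝ) : Measurable (B t) :=
  (hB.1 t).mono (F.le t) le_rfl

lemma hasLaw_sub (hB : IsStdBrownian P F B) {s t : ℝ} (hs : 0 ≤ s) (hst : s ≤ t) :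
    HasLaw (fun ω => B t ω - B s ω) (gaussianReal 0 (Real.toNNReal (t - s))) P :=
  ⟨((hB.measurable t).sub (hB.measurable s)).aemeasurable, hB.2.2.2.1 s t hs hst⟩

lemma hasLaw_sum_mul_sub [IsProbabilityMeasure P] (hB : IsStdBrownian P F B) {x : ℕ → ℝ}
    (hx0 : ∀ k, 0 ≤ x k) (hx : ∀ k, x k ≤ x (k + 1)) (c : ℕ → ℝ) (n : ℕ) :
    Measurable[F (x n)] (fun ω => ∑ k ∈ Finset.range n, c k * (B (x (k + 1)) ω - B (x k) ω)) ∧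
    HasLaw (fun ω => ∑ k ∈ Finset.range n, c k * (B (x (k + 1)) ω - B (x k) ω))
      (gaussianReal 0 (Real.toNNReal (∑ k ∈ Finset.range n, c k ^ 2 * (x (k + 1) - x k)))) P := by
  induction n with
  | zero =>
    refine ⟨by simp, by simp, ?_⟩
    simp [gaussianReal_zero_var]
  | succ n ih =>
    have hmeas : Measurable[F (x (n + 1))] (fun ω =>
        ∑ k ∈ Finset.range (n + 1), c k * (B (x (k + 1)) ω - B (x k) ω)) := by
      simp_rw [Finset.sum_range_succ]
      have h1 := ih.1.mono (F.mono (hx n)) le_rfl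
      have h2 := hB.1 (x (n + 1))
      have h3 := (hB.1 (x n)).mono (F.mono (hx n)) le_rfl
      exact h1.add ((h2.sub h3).const_mul _)
    refine ⟨hmeas, (hmeas.mono (F.le _) le_rfl).aemeasurable, ?_⟩
    have hincr := (hB.hasLaw_sub (hx0 n) (hx n))
    have hincr' := gaussianReal_const_mul hincr (c n)
    have hind : IndepFun (fun ω => ∑ k ∈ Finset.range n, c k * (B (x (k + 1)) ω - B (x k) ω))
        (fun ω => c n * (B (x (n + 1)) ω - B (x n) ω)) P := by
      have h1 : IndepFun (fun ω => ∑ k ∈ Finset.range n, c k * (B (x (k + 1)) ω - B (x k) ω))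
          (fun ω => B (x (n + 1)) ω - B (x n) ω) P := by
        rw [IndepFun_iff_Indep]
        exact indep_of_indep_of_le_left (hB.2.2.2.2 _ _ (hx0 n) (hx n)).symm ih.1.comap_le
      exact h1.comp measurable_id (measurable_const_mul (c n))
    have h := gaussianReal_add_gaussianReal_of_indepFun hind ih.2.map_eq hincr'.map_eq
    simp_rw [Finset.sum_range_succ]
    convert! h using 2
    · simp
    · have e1 : 0 ≤ ∑ k ∈ Finset.range n, c k ^ 2 * (x (k + 1) - x k) :=
        Finset.sum_nonneg fun k _ => mul_nonneg (sq_nonneg _) (by linarith [hx k])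
      have e2 : 0 ≤ x (n + 1) - x n := by linarith [hx n]
      rw [Real.toNNReal_add e1 (by positivity)]
      congr 1
      ext
      simp [mul_nonneg (sq_nonneg (c n)) e2, e2]

/-- The law of the Wiener integral of a `C¹` function, written by integration by parts. -/
lemma hasLaw_wiener_integral [IsProbabilityMeasure P] (hB : IsStdBrownian P F B)
    {p p' : ℝ → ℝ} {T : ℝ} (hT : 0 ≤ T) (hp : ∀ t ∈ Icc 0 T, HasDerivAt p (p' t) t)
    (hp' : ContinuousOn p' (Icc 0 T)) :
    HasLaw (fun ω => p T * B T ω - ∫ t in (0 : ℝ)..T, B t ω * p' t)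
      (gaussianReal 0 (Real.toNNReal (∫ t in (0 : ℝ)..T, p t ^ 2))) P := by
  have hpc : ContinuousOn p (Icc 0 T) := fun t ht => (hp t ht).continuousAt.continuousWithinAt
  have hx : ∀ n k : ℕ, (k : ℝ) * (T / n) ≤ (k + 1 : ℕ) * (T / n) := fun n k => by
    have : 0 ≤ T / n := by positivity
    push_cast
    nlinarith
  have hlaw := fun n : ℕ => (hB.hasLaw_sum_mul_sub (x := fun k => k * (T / n))
    (fun k => by positivity) (hx n) (fun k => p (k * (T / n))) n).2
  refine hasLaw_gaussianReal_of_ae_tendsto hlaw tendsto_const_nhds ?_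
    (Eventually.of_forall fun ω => ?_)
  · refine (continuous_real_toNNReal.tendsto _).comp ?_
    have := tendsto_riemann_stieltjes_sum (f := fun t => p t ^ 2) (g := id) (g' := fun _ => 1)
      (τ := fun n k => k * (T / n)) hT (hpc.pow 2) (fun t _ => hasDerivAt_id t)
      continuousOn_const (fun n k _ => ⟨le_rfl, hx n k⟩)
    simpa using this
  · have := tendsto_riemann_stieltjes_sum (f := fun t => B t ω) (g := p) (g' := p')
      (τ := fun n k => (k + 1 : ℕ) * (T / n)) hT (hB.2.2.1 ω).continuousOn hp hp'
      (fun n k _ => ⟨hx n k, le_rfl⟩)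
    refine (this.const_sub (p T * B T ω)).congr' ?_
    filter_upwards [eventually_gt_atTop 0] with n hn
    have hn' : (0 : ℝ) < n := by exact_mod_cast hn
    have htel := Finset.sum_range_sub (fun k : ℕ => p (k * (T / n)) * B (k * (T / n)) ω) n
    have hTn : (n : ℝ) * (T / n) = T := by field_simp
    rw [hTn, Nat.cast_zero, zero_mul, hB.2.1 ω, mul_zero, sub_zero] at htel
    rw [← htel, ← Finset.sum_sub_distrib]
    refine Finset.sum_congr rfl fun k _ => ?_
    ring

lemma integrable_exp_mul_sub [IsProbabilityMeasure P] (hB : IsStdBrownian P F B) (θ : ℝ)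
    {s t : ℝ} (hs : 0 ≤ s) (hst : s ≤ t) :
    Integrable (fun ω => exp (θ * (B t ω - B s ω))) P := by
  have hlaw := hB.hasLaw_sub hs hst
  have := integrable_exp_mul_gaussianReal (μ := 0) (v := Real.toNNReal (t - s)) θ
  rw [← hlaw.map_eq] at this
  exact this.comp_aemeasurable hlaw.aemeasurable

lemma integral_exp_mul_sub [IsProbabilityMeasure P] (hB : IsStdBrownian P F B) (θ : ℝ)
    {s t : ℝ} (hs : 0 ≤ s) (hst : s ≤ t) :
    ∫ ω, exp (θ * (B t ω - B s ω)) ∂P = exp ((t - s) * θ ^ 2 / 2) := by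
  have h := mgf_gaussianReal (hB.hasLaw_sub hs hst).map_eq θ
  rw [mgf, Real.coe_toNNReal _ (by linarith), zero_mul, zero_add] at h
  exact h

/-- The exponential of a Brownian increment sampled along a grid is a submartingale. -/
lemma submartingale_exp_mul_sub [IsProbabilityMeasure P] (hB : IsStdBrownian P F B) (θ : ℝ)
    {x : ℕ → ℝ} (hx0 : 0 ≤ x 0) (hx : Monotone x) :
    Submartingale (fun k ω => exp (θ * (B (x k) ω - B (x 0) ω)))
      (⟨fun k => F (x k), fun _ _ h => F.mono (hx h), fun k => F.le (x k)⟩ :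
        Filtration ℕ mΩ) P := by
  have hxn : ∀ k, 0 ≤ x k := fun k => hx0.trans (hx (Nat.zero_le k))
  have hmeas : ∀ k, Measurable[F (x k)] (fun ω => exp (θ * (B (x k) ω - B (x 0) ω))) := fun k =>
    (((hB.1 (x k)).sub ((hB.1 (x 0)).mono (F.mono (hx (Nat.zero_le k))) le_rfl)).const_mul
      θ).exp
  refine submartingale_nat (fun k => (hmeas k).stronglyMeasurable)
    (fun k => hB.integrable_exp_mul_sub θ hx0 (hx (Nat.zero_le k))) fun k => ?_
  have hk : x k ≤ x (k + 1) := hx (Nat.le_succ k)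
  have hprod : (fun ω => exp (θ * (B (x (k + 1)) ω - B (x 0) ω)))
      = (fun ω => exp (θ * (B (x k) ω - B (x 0) ω)))
        * (fun ω => exp (θ * (B (x (k + 1)) ω - B (x k) ω))) := by
    ext ω
    rw [Pi.mul_apply, ← exp_add]
    ring_nf
  have hint := hB.integrable_exp_mul_sub θ (hxn k) hk
  have hpull := condExp_mul_of_stronglyMeasurable_left (m := F (x k)) (μ := P)
    (hmeas k).stronglyMeasurable
    (by rw [← hprod]; exact hB.integrable_exp_mul_sub θ hx0 (hx (Nat.zero_le (k + 1)))) hint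
  have hindep : P[fun ω => exp (θ * (B (x (k + 1)) ω - B (x k) ω)) | F (x k)]
      =ᵐ[P] fun _ => exp ((x (k + 1) - x k) * θ ^ 2 / 2) := by
    have hle : MeasurableSpace.comap (fun ω => B (x (k + 1)) ω - B (x k) ω) Real.measurableSpace
        ≤ mΩ := ((hB.measurable _).sub (hB.measurable _)).comap_le
    have := condExp_indep_eq hle (F.le (x k))
      (f := fun ω => exp (θ * (B (x (k + 1)) ω - B (x k) ω))) ?_
      (hB.2.2.2.2 _ _ (hxn k) hk)
    · rwa [hB.integral_exp_mul_sub θ (hxn k) hk] at this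
    · exact (((comap_measurable (fun ω => B (x (k + 1)) ω - B (x k) ω)).const_mul
        θ).exp).stronglyMeasurable
  filter_upwards [hpull, hindep] with ω h1 h2
  change _ ≤ (P[fun ω => exp (θ * (B (x (k + 1)) ω - B (x 0) ω)) | F (x k)]) ω
  rw [hprod, h1, Pi.mul_apply, h2]
  refine le_mul_of_one_le_right (exp_pos _).le (one_le_exp ?_)
  have : 0 ≤ x (k + 1) - x k := by linarith
  positivity

/-- Doob's maximal inequality for a Brownian increment sampled along a uniform grid. -/
lemma measure_exists_grid_lt_mul_sub_le [IsProbabilityMeasure P] (hB : IsStdBrownian P F B)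
    {θ : ℝ} (hθ : θ ^ 2 = 1) {s : ℝ} (hs : 0 ≤ s) (r : ℝ) {N : ℕ} (hN : 0 < N) :
    P {ω | ∃ k : ℕ, k ≤ N ∧ r < θ * (B (s + (k : ℝ) / N) ω - B s ω)}
      ≤ ENNReal.ofReal (exp (1 / 2 - r)) := by
  have hN' : (0 : ℝ) < N := by exact_mod_cast hN
  have hx : Monotone fun k : ℕ => s + (k : ℝ) / N := fun i j h => by
    have : (i : ℝ) ≤ j := by exact_mod_cast h
    dsimp only
    gcongr
  have hsub := hB.submartingale_exp_mul_sub θ (x := fun k : ℕ => s + (k : ℝ) / N)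
    (by simpa using hs) hx
  have hmax := maximal_ineq hsub (fun k ω => (exp_pos _).le) (ε := ⟨exp r, (exp_pos r).le⟩) N
  have hbound : ∀ S : Set Ω,
      ∫ ω in S, exp (θ * (B (s + (N : ℝ) / N) ω - B (s + ((0 : ℕ) : ℝ) / N) ω)) ∂P ≤ exp (1 / 2) := fun S => by
    have h0 : s + ((0 : ℕ) : ℝ) / N = s := by simp
    rw [h0, div_self hN'.ne']
    refine (setIntegral_le_integral (hB.integrable_exp_mul_sub θ hs (by linarith))
      (Eventually.of_forall fun ω => (exp_pos _).le)).trans ?_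
    rw [hB.integral_exp_mul_sub θ hs (by linarith), hθ]
    simp
  have hmax' := hmax.trans (ENNReal.ofReal_le_ofReal (hbound _))
  have hε : ENNReal.ofReal (exp r) = ((NNReal.mk (exp r) (exp_pos r).le : NNReal) : ENNReal) := by
    rw [ENNReal.ofReal, Real.toNNReal_of_nonneg (exp_pos r).le]
  rw [exp_sub, ENNReal.ofReal_div_of_pos (exp_pos r),
    ENNReal.le_div_iff_mul_le (Or.inl (by simp [exp_pos])) (Or.inl (by simp)), mul_comm, hε]
  refine le_trans ?_ hmax'
  refine mul_le_mul' le_rfl (measure_mono ?_)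
  rintro ω ⟨k, hk, hr⟩
  have h1 : exp r ≤ exp (θ * (B (s + (k : ℝ) / N) ω - B (s + ((0 : ℕ) : ℝ) / N) ω)) :=
    exp_le_exp.2 (by simpa using hr.le)
  exact h1.trans (Finset.le_sup' (fun k : ℕ => exp (θ * (B (s + (k : ℝ) / N) ω
    - B (s + ((0 : ℕ) : ℝ) / N) ω))) (Finset.mem_range.2 (Nat.lt_succ_of_le hk)))

/-- Maximal inequality for the supremum of a Brownian increment over a unit interval. -/
lemma measure_exists_lt_mul_sub_le [IsProbabilityMeasure P] (hB : IsStdBrownian P F B)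
    {θ : ℝ} (hθ : θ ^ 2 = 1) {s : ℝ} (hs : 0 ≤ s) (r : ℝ) :
    P {ω | ∃ t ∈ Icc s (s + 1), r < θ * (B t ω - B s ω)} ≤ ENNReal.ofReal (exp (1 / 2 - r)) := by
  set A : ℕ → Set Ω := fun n =>
    {ω | ∃ k : ℕ, k ≤ 2 ^ n ∧ r < θ * (B (s + (k : ℝ) / (2 ^ n : ℕ)) ω - B s ω)} with hA
  have hmono : Monotone A := by
    refine monotone_nat_of_le_succ fun n ω ⟨k, hk, hr⟩ => ⟨2 * k, ?_, ?_⟩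
    · rw [pow_succ]; omega
    · have : ((2 * k : ℕ) : ℝ) / (2 ^ (n + 1) : ℕ) = (k : ℝ) / (2 ^ n : ℕ) := by
        push_cast
        rw [pow_succ]
        field_simp
      rwa [this]
  have hsubset : {ω | ∃ t ∈ Icc s (s + 1), r < θ * (B t ω - B s ω)} ⊆ ⋃ n, A n := by
    rintro ω ⟨t, ht, hr⟩
    have hlim : Tendsto (fun n : ℕ => s + (⌊(t - s) * (2 ^ n : ℕ)⌋₊ : ℝ) / (2 ^ n : ℕ)) atTop
        (nhds t) := by
      have h := (tendsto_nat_floor_mul_div_atTop (R := ℝ) (a := t - s) (by linarith [ht.1])).comp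
        ((tendsto_natCast_atTop_atTop (R := ℝ)).comp
          (tendsto_pow_atTop_atTop_of_one_lt (r := 2) one_lt_two))
      simpa using h.const_add s
    have hlim' := (((hB.2.2.1 ω).tendsto t).comp hlim |>.sub_const (B s ω)).const_mul θ
    obtain ⟨n, hn⟩ := (hlim'.eventually_const_lt hr).exists
    refine mem_iUnion.2 ⟨n, _, ?_, hn⟩
    refine Nat.floor_le_of_le ?_
    have : (0 : ℝ) < (2 ^ n : ℕ) := by positivity
    nlinarith [ht.2]
  refine (measure_mono hsubset).trans ?_
  rw [hmono.measure_iUnion]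
  exact iSup_le fun n => hB.measure_exists_grid_lt_mul_sub_le hθ hs r (by positivity)

lemma ae_eventually_mul_sub_le [IsProbabilityMeasure P] (hB : IsStdBrownian P F B)
    {θ : ℝ} (hθ : θ ^ 2 = 1) :
    ∀ᵐ ω ∂P, ∀ᶠ n : ℕ in atTop, ∀ t ∈ Icc (n : ℝ) (n + 1),
      θ * (B t ω - B n ω) ≤ 2 * log (n + 1) := by
  have hsum : ∑' n : ℕ, P {ω | ∃ t ∈ Icc (n : ℝ) (n + 1), 2 * log (n + 1) < θ * (B t ω - B n ω)}
      ≠ ⊤ := by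
    have hs : Summable fun n : ℕ => exp (1 / 2 - 2 * log ((n : ℝ) + 1)) := by
      have h1 : Summable fun n : ℕ => 1 / ((n : ℝ)) ^ 2 :=
        Real.summable_one_div_nat_pow.2 one_lt_two
      have h2 := ((summable_nat_add_iff 1).2 h1).mul_left (exp (1 / 2))
      refine h2.congr fun n => ?_
      have h0 : (0 : ℝ) < n + 1 := by positivity
      rw [exp_sub, two_mul, exp_add, exp_log h0]
      push_cast
      field_simp
    refine ne_top_of_le_ne_top ?_ (ENNReal.tsum_le_tsum fun n =>
      hB.measure_exists_lt_mul_sub_le hθ n.cast_nonneg (2 * log (n + 1)))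
    exact hs.tsum_ofReal_ne_top
  filter_upwards [ae_eventually_notMem hsum] with ω hω
  filter_upwards [hω] with n hn t ht
  by_contra! h
  exact hn ⟨t, ht, h⟩

lemma ae_exists_abs_sub_natCast_le [IsProbabilityMeasure P] (hB : IsStdBrownian P F B)
    {ε : ℝ} (hε : 0 < ε) :
    ∀ᵐ ω ∂P, ∃ K : ℝ, 0 ≤ K ∧ ∀ n : ℕ, ∀ t ∈ Icc (n : ℝ) (n + 1),
      |B t ω - B n ω| ≤ K * (1 + n) ^ ε := by
  filter_upwards [hB.ae_eventually_mul_sub_le (θ := 1) (by norm_num),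
    hB.ae_eventually_mul_sub_le (θ := -1) (by norm_num)] with ω h1 h2
  obtain ⟨N, hN⟩ := eventually_atTop.1 (h1.and h2)
  obtain ⟨M, hM⟩ := (isCompact_Icc (a := (0 : ℝ)) (b := N + 1)).exists_bound_of_continuousOn
    (hB.2.2.1 ω).continuousOn
  have hM0 : 0 ≤ M := (norm_nonneg _).trans (hM 0 ⟨le_rfl, by positivity⟩)
  refine ⟨2 / ε + 2 * M, by positivity, fun n t ht => ?_⟩
  have hn0 : (0 : ℝ) ≤ n := n.cast_nonneg
  have hpow : 1 ≤ (1 + (n : ℝ)) ^ ε := one_le_rpow (by linarith) hε.le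
  rcases le_or_gt N n with h | h
  · have h3 := (hN n h).1 t ht
    have h4 := (hN n h).2 t ht
    have h5 : 2 * log ((n : ℝ) + 1) ≤ 2 / ε * (1 + n) ^ ε := by
      have := log_le_rpow_div (x := 1 + (n : ℝ)) (by linarith) hε
      rw [add_comm (n : ℝ) 1]
      calc 2 * log (1 + (n : ℝ)) ≤ 2 * ((1 + (n : ℝ)) ^ ε / ε) := by linarith
        _ = _ := by ring
    rw [abs_le]
    constructor <;> nlinarith
  · have hnN : (n : ℝ) + 1 ≤ N := by exact_mod_cast h
    have h3 := hM t ⟨by linarith [ht.1], by linarith [ht.2]⟩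
    have h4 := hM n ⟨by linarith, by linarith⟩
    rw [norm_eq_abs] at h3 h4
    have h5 := abs_sub (B t ω) (B n ω)
    have h6 : 0 ≤ 2 / ε * (1 + (n : ℝ)) ^ ε := by positivity
    nlinarith

/-- Polynomial growth of Brownian paths and of their increments over unit intervals. -/
lemma ae_exists_growth_bound [IsProbabilityMeasure P] (hB : IsStdBrownian P F B)
    {ε : ℝ} (hε : 0 < ε) :
    ∀ᵐ ω ∂P, ∃ K : ℝ, 0 ≤ K ∧ ∀ t : ℝ, 0 ≤ t → |B t ω| ≤ K * (1 + t) ^ (1 + ε) ∧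
      ∀ u ∈ Icc t (t + 1), |B u ω - B t ω| ≤ K * (1 + t) ^ ε := by
  filter_upwards [hB.ae_exists_abs_sub_natCast_le hε] with ω ⟨K, hK0, hK⟩
  have hpow_mono : ∀ {x y : ℝ}, 0 ≤ x → x ≤ y → K * (1 + x) ^ ε ≤ K * (1 + y) ^ ε :=
    fun hx hxy => mul_le_mul_of_nonneg_left (rpow_le_rpow (by linarith) (by linarith) hε.le) hK0
  have hnat : ∀ n : ℕ, |B n ω| ≤ n * (K * (1 + n) ^ ε) := by
    intro n
    induction n with
    | zero => simp [hB.2.1 ω]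
    | succ n ih =>
      have hn0 : (0 : ℝ) ≤ n := n.cast_nonneg
      have h1 := hK n (n + 1) ⟨by linarith, le_rfl⟩
      have h2 : |B (n + 1) ω| ≤ |B (n + 1) ω - B n ω| + |B n ω| := by
        simpa using abs_add_le (B (n + 1) ω - B n ω) (B n ω)
      have h3 := hpow_mono hn0 (by linarith : (n : ℝ) ≤ n + 1)
      push_cast
      nlinarith
  have hfloor : ∀ t : ℝ, 0 ≤ t → t ∈ Icc (⌊t⌋₊ : ℝ) (⌊t⌋₊ + 1) := fun t ht =>
    ⟨Nat.floor_le ht, (Nat.lt_floor_add_one t).le⟩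
  refine ⟨K * (2 ^ ε + 2), by positivity, fun t ht => ⟨?_, fun u hu => ?_⟩⟩
  · have h0 : (0 : ℝ) ≤ ⌊t⌋₊ := Nat.cast_nonneg _
    have h1 := hK ⌊t⌋₊ t (hfloor t ht)
    have h2 := hnat ⌊t⌋₊
    have h3 : |B t ω| ≤ |B t ω - B ⌊t⌋₊ ω| + |B ⌊t⌋₊ ω| := by
      simpa using abs_add_le (B t ω - B ⌊t⌋₊ ω) (B ⌊t⌋₊ ω)
    have h4 := hpow_mono h0 (hfloor t ht).1
    have h5 : 0 ≤ K * (1 + t) ^ ε := by positivity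
    have h6 : |B t ω| ≤ K * ((1 + t) * (1 + t) ^ ε) := by nlinarith [(hfloor t ht).1]
    rw [rpow_add (by linarith), rpow_one]
    refine h6.trans ?_
    have h7 : (0 : ℝ) < 2 ^ ε := by positivity
    have h8 : 0 ≤ K * ((1 + t) * (1 + t) ^ ε) := by positivity
    nlinarith
  · set n := ⌊t⌋₊ with hn
    have h0 : (0 : ℝ) ≤ n := Nat.cast_nonneg _
    have ht' := hfloor t ht
    have h1 := hK n t ht'
    have h4 := hpow_mono h0 ht'.1
    have h5 : 0 ≤ K * (1 + t) ^ ε := by positivity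
    have h6 : (0 : ℝ) < 2 ^ ε := by positivity
    rw [abs_sub_comm] at h1
    rcases le_total u (n + 1) with h | h
    · have h2 := hK n u ⟨ht'.1.trans hu.1, h⟩
      have h3 := abs_sub_le (B u ω) (B n ω) (B t ω)
      nlinarith
    · have h2 := hK n (n + 1) ⟨by linarith, le_rfl⟩
      have h3 := hK (n + 1) u (by push_cast; exact ⟨h, by linarith [hu.2, ht'.2]⟩)
      have h7 := abs_sub_le (B u ω) (B (n + 1) ω) (B t ω)
      have h8 := abs_sub_le (B (n + 1) ω) (B n ω) (B t ω)
      have h9 : K * (1 + ((n : ℝ) + 1)) ^ ε ≤ 2 ^ ε * (K * (1 + t) ^ ε) := by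
        rw [mul_left_comm, ← mul_rpow (by norm_num) (by linarith)]
        exact mul_le_mul_of_nonneg_left
          (rpow_le_rpow (by linarith) (by linarith [ht'.1]) hε.le) hK0
      push_cast at h3
      linarith

end IsStdBrownian

lemma exists_continuous_eq_of_continuousOn_Ici {f : ℝ → ℝ} (hf : ContinuousOn f (Ici 0)) :
    ∃ g : ℝ → ℝ, Continuous g ∧ ∀ t, 0 ≤ t → f t = g t ∧
      ∫ s in (0 : ℝ)..t, f s = ∫ s in (0 : ℝ)..t, g s := by
  refine ⟨fun t => f (max t 0),
    hf.comp_continuous (by fun_prop) fun t => le_max_right t 0, fun t ht => ⟨?_, ?_⟩⟩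
  · simp [max_eq_left ht]
  · refine intervalIntegral.integral_congr fun s hs => ?_
    rw [uIcc_of_le ht] at hs
    simp [max_eq_left hs.1]

lemma continuousOn_integral_of_continuousOn_Ici {f : ℝ → ℝ} (hf : ContinuousOn f (Ici 0)) :
    ContinuousOn (fun t => ∫ s in (0 : ℝ)..t, f s) (Ici 0) := by
  obtain ⟨g, hg, hfg⟩ := exists_continuous_eq_of_continuousOn_Ici hf
  exact (intervalIntegral.continuous_primitive (fun a b => hg.intervalIntegrable a b)
    0).continuousOn.congr fun t ht => (hfg t ht).2

lemma hasDerivAt_integral_of_continuousOn_Ici {f : ℝ → ℝ} (hf : ContinuousOn f (Ici 0)) {t : ℝ}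
    (ht : 0 < t) : HasDerivAt (fun t => ∫ s in (0 : ℝ)..t, f s) (f t) t := by
  obtain ⟨g, hg, hfg⟩ := exists_continuous_eq_of_continuousOn_Ici hf
  rw [(hfg t ht.le).1]
  refine (hg.integral_hasStrictDerivAt 0 t).hasDerivAt.congr_of_eventuallyEq ?_
  filter_upwards [Ioi_mem_nhds ht] with u hu using (hfg u (le_of_lt hu)).2

/-- A path `x` of the functional differential equation driven by a continuous path `β`. -/
structure IsSFDEPath (a b σ x₀ I₀ : ℝ) (β x : ℝ → ℝ) : Prop where
  continuous_noise : Continuous β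
  noise_zero : β 0 = 0
  continuousOn : ContinuousOn x (Ici 0)
  eq_integral : ∀ t, 0 ≤ t → x t = x₀
    + (∫ s in (0 : ℝ)..t, (a * x s + b / (1 + s) * (I₀ + ∫ u in (0 : ℝ)..s, x u))) + σ * β t

namespace IsSFDEPath

variable {a b σ x₀ I₀ : ℝ} {β x : ℝ → ℝ}

lemma continuousOn_drift (h : IsSFDEPath a b σ x₀ I₀ β x) :
    ContinuousOn (fun s => a * x s + b / (1 + s) * (I₀ + ∫ u in (0 : ℝ)..s, x u)) (Ici 0) := by
  refine (h.continuousOn.const_mul a).add (ContinuousOn.mul ?_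
    ((continuousOn_integral_of_continuousOn_Ici h.continuousOn).const_add I₀))
  refine continuousOn_const.div (by fun_prop) fun t ht => ?_
  have : (0 : ℝ) ≤ t := ht
  positivity

lemma hasDerivAt_sub_noise (h : IsSFDEPath a b σ x₀ I₀ β x) {t : ℝ} (ht : 0 < t) :
    HasDerivAt (fun t => x t - σ * β t)
      (a * x t + b / (1 + t) * (I₀ + ∫ u in (0 : ℝ)..t, x u)) t := by
  refine ((hasDerivAt_integral_of_continuousOn_Ici h.continuousOn_drift ht).const_add
    x₀).congr_of_eventuallyEq ?_
  filter_upwards [Ioi_mem_nhds ht] with u hu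
  rw [h.eq_integral u (le_of_lt hu)]
  ring

/-- Testing the equation against a solution `(p, q)` of the adjoint system. -/
lemma adjoint_identity (h : IsSFDEPath a b σ x₀ I₀ β x) {p q : ℝ → ℝ} {T : ℝ} (hT : 0 ≤ T)
    (hp : ∀ t ∈ Icc 0 T, HasDerivAt p (-a * p t - q t) t)
    (hq : ∀ t ∈ Icc 0 T, HasDerivAt q (-(b / (1 + t)) * p t) t) :
    p T * x T + q T * (I₀ + ∫ u in (0 : ℝ)..T, x u) = p 0 * x₀ + q 0 * I₀
      + σ * (p T * β T - ∫ t in (0 : ℝ)..T, β t * (-a * p t - q t)) := by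
  have hpc : ContinuousOn p (Icc 0 T) := fun t ht => (hp t ht).continuousAt.continuousWithinAt
  have hqc : ContinuousOn q (Icc 0 T) := fun t ht => (hq t ht).continuousAt.continuousWithinAt
  have hsub : Icc 0 T ⊆ Ici (0 : ℝ) := fun t ht => ht.1
  have hβ := h.continuous_noise
  have hx0 : x 0 = x₀ := by simp [h.eq_integral 0 le_rfl, h.noise_zero]
  have hint : IntervalIntegrable (fun t => -σ * (β t * (-a * p t - q t))) volume 0 T := by
    refine ContinuousOn.intervalIntegrable ?_
    rw [uIcc_of_le hT]
    fun_prop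
  have key := intervalIntegral.integral_eq_sub_of_hasDerivAt_of_le
    (f := fun t => p t * (x t - σ * β t) + q t * (I₀ + ∫ u in (0 : ℝ)..t, x u)) hT ?_ ?_ hint
  · rw [intervalIntegral.integral_const_mul] at key
    simp only [intervalIntegral.integral_same, h.noise_zero, hx0] at key
    linear_combination -key
  · have h1 := h.continuousOn.mono hsub
    have h2 := (continuousOn_integral_of_continuousOn_Ici h.continuousOn).mono hsub
    fun_prop
  · intro t ht
    have ht' : t ∈ Icc 0 T := ⟨ht.1.le, ht.2.le⟩
    convert! ((hp t ht').mul (h.hasDerivAt_sub_noise ht.1)).add ((hq t ht').mul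
      ((hasDerivAt_integral_of_continuousOn_Ici h.continuousOn ht.1).const_add I₀)) using 1
    ring

end IsSFDEPath

/-- First component of the decaying solution of the adjoint system of the functional differential
equation with `a = -α`, `b = α κ`. -/
def adjointP (α κ t : ℝ) : ℝ := kummerLaplace α (κ - 1) (κ + 1) (1 + t)

/-- Second component of the decaying solution of the adjoint system. -/
def adjointQ (α κ t : ℝ) : ℝ := kummerLaplace α (κ - 1) κ (1 + t)

section Adjoint

variable {α κ t : ℝ}

lemma adjointP_pos (hα : 0 < α) (hκ : 0 < κ) (ht : 0 ≤ t) : 0 < adjointP α κ t :=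
  kummerLaplace_pos hα (by linarith) (by linarith) (by linarith)

lemma adjointQ_pos (hα : 0 < α) (hκ : 0 < κ) (ht : 0 ≤ t) : 0 < adjointQ α κ t :=
  kummerLaplace_pos hα (by linarith) (by linarith) (by linarith)

lemma adjointQ_eq (hα : 0 < α) (hκ : 0 < κ) (ht : 0 ≤ t) :
    adjointQ α κ t = α * adjointP α κ t + kummerLaplace α κ (κ + 1) (1 + t) := by
  have := kummerLaplace_eq_add (c := κ - 1) (d := κ) (s := 1 + t) hα (by linarith) hκ.le
    (by linarith)
  rwa [sub_add_cancel] at this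

lemma hasDerivAt_adjointP (hα : 0 < α) (hκ : 0 < κ) (ht : 0 ≤ t) :
    HasDerivAt (adjointP α κ) (-(-α) * adjointP α κ t - adjointQ α κ t) t := by
  have h := hasDerivAt_kummerLaplace (c := κ - 1) (d := κ + 1) (s := 1 + t) hα (by linarith)
    (by linarith) (by linarith)
  rw [sub_add_cancel] at h
  convert! h.comp_const_add 1 t using 1
  rw [adjointQ_eq hα hκ ht]
  ring

lemma hasDerivAt_adjointQ (hα : 0 < α) (hκ : 0 < κ) (ht : 0 ≤ t) :
    HasDerivAt (adjointQ α κ) (-(α * κ / (1 + t)) * adjointP α κ t) t := by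
  have h := hasDerivAt_kummerLaplace (c := κ - 1) (d := κ) (s := 1 + t) hα (by linarith)
    hκ.le (by linarith)
  rw [sub_add_cancel] at h
  convert! h.comp_const_add 1 t using 1
  have h2 := mul_kummerLaplace_self (κ := κ) (s := 1 + t) hα hκ (by linarith)
  have : (1 + t) ≠ 0 := by linarith
  rw [adjointP]
  field_simp
  linarith

lemma mul_adjointP_le (hα : 0 < α) (hκ : 0 < κ) (ht : 0 ≤ t) :
    α * adjointP α κ t ≤ adjointQ α κ t := by
  rw [adjointQ_eq hα hκ ht]
  linarith [kummerLaplace_pos (c := κ) (d := κ + 1) (s := 1 + t) hα (by linarith) (by linarith)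
    (by linarith)]

lemma exists_adjoint_bound (hα : 0 < α) (hκ : 0 < κ) : ∃ c : ℝ, 0 ≤ c ∧ ∀ t, 0 ≤ t →
    adjointP α κ t ≤ c * (1 + t) ^ (-κ) ∧ adjointQ α κ t ≤ c * (1 + t) ^ (-κ) ∧
    |-(-α) * adjointP α κ t - adjointQ α κ t| ≤ c * (1 + t) ^ (-κ - 1) := by
  have hG : ∀ d : ℝ, 0 < α ^ (-d) * Gamma κ := fun d => mul_pos (rpow_pos_of_pos hα _)
    (Gamma_pos_of_pos hκ)
  have hG' : 0 < α ^ (-(κ + 1)) * Gamma (κ + 1) := mul_pos (rpow_pos_of_pos hα _)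
    (Gamma_pos_of_pos (by linarith))
  refine ⟨α ^ (-(κ + 1)) * Gamma κ + α ^ (-κ) * Gamma κ + α ^ (-(κ + 1)) * Gamma (κ + 1), ?_,
    fun t ht => ?_⟩
  · linarith [hG (κ + 1), hG κ]
  · have hs : 0 < 1 + t := by linarith
    have h1 := kummerLaplace_le (c := κ - 1) (d := κ + 1) hα (by linarith) (by linarith) hs
    have h2 := kummerLaplace_le (c := κ - 1) (d := κ) hα (by linarith) (by linarith) hs
    have h3 := kummerLaplace_le (c := κ) (d := κ + 1) hα (by linarith) (by linarith) hs
    have h4 := kummerLaplace_pos (c := κ) (d := κ + 1) hα (by linarith) (by linarith) hs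
    rw [sub_add_cancel] at h1 h2
    rw [neg_add'] at h3
    have e1 : 0 < (1 + t) ^ (-κ) := by positivity
    have e2 : 0 < (1 + t) ^ (-κ - 1) := by positivity
    refine ⟨h1.trans ?_, h2.trans ?_, ?_⟩
    · exact mul_le_mul_of_nonneg_right (by linarith [hG κ]) e1.le
    · exact mul_le_mul_of_nonneg_right (by linarith [hG (κ + 1)]) e1.le
    · rw [adjointQ_eq hα hκ ht, neg_neg, sub_add_cancel_left, abs_neg, abs_of_pos h4]
      refine h3.trans ?_
      rw [neg_add']
      refine mul_le_mul_of_nonneg_right ?_ e2.le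
      rw [← neg_add']
      linarith [hG κ, hG (κ + 1)]

lemma tendsto_rpow_mul_adjointQ (hα : 0 < α) (hκ : 0 < κ) :
    Tendsto (fun t => (1 + t) ^ κ * adjointQ α κ t) atTop (nhds (α ^ (-κ) * Gamma κ)) := by
  have h := tendsto_rpow_mul_kummerLaplace (c := κ - 1) (d := κ) hα (by linarith) hκ.le
  rw [sub_add_cancel] at h
  exact h.comp (tendsto_atTop_add_const_left _ 1 tendsto_id)

lemma integrableOn_adjointP_sq (hα : 0 < α) (hκ : 1 < κ) :
    IntegrableOn (fun t => adjointP α κ t ^ 2) (Ioi 0) := by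
  obtain ⟨c, hc0, hc⟩ := exists_adjoint_bound hα (by linarith : 0 < κ)
  have hcont : ContinuousOn (fun t => adjointP α κ t ^ 2) (Ioi 0) := fun t ht =>
    ((hasDerivAt_adjointP hα (by linarith) (le_of_lt ht)).continuousAt.pow 2).continuousWithinAt
  refine Integrable.mono' ((integrableOn_add_rpow_Ioi_of_lt (m := 1) (a := -(2 * κ)) (c := 0)
    (by linarith) (by norm_num)).const_mul (c ^ 2))
    (hcont.aestronglyMeasurable measurableSet_Ioi)
    ((ae_restrict_iff' measurableSet_Ioi).2 (Eventually.of_forall fun t ht => ?_))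
  have ht' : (0 : ℝ) < t := ht
  have h1 := (hc t ht'.le).1
  have h2 := adjointP_pos hα (by linarith : 0 < κ) ht'.le
  rw [norm_of_nonneg (by positivity)]
  calc adjointP α κ t ^ 2 ≤ (c * (1 + t) ^ (-κ)) ^ 2 := by gcongr
    _ = c ^ 2 * (t + 1) ^ (-(2 * κ)) := by
      rw [mul_pow, ← rpow_natCast ((1 + t) ^ (-κ)), ← rpow_mul (by positivity), add_comm 1 t]
      push_cast
      ring_nf

lemma integral_adjointP_sq_pos (hα : 0 < α) (hκ : 1 < κ) :
    0 < ∫ t in Ioi 0, adjointP α κ t ^ 2 := by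
  have hpos : ∀ t ∈ Ioi (0 : ℝ), 0 < adjointP α κ t ^ 2 := fun t ht =>
    pow_pos (adjointP_pos hα (by linarith) (le_of_lt ht)) 2
  rw [setIntegral_pos_iff_support_of_nonneg_ae
    ((ae_restrict_iff' measurableSet_Ioi).2 (Eventually.of_forall fun t ht => (hpos t ht).le))
    (integrableOn_adjointP_sq hα hκ)]
  have : Function.support (fun t => adjointP α κ t ^ 2) ∩ Ioi 0 = Ioi 0 :=
    inter_eq_right.2 fun t ht => (hpos t ht).ne'
  rw [this]
  simp

end Adjoint

/-- The adjoint system with terminal data `(1, 0)` at time `T`. -/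
lemma exists_adjoint_terminal {α κ T : ℝ} (hα : 0 < α) (hκ : 0 < κ) (hT : 0 ≤ T) :
    ∃ p q : ℝ → ℝ, (∀ t ∈ Icc 0 T, HasDerivAt p (-(-α) * p t - q t) t) ∧
      (∀ t ∈ Icc 0 T, HasDerivAt q (-(α * κ / (1 + t)) * p t) t) ∧ p T = 1 ∧ q T = 0 := by
  have hcont : ContinuousOn (fun r => exp (α * r) / adjointP α κ r ^ 2) (Ici 0) := fun r hr =>
    (ContinuousAt.div (by fun_prop) ((hasDerivAt_adjointP hα hκ hr).continuousAt.pow 2)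
      (pow_ne_zero 2 (adjointP_pos hα hκ hr).ne')).continuousWithinAt
  obtain ⟨g, hg, hfg⟩ := exists_continuous_eq_of_continuousOn_Ici hcont
  set R : ℝ → ℝ := fun t => ∫ r in T..t, g r with hR
  have hR' : ∀ t ∈ Icc 0 T, HasDerivAt R (exp (α * t) / adjointP α κ t ^ 2) t := fun t ht => by
    rw [(hfg t ht.1).1]
    exact (hg.integral_hasStrictDerivAt T t).hasDerivAt
  have hRT : R T = 0 := intervalIntegral.integral_same
  have hexp : ∀ t, HasDerivAt (fun t => exp (α * t)) (exp (α * t) * α) t := fun t => by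
    simpa using ((hasDerivAt_id t).const_mul α).exp
  set c₁ := 1 / adjointP α κ T
  set c₂ := adjointQ α κ T * exp (-(α * T))
  have hpT := (adjointP_pos hα hκ hT).ne'
  refine ⟨fun t => c₁ * adjointP α κ t + c₂ * (adjointP α κ t * R t),
    fun t => c₁ * adjointQ α κ t + c₂ * (adjointQ α κ t * R t - exp (α * t) / adjointP α κ t),
    fun t ht => ?_, fun t ht => ?_, ?_, ?_⟩
  · have hp := hasDerivAt_adjointP hα hκ ht.1
    have hpt := (adjointP_pos hα hκ ht.1).ne'
    convert! (hp.const_mul c₁).add ((hp.mul (hR' t ht)).const_mul c₂) using 1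
    field_simp
    ring
  · have hp := hasDerivAt_adjointP hα hκ ht.1
    have hq := hasDerivAt_adjointQ hα hκ ht.1
    have hpt := (adjointP_pos hα hκ ht.1).ne'
    convert! (hq.const_mul c₁).add
      (((hq.mul (hR' t ht)).sub ((hexp t).div hp hpt)).const_mul c₂) using 1
    have : 1 + t ≠ 0 := by linarith [ht.1]
    field_simp
    ring
  · simp [hRT, c₁, hpT]
  · simp only [hRT, c₁, c₂, exp_neg]
    field_simp
    ring

namespace IsSolutionSFDE

variable {Ω : Type*} {mΩ : MeasurableSpace Ω} {P : Measure Ω}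
  {F : MeasureTheory.Filtration ℝ mΩ} {a b σ : ℝ} {ψ : ℝ → ℝ} {B X : ℝ → Ω → ℝ}

lemma ae_isSFDEPath (hX : IsSolutionSFDE P F a b σ ψ B X) (hB : IsStdBrownian P F B) :
    ∀ᵐ ω ∂P, IsSFDEPath a b σ (ψ 0) (∫ u in (-1 : ℝ)..0, ψ u) (fun t => B t ω)
      (fun t => X t ω) := by
  filter_upwards [hX.2.2] with ω hω
  exact ⟨hB.2.2.1 ω, hB.2.1 ω, hX.2.1 ω, hω⟩

/-- Testing a solution against an adjoint solution yields a Gaussian variable. -/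
lemma hasLaw_adjoint [IsProbabilityMeasure P] (hX : IsSolutionSFDE P F a b σ ψ B X)
    (hB : IsStdBrownian P F B) {p q : ℝ → ℝ} {T : ℝ} (hT : 0 ≤ T)
    (hp : ∀ t ∈ Icc 0 T, HasDerivAt p (-a * p t - q t) t)
    (hq : ∀ t ∈ Icc 0 T, HasDerivAt q (-(b / (1 + t)) * p t) t) :
    HasLaw (fun ω => p T * X T ω + q T * ((∫ u in (-1 : ℝ)..0, ψ u) + ∫ u in (0 : ℝ)..T, X u ω))
      (gaussianReal (p 0 * ψ 0 + q 0 * ∫ u in (-1 : ℝ)..0, ψ u)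
        (.mk (σ ^ 2) (sq_nonneg _) * Real.toNNReal (∫ t in (0 : ℝ)..T, p t ^ 2))) P := by
  have hpc : ContinuousOn p (Icc 0 T) := fun t ht => (hp t ht).continuousAt.continuousWithinAt
  have hqc : ContinuousOn q (Icc 0 T) := fun t ht => (hq t ht).continuousAt.continuousWithinAt
  have hlaw := gaussianReal_const_add (gaussianReal_const_mul
    (hB.hasLaw_wiener_integral hT hp (by fun_prop)) σ) (p 0 * ψ 0 + q 0 * ∫ u in (-1 : ℝ)..0, ψ u)
  rw [mul_zero, zero_add] at hlaw
  refine hlaw.congr ?_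
  filter_upwards [hX.ae_isSFDEPath hB] with ω hω using hω.adjoint_identity hT hp hq

lemma exists_hasLaw_gaussianReal [IsProbabilityMeasure P] {α κ : ℝ}
    (hX : IsSolutionSFDE P F (-α) (α * κ) σ ψ B X) (hB : IsStdBrownian P F B) (hα : 0 < α)
    (hκ : 0 < κ) {T : ℝ} (hT : 0 ≤ T) :
    ∃ m v, HasLaw (X T) (gaussianReal m v) P := by
  obtain ⟨p, q, hp, hq, hpT, hqT⟩ := exists_adjoint_terminal hα hκ hT
  have h := hX.hasLaw_adjoint hB hT hp hq
  simp only [hpT, hqT, one_mul, zero_mul, add_zero] at h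
  exact ⟨_, _, h⟩

end IsSolutionSFDE

lemma tendsto_one_add_rpow_neg {e : ℝ} (he : e < 0) :
    Tendsto (fun t : ℝ => (1 + t) ^ e) atTop (nhds 0) := by
  have := (tendsto_rpow_neg_atTop (y := -e) (by linarith)).comp
    (tendsto_atTop_add_const_left (α := ℝ) atTop 1 tendsto_id)
  simpa [Function.comp_def] using this

lemma tendsto_zero_of_abs_le_rpow {f : ℝ → ℝ} {M e : ℝ} (he : e < 0)
    (hf : ∀ t, 0 ≤ t → |f t| ≤ M * (1 + t) ^ e) : Tendsto f atTop (nhds 0) := by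
  refine squeeze_zero_norm' (a := fun t => M * (1 + t) ^ e) ?_
    (by simpa using (tendsto_one_add_rpow_neg he).const_mul M)
  filter_upwards [eventually_ge_atTop (0 : ℝ)] with t ht using hf t ht

namespace IsSFDEPath

variable {α κ ε K σ x₀ I₀ : ℝ} {β x : ℝ → ℝ}

lemma exists_tendsto_adjoint (h : IsSFDEPath (-α) (α * κ) σ x₀ I₀ β x) (hα : 0 < α) (hκ : 0 < κ)
    (hε : 1 + ε < κ) (hβ : ∀ t, 0 ≤ t → |β t| ≤ K * (1 + t) ^ (1 + ε)) :
    ∃ y, Tendsto (fun t => adjointP α κ t * x t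
      + adjointQ α κ t * (I₀ + ∫ u in (0 : ℝ)..t, x u)) atTop (nhds y) := by
  obtain ⟨c, hc0, hc⟩ := exists_adjoint_bound hα hκ
  have hβc := h.continuous_noise
  have hpβ : Tendsto (fun t => adjointP α κ t * β t) atTop (nhds 0) := by
    refine tendsto_zero_of_abs_le_rpow (M := c * K) (e := -κ + (1 + ε)) (by linarith)
      fun t ht => ?_
    rw [abs_mul, abs_of_pos (adjointP_pos hα hκ ht), rpow_add (by linarith)]
    calc _ ≤ (c * (1 + t) ^ (-κ)) * (K * (1 + t) ^ (1 + ε)) :=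
          mul_le_mul (hc t ht).1 (hβ t ht) (abs_nonneg _) (by positivity)
      _ = _ := by ring
  have hint : IntegrableOn (fun t => β t * (-(-α) * adjointP α κ t - adjointQ α κ t))
      (Ioi 0) := by
    have hcont : ContinuousOn (fun t => β t * (-(-α) * adjointP α κ t - adjointQ α κ t))
        (Ioi 0) := fun t ht => by
      have h1 := (hasDerivAt_adjointP hα hκ (le_of_lt ht)).continuousAt
      have h2 := (hasDerivAt_adjointQ hα hκ (le_of_lt ht)).continuousAt
      exact ContinuousAt.continuousWithinAt (by fun_prop)
    refine Integrable.mono' ((integrableOn_add_rpow_Ioi_of_lt (m := 1) (a := ε - κ) (c := 0)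
      (by linarith) (by norm_num)).const_mul (K * c))
      (hcont.aestronglyMeasurable measurableSet_Ioi)
      ((ae_restrict_iff' measurableSet_Ioi).2 (Eventually.of_forall fun t ht => ?_))
    have ht' : (0 : ℝ) ≤ t := le_of_lt ht
    rw [norm_mul, norm_eq_abs, norm_eq_abs]
    calc _ ≤ (K * (1 + t) ^ (1 + ε)) * (c * (1 + t) ^ (-κ - 1)) :=
          mul_le_mul (hβ t ht') (hc t ht').2.2 (abs_nonneg _) ((abs_nonneg _).trans (hβ t ht'))
      _ = K * c * ((1 + t) ^ (1 + ε) * (1 + t) ^ (-κ - 1)) := by ring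
      _ = _ := by
        rw [← rpow_add (by linarith), add_comm 1 t]
        ring_nf
  have hlim := ((hpβ.sub (intervalIntegral_tendsto_integral_Ioi 0 hint tendsto_id)).const_mul
    σ).const_add (adjointP α κ 0 * x₀ + adjointQ α κ 0 * I₀)
  refine ⟨_, hlim.congr' ?_⟩
  filter_upwards [eventually_ge_atTop (0 : ℝ)] with T hT
  exact (h.adjoint_identity hT (fun t ht => hasDerivAt_adjointP hα hκ ht.1)
    fun t ht => hasDerivAt_adjointQ hα hκ ht.1).symm

/-- Subtracting from the path the noise, recentred by its moving average, gives a
differentiable path whose rescaling solves a relaxation equation. -/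
lemma hasDerivAt_rescaled (h : IsSFDEPath (-α) (α * κ) σ x₀ I₀ β x) (hα : 0 < α) (hκ : 0 < κ)
    {t : ℝ} (ht : 0 < t) :
    HasDerivAt (fun t => (1 + t) * adjointQ α κ t
        * (x t - σ * (β t - ∫ u in t..t + 1, β u)))
      (-(α + 2 * (α * κ) * adjointP α κ t / ((1 + t) * adjointQ α κ t) - 1 / (1 + t))
          * ((1 + t) * adjointQ α κ t * (x t - σ * (β t - ∫ u in t..t + 1, β u)))
        + (α * κ * (adjointP α κ t * x t + adjointQ α κ t * (I₀ + ∫ u in (0 : ℝ)..t, x u))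
          + σ * ((1 + t) * adjointQ α κ t
              * ((β (t + 1) - β t) - α * (β t - ∫ u in t..t + 1, β u))
            - α * κ * (adjointP α κ t * (β t - ∫ u in t..t + 1, β u))))) t := by
  have hβc := h.continuous_noise
  have hA : HasDerivAt (fun t => ∫ u in t..t + 1, β u) (β (t + 1) - β t) t := by
    have hprim : ∀ s, HasDerivAt (fun s => ∫ u in (0 : ℝ)..s, β u) (β s) s := fun s =>
      (hβc.integral_hasStrictDerivAt 0 s).hasDerivAt
    refine (((hprim (t + 1)).comp_add_const t 1).sub (hprim t)).congr_of_eventuallyEq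
      (Eventually.of_forall fun s => ?_)
    exact (intervalIntegral.integral_interval_sub_left (hβc.intervalIntegrable _ _)
      (hβc.intervalIntegrable _ _)).symm
  have hx : HasDerivAt (fun t => x t - σ * (β t - ∫ u in t..t + 1, β u))
      (-α * x t + α * κ / (1 + t) * (I₀ + ∫ u in (0 : ℝ)..t, x u)
        + σ * (β (t + 1) - β t)) t := by
    refine ((h.hasDerivAt_sub_noise ht).add (hA.const_mul σ)).congr_of_eventuallyEq
      (Eventually.of_forall fun s => ?_)
    simp only [Pi.add_apply]
    ring
  have hq := hasDerivAt_adjointQ hα hκ ht.le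
  have hs : 1 + t ≠ 0 := by linarith
  have hq0 := (adjointQ_pos hα hκ ht.le).ne'
  convert! ((((hasDerivAt_id t).const_add 1).mul hq).mul hx) using 1
  simp only [id, Pi.mul_apply]
  field_simp
  ring

lemma tendsto_rpow_mul (h : IsSFDEPath (-α) (α * κ) σ x₀ I₀ β x) (hα : 0 < α) (hκ : 0 < κ)
    (hε : 1 + ε < κ)
    (hβ : ∀ t, 0 ≤ t → ∀ u ∈ Icc t (t + 1), |β u - β t| ≤ K * (1 + t) ^ ε) {y : ℝ}
    (hy : Tendsto (fun t => adjointP α κ t * x t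
      + adjointQ α κ t * (I₀ + ∫ u in (0 : ℝ)..t, x u)) atTop (nhds y)) :
    Tendsto (fun t => t ^ (1 - κ) * x t) atTop (nhds (κ / (α ^ (-κ) * Gamma κ) * y)) := by
  obtain ⟨c, hc0, hc⟩ := exists_adjoint_bound hα hκ
  have hβc := h.continuous_noise
  set D : ℝ → ℝ := fun t => β t - ∫ u in t..t + 1, β u with hD
  have hDle : ∀ t, 0 ≤ t → |D t| ≤ K * (1 + t) ^ ε := fun t ht => by
    have e : D t = ∫ u in t..t + 1, (β t - β u) := by
      rw [intervalIntegral.integral_sub (by simp) (hβc.intervalIntegrable _ _)]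
      simp [hD]
    have := intervalIntegral.norm_integral_le_of_norm_le_const (f := fun u => β t - β u)
      (a := t) (b := t + 1) (C := K * (1 + t) ^ ε) fun u hu => by
        rw [uIoc_of_le (by linarith)] at hu
        rw [norm_eq_abs, abs_sub_comm]
        exact hβ t ht u ⟨hu.1.le, hu.2⟩
    rw [e]
    simpa using this
  have hQ : ∀ {f : ℝ → ℝ}, (∀ t, 0 ≤ t → |f t| ≤ K * (1 + t) ^ ε) →
      Tendsto (fun t => (1 + t) * adjointQ α κ t * f t) atTop (nhds 0) := fun {f} hf => by
    refine tendsto_zero_of_abs_le_rpow (M := c * K) (e := 1 + -κ + ε) (by linarith) fun t ht => ?_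
    have hs : 0 < 1 + t := by linarith
    rw [abs_mul, abs_mul, abs_of_pos hs, abs_of_pos (adjointQ_pos hα hκ ht), rpow_add hs,
      rpow_add hs, rpow_one]
    calc _ ≤ (1 + t) * (c * (1 + t) ^ (-κ)) * (K * (1 + t) ^ ε) :=
          mul_le_mul (mul_le_mul_of_nonneg_left (hc t ht).2.1 hs.le) (hf t ht) (abs_nonneg _)
            (by positivity)
      _ = _ := by ring
  have hQD := hQ hDle
  have hQΔ := hQ (f := fun t => β (t + 1) - β t) fun t ht =>
    hβ t ht _ ⟨by linarith, le_rfl⟩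
  have hratio : Tendsto (fun t => adjointP α κ t / ((1 + t) * adjointQ α κ t)) atTop
      (nhds 0) := by
    refine tendsto_zero_of_abs_le_rpow (M := 1 / α) (e := -1) (by norm_num) fun t ht => ?_
    have hs : 0 < 1 + t := by linarith
    have hp := adjointP_pos hα hκ ht
    have hq := adjointQ_pos hα hκ ht
    rw [abs_of_pos (by positivity), rpow_neg_one, ← one_div, div_mul_div_comm,
      div_le_div_iff₀ (by positivity) (by positivity)]
    nlinarith [mul_le_mul_of_nonneg_right (mul_adjointP_le hα hκ ht) hs.le]
  have hPD : Tendsto (fun t => adjointP α κ t * D t) atTop (nhds 0) := by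
    refine (by simpa using hratio.mul hQD : Tendsto _ _ (nhds (0 : ℝ))).congr' ?_
    filter_upwards [eventually_ge_atTop (0 : ℝ)] with t ht
    have hs : 1 + t ≠ 0 := by linarith
    have hq := (adjointQ_pos hα hκ ht).ne'
    field_simp
  have hinv : Tendsto (fun t : ℝ => 1 / (1 + t)) atTop (nhds 0) := by
    simpa [rpow_neg_one] using tendsto_one_add_rpow_neg (e := -1) (by norm_num)
  have hw := tendsto_of_hasDerivAt_relaxation (α := α) (ℓ := α * κ * y)
    (w := fun t => (1 + t) * adjointQ α κ t * (x t - σ * D t)) hα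
    (by filter_upwards [eventually_gt_atTop (0 : ℝ)] with t ht
        exact h.hasDerivAt_rescaled hα hκ ht) ?_ ?_
  · have hL : α ^ (-κ) * Gamma κ ≠ 0 :=
      (mul_pos (rpow_pos_of_pos hα _) (Gamma_pos_of_pos hκ)).ne'
    have h1 := (hw.add (hQD.const_mul σ)).div (tendsto_rpow_mul_adjointQ hα hκ) hL
    have h2 : Tendsto (fun t : ℝ => (t / (1 + t)) ^ (1 - κ)) atTop (nhds 1) := by
      have : Tendsto (fun t : ℝ => t / (1 + t)) atTop (nhds 1) := by
        refine (by simpa using hinv.const_sub 1 :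
          Tendsto (fun t : ℝ => 1 - 1 / (1 + t)) atTop (nhds 1)).congr' ?_
        filter_upwards [eventually_ge_atTop (0 : ℝ)] with t ht
        have : 1 + t ≠ 0 := by linarith
        field_simp
        ring
      simpa using this.rpow_const (p := 1 - κ) (Or.inl one_ne_zero)
    refine ((h2.mul h1).congr' ?_).trans (le_of_eq ?_)
    · filter_upwards [eventually_gt_atTop (0 : ℝ)] with t ht
      have hs : 0 < 1 + t := by linarith
      have hq := (adjointQ_pos hα hκ ht.le).ne'
      have hsκ : (1 + t) ^ κ ≠ 0 := by positivity
      rw [Pi.div_apply, div_rpow ht.le hs.le, rpow_sub hs, rpow_one]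
      field_simp
      ring
    · congr 1
      field_simp
      ring
  · have := ((hratio.const_mul (2 * (α * κ))).const_add α).sub hinv
    simpa [mul_div_assoc] using this
  · have := (hy.const_mul (α * κ)).add
      (((hQΔ.sub (hQD.const_mul α)).sub (hPD.const_mul (α * κ))).const_mul σ)
    simp only [mul_zero, sub_zero, add_zero] at this
    refine this.congr fun t => ?_
    ring

end IsSFDEPath

namespace IsSolutionSFDE

variable {Ω : Type*} {mΩ : MeasurableSpace Ω} {P : Measure Ω}
  {F : MeasureTheory.Filtration ℝ mΩ} {σ α κ : ℝ} {ψ : ℝ → ℝ} {B X : ℝ → Ω → ℝ}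

/-- The adjoint martingale converges almost surely to a nondegenerate Gaussian limit, which
determines the asymptotics of the solution. -/
lemma exists_limit [IsProbabilityMeasure P] (hX : IsSolutionSFDE P F (-α) (α * κ) σ ψ B X)
    (hB : IsStdBrownian P F B) (hσ : 0 < σ) (hα : 0 < α) (hκ : 1 < κ) :
    ∃ (Y : Ω → ℝ) (m : ℝ) (v : NNReal), 0 < v ∧ HasLaw Y (gaussianReal m v) P ∧
      ∀ᵐ ω ∂P, Tendsto (fun t => t ^ (1 - κ) * X t ω) atTop
        (nhds (κ / (α ^ (-κ) * Gamma κ) * Y ω)) := by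
  have hκ0 : 0 < κ := by linarith
  set ε := (κ - 1) / 2 with hε
  have hpath : ∀ᵐ ω ∂P, ∃ y, Tendsto (fun t => adjointP α κ t * X t ω + adjointQ α κ t
        * ((∫ u in (-1 : ℝ)..0, ψ u) + ∫ u in (0 : ℝ)..t, X u ω)) atTop (nhds y) ∧
      Tendsto (fun t => t ^ (1 - κ) * X t ω) atTop
        (nhds (κ / (α ^ (-κ) * Gamma κ) * y)) := by
    filter_upwards [hX.ae_isSFDEPath hB, hB.ae_exists_growth_bound (ε := ε) (by linarith)]
      with ω hω ⟨K, _, hK⟩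
    obtain ⟨y, hy⟩ := hω.exists_tendsto_adjoint hα hκ0 (by linarith) fun t ht => (hK t ht).1
    exact ⟨y, hy, hω.tendsto_rpow_mul hα hκ0 (ε := ε) (by linarith)
      (fun t ht => (hK t ht).2) hy⟩
  choose! Y hY using fun ω (h : ∃ y, Tendsto (fun t => adjointP α κ t * X t ω + adjointQ α κ t
        * ((∫ u in (-1 : ℝ)..0, ψ u) + ∫ u in (0 : ℝ)..t, X u ω)) atTop (nhds y) ∧
      Tendsto (fun t => t ^ (1 - κ) * X t ω) atTop
        (nhds (κ / (α ^ (-κ) * Gamma κ) * y))) => h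
  have hvar := (continuous_real_toNNReal.tendsto _).comp (intervalIntegral_tendsto_integral_Ioi 0
    (integrableOn_adjointP_sq hα hκ) (tendsto_natCast_atTop_atTop (R := ℝ)))
  refine ⟨Y, _, _, ?_, hasLaw_gaussianReal_of_ae_tendsto (fun n : ℕ =>
    hX.hasLaw_adjoint hB (T := n) n.cast_nonneg (fun t ht => hasDerivAt_adjointP hα hκ0 ht.1)
      fun t ht => hasDerivAt_adjointQ hα hκ0 ht.1) tendsto_const_nhds (hvar.const_mul _) ?_, ?_⟩
  · refine mul_pos ?_ (Real.toNNReal_pos.2 (integral_adjointP_sq_pos hα hκ))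
    rw [← NNReal.coe_pos]
    exact pow_pos hσ 2
  · filter_upwards [hpath] with ω hω
    exact (hY ω hω).1.comp tendsto_natCast_atTop_atTop
  · filter_upwards [hpath] with ω hω using (hY ω hω).2

end IsSolutionSFDE

theorem sfde_poly_growth {Ω : Type*} {mΩ : MeasurableSpace Ω} (P : Measure Ω) [IsProbabilityMeasure P]
    (F : MeasureTheory.Filtration ℝ mΩ) (a b σ : ℝ) (ψ : ℝ → ℝ) (B X : ℝ → Ω → ℝ)
    (hσ : 0 < σ) (hψ : ContinuousOn ψ (Set.Icc (-1 : ℝ) 0))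
    (hB : IsStdBrownian P F B) (hX : IsSolutionSFDE P F a b σ ψ B X)
    (ha : a < 0) (hab : 0 < a + b) :
    ∃ C : Ω → ℝ, Measurable C ∧
      (∃ m : ℝ, ∃ v : NNReal, 0 < v ∧ P.map C = gaussianReal m v) ∧
      (∀ᵐ ω ∂P, Filter.Tendsto (fun t : ℝ => t ^ (1 + b / a) * X t ω)
        Filter.atTop (nhds (C ω))) ∧
      Filter.Tendsto (fun t : ℝ => t ^ (1 + b / a) * ∫ ω, X t ω ∂P)
        Filter.atTop (nhds (∫ ω, C ω ∂P)) ∧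
      Filter.Tendsto (fun t : ℝ => t ^ (2 + 2 * b / a) * variance (X t) P)
        Filter.atTop (nhds (variance C P)) := by
  obtain ⟨α, rfl⟩ : ∃ α, a = -α := ⟨-a, by ring⟩
  have hα : 0 < α := by linarith
  obtain ⟨κ, rfl⟩ : ∃ κ, b = α * κ := ⟨b / α, by field_simp⟩
  have hκ : 1 < κ := by nlinarith
  have he : 1 + α * κ / -α = 1 - κ := by field_simp; ring
  have he2 : 2 + 2 * (α * κ) / -α = (1 - κ) * 2 := by field_simp; ring
  rw [he, he2]
  obtain ⟨Y, m, v, hv, hY, hlim⟩ := hX.exists_limit hB hσ hα hκ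
  set L := κ / (α ^ (-κ) * Gamma κ)
  have hL : 0 < L := by
    have := rpow_pos_of_pos hα (-κ)
    have := Gamma_pos_of_pos (by linarith : 0 < κ)
    positivity
  have hLY := gaussianReal_const_mul hY L
  set C := hLY.aemeasurable.mk _ with hC
  have hCY : C =ᵐ[P] fun ω => L * Y ω := hLY.aemeasurable.ae_eq_mk.symm
  have hClaw := hLY.congr hCY
  have hClim : ∀ᵐ ω ∂P, Tendsto (fun t : ℝ => t ^ (1 - κ) * X t ω) atTop (nhds (C ω)) := by
    filter_upwards [hlim, hCY] with ω h1 h2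
    rwa [h2]
  choose! mX vX hXlaw using fun T (hT : 0 ≤ T) =>
    hX.exists_hasLaw_gaussianReal hB hα (by linarith) hT
  obtain ⟨hm, hvar⟩ := tendsto_gaussianReal_params_of_ae_tendsto
    ((eventually_ge_atTop (0 : ℝ)).mono fun t ht =>
      gaussianReal_const_mul (hXlaw t ht) (t ^ (1 - κ))) hClaw hClim
  refine ⟨C, hLY.aemeasurable.measurable_mk, ⟨_, _, ?_, hClaw.map_eq⟩, hClim, ?_, ?_⟩
  · refine mul_pos ?_ hv
    rw [← NNReal.coe_pos]
    exact pow_pos hL 2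
  · rw [hClaw.integral_eq, integral_id_gaussianReal]
    refine hm.congr' ?_
    filter_upwards [eventually_ge_atTop (0 : ℝ)] with t ht
    rw [(hXlaw t ht).integral_eq, integral_id_gaussianReal]
  · rw [hClaw.variance_eq, variance_id_gaussianReal]
    refine hvar.congr' ?_
    filter_upwards [eventually_ge_atTop (0 : ℝ)] with t ht
    rw [(hXlaw t ht).variance_eq, variance_id_gaussianReal, rpow_mul ht]
    simp
end
end
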